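/- Suppose τ restricted to ∂K is a positive constant on each face. Then the HDG projection system defining (Π_V q, Π_W u) is uniquely solvable, and there is a constant C independent of K and τ such that for all ℓ_u, ℓ_q ∈ [0, k]: ‖Π_W u − u‖_{L²(K)} ≤ C h_K^{ℓ_u+1} |u|_{H^{ℓ_u+1}(K)} + C (h_K^{ℓ_q+1} / τ_K^{max}) |∇·q|_{H^{ℓ_q}(K)}, and ‖Π_V q − q‖_{L²(K)} ≤ C h_K^{ℓ_q+1} |q|_{H^{ℓ_q+1}(K)} + C h_K^{ℓ_u+1} τ_K^⋆ |u|_{H^{ℓ_u+1}(K)}, where τ_K^⋆ = max of τ over ∂K minus the face where τ is largest, and τ_K^{max} is the maximum of τ on ∂K. -/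

import Mathlib

/-!
STATEMENT 2 (well-posedness and approximation of the HDG projection, Lemma 2.4):
if `τ` is a positive constant on each face of the simplex `K`, the HDG projection
system (2.5) defining `(Π_V q, Π_W u)` is uniquely solvable, and with a constant
`C` independent of `K` and `τ`, for `ℓ_u, ℓ_q ∈ [0,k]`:
`‖Π_W u − u‖_{L²(K)} ≤ C h_K^{ℓ_u+1}|u|_{H^{ℓ_u+1}(K)} + C h_K^{ℓ_q+1}/τ_K^{max} |∇·q|_{H^{ℓ_q}(K)}`,
`‖Π_V q − q‖_{L²(K)} ≤ C h_K^{ℓ_q+1}|q|_{H^{ℓ_q+1}(K)} + C h_K^{ℓ_u+1} τ_K^⋆ |u|_{H^{ℓ_u+1}(K)}`,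
where `τ_K^{max} = max_{∂K} τ` and `τ_K^⋆ = max_{∂K \ F^⋆} τ`, `F^⋆` a face where `τ`
is maximal.  The simplex is given by its `d+1` affinely independent vertices `vv`,
its faces `Fc i = conv(vv '' {i}ᶜ)` carry the `(d−1)`-Hausdorff surface measure and
outward unit normals `n i` (unit vectors defining supporting hyperplanes). -/

open MeasureTheory ENNReal Metric Set
open scoped RealInnerProductSpace

noncomputable section

variable {d : ℕ}

local notation "E" => EuclideanSpace ℝ (Fin d)

/-- divergence of a vector field -/
def pdivD (q : E → E) (x : E) : ℝ := ∑ i, fderiv ℝ q x (EuclideanSpace.single i 1) i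

def sobSemiD {F : Type*} [NormedAddCommGroup F] [NormedSpace ℝ F]
    (j : ℕ) (p : ℝ≥0∞) (K : Set E) (f : E → F) : ℝ≥0∞ :=
  eLpNorm (fun x => ‖iteratedFDeriv ℝ j f x‖) p (volume.restrict K)

def IsPolyOnD (k : ℕ) (K : Set E) (f : E → ℝ) : Prop :=
  ∃ P : MvPolynomial (Fin d) ℝ, P.totalDegree ≤ k ∧
    ∀ x ∈ K, f x = MvPolynomial.eval (fun i => x i) P

def IsVPolyOnD (k : ℕ) (K : Set E) (f : E → E) : Prop :=
  ∀ i, IsPolyOnD k K fun x => f x i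

/-- The HDG projection system (2.5) on the simplex `K` with faces `Fc`, outward unit
normals `n`, and facewise constant stabilization `τ`: `(Pq, Pu)` is the HDG projection
of the pair `(q, u)`.  (For `k = 0` the volume conditions are vacuous.) -/
def ProjSys (d k : ℕ) (K : Set (EuclideanSpace ℝ (Fin d)))
    (Fc : Fin (d+1) → Set (EuclideanSpace ℝ (Fin d)))
    (n : Fin (d+1) → EuclideanSpace ℝ (Fin d)) (τ : Fin (d+1) → ℝ)
    (q : EuclideanSpace ℝ (Fin d) → EuclideanSpace ℝ (Fin d))
    (u : EuclideanSpace ℝ (Fin d) → ℝ)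
    (Pq : EuclideanSpace ℝ (Fin d) → EuclideanSpace ℝ (Fin d))
    (Pu : EuclideanSpace ℝ (Fin d) → ℝ) : Prop :=
  IsVPolyOnD k K Pq ∧ IsPolyOnD k K Pu ∧
  (1 ≤ k → ∀ v, IsVPolyOnD (k-1) K v → ∫ x in K, ⟪Pq x - q x, v x⟫ = 0) ∧
  (1 ≤ k → ∀ w, IsPolyOnD (k-1) K w → ∫ x in K, (Pu x - u x) * w x = 0) ∧
  (∀ i, ∀ μ, IsPolyOnD k (Fc i) μ →
    ∫ x, (⟪Pq x - q x, n i⟫ + τ i * (Pu x - u x)) * μ x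
      ∂((μH[(d : ℝ) - 1]).restrict (Fc i)) = 0)

namespace HDG

/-- `PolyLT n p` says that `p` is a polynomial function of total degree less than `n`. -/
inductive PolyLT : ℕ → ((Fin d → ℝ) → ℝ) → Prop
  | zero (n : ℕ) : PolyLT n fun _ => 0
  | const (n : ℕ) (c : ℝ) : PolyLT (n + 1) fun _ => c
  | coord_mul {n : ℕ} {p : (Fin d → ℝ) → ℝ} (i : Fin d) (hp : PolyLT n p) :
      PolyLT (n + 1) fun x => x i * p x
  | add {n : ℕ} {p q : (Fin d → ℝ) → ℝ} (hp : PolyLT n p) (hq : PolyLT n q) :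
      PolyLT n fun x => p x + q x

namespace PolyLT

variable {n m : ℕ} {p q : (Fin d → ℝ) → ℝ}

theorem eq_zero (h : PolyLT 0 p) : p = fun _ => 0 := by
  generalize hn : 0 = n at h
  induction h with
  | zero => rfl
  | const => omega
  | coord_mul => omega
  | add _ _ ih₁ ih₂ => subst hn; simp [ih₁ rfl, ih₂ rfl]

theorem const_mul (c : ℝ) (h : PolyLT n p) : PolyLT n fun x => c * p x := by
  induction h with
  | zero n => simpa using zero n
  | const n a => exact const n _
  | coord_mul i _ ih => simpa [mul_left_comm] using coord_mul i ih
  | add _ _ ih₁ ih₂ => simpa [mul_add] using ih₁.add ih₂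

theorem mono (h : PolyLT n p) (hnm : n ≤ m) : PolyLT m p := by
  induction h generalizing m with
  | zero n => exact zero m
  | const n a => obtain ⟨m, rfl⟩ := Nat.exists_eq_add_of_le' (Nat.le_of_add_left_le hnm); exact const m _
  | coord_mul i _ ih =>
    obtain ⟨m, rfl⟩ := Nat.exists_eq_add_of_le' (Nat.le_of_add_left_le hnm)
    exact coord_mul i (ih (by omega))
  | add _ _ ih₁ ih₂ => exact (ih₁ hnm).add (ih₂ hnm)

theorem neg (h : PolyLT n p) : PolyLT n fun x => -p x := by simpa using h.const_mul (-1)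

theorem sub (hp : PolyLT n p) (hq : PolyLT n q) : PolyLT n fun x => p x - q x := by
  simpa [sub_eq_add_neg] using hp.add hq.neg

theorem sum {ι : Type*} (s : Finset ι) {f : ι → (Fin d → ℝ) → ℝ}
    (h : ∀ i ∈ s, PolyLT n (f i)) : PolyLT n fun x => ∑ i ∈ s, f i x := by
  classical
  induction s using Finset.induction_on with
  | empty => simpa using zero n
  | insert a s ha ih =>
    simp only [Finset.sum_insert ha]
    exact (h a (by simp)).add (ih fun i hi => h i (by simp [hi]))

theorem contDiff {r : WithTop ℕ∞} (h : PolyLT n p) : ContDiff ℝ r p := by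
  induction h with
  | zero => fun_prop
  | const => fun_prop
  | coord_mul i _ ih => fun_prop
  | add _ _ ih₁ ih₂ => fun_prop

theorem continuous (h : PolyLT n p) : Continuous p := (h.contDiff (r := 0)).continuous

theorem differentiable (h : PolyLT n p) : Differentiable ℝ p :=
  (h.contDiff (r := 1)).differentiable (by norm_num)

theorem partialDeriv (h : PolyLT n p) (v : Fin d → ℝ) :
    PolyLT (n - 1) fun x => fderiv ℝ p x v := by
  induction h with
  | zero n => simpa using zero _
  | const n c => simpa using zero _
  | @coord_mul n p i hp ih =>
    have : (fun x => fderiv ℝ (fun x => x i * p x) x v) =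
        fun x => x i * fderiv ℝ p x v + v i * p x := by
      ext x
      have h1 : HasFDerivAt (fun x : Fin d → ℝ => x i)
          (ContinuousLinearMap.proj (R := ℝ) (φ := fun _ : Fin d => ℝ) i) x := hasFDerivAt_apply i x
      rw [(h1.fun_mul (hp.differentiable x).hasFDerivAt).fderiv]
      simp [mul_comm]
    rw [this]
    rcases n with _ | n
    · simpa [hp.eq_zero] using zero 0
    · exact (coord_mul i ih).add (hp.const_mul _)
  | add hp hq ih₁ ih₂ =>
    convert ih₁.add ih₂ using 2 with x
    rw [fderiv_fun_add (hp.differentiable x) (hq.differentiable x)]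
    simp

theorem mul (hp : PolyLT n p) (hq : PolyLT m q) : PolyLT (n + m - 1) fun x => p x * q x := by
  induction hp with
  | zero n => simpa using zero _
  | const n c => exact (hq.const_mul c).mono (by omega)
  | @coord_mul n p i hp ih =>
    rcases n with _ | n
    · simpa [hp.eq_zero] using zero _
    · simpa [mul_assoc] using (coord_mul i ih).mono (by omega)
  | add _ _ ih₁ ih₂ => simpa [add_mul] using ih₁.add ih₂

theorem coord (i : Fin d) : PolyLT 2 fun x : Fin d → ℝ => x i := by
  simpa using coord_mul i (const 0 1)

theorem comp {d' : ℕ} {φ : (Fin d' → ℝ) → Fin d → ℝ} (h : PolyLT n p)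
    (hφ : ∀ i, PolyLT 2 fun x => φ x i) : PolyLT n fun x => p (φ x) := by
  induction h with
  | zero n => exact zero n
  | const n c => exact const n c
  | coord_mul i _ ih => exact ((hφ i).mul ih).mono (by omega)
  | add _ _ ih₁ ih₂ => exact ih₁.add ih₂

theorem exists_factor (h : PolyLT n p) {l : (Fin d → ℝ) → ℝ} (hl : PolyLT 2 l) (e : Fin d → ℝ) :
    ∃ s, PolyLT (n - 1) s ∧ ∀ x, p x - p (x - l x • e) = l x * s x := by
  have hπ : ∀ i, PolyLT 2 fun x => (x - l x • e) i := fun i => by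
    simpa [mul_comm] using (coord i).sub (hl.const_mul (e i))
  induction h with
  | zero n => exact ⟨_, zero _, by simp⟩
  | const n c => exact ⟨_, zero _, by simp⟩
  | @coord_mul n p i hp ih =>
    obtain ⟨s, hs, hps⟩ := ih
    rcases n with _ | n
    · exact ⟨_, zero _, by simp [hp.eq_zero]⟩
    · refine ⟨_, (coord_mul i hs).add ((hp.comp hπ).const_mul (e i)), fun x => ?_⟩
      have := hps x
      simp only [Pi.sub_apply, Pi.smul_apply, smul_eq_mul]
      linear_combination x i * this
  | add _ _ ih₁ ih₂ =>
    obtain ⟨s, hs, h₁⟩ := ih₁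
    obtain ⟨t, ht, h₂⟩ := ih₂
    exact ⟨_, hs.add ht, fun x => by linear_combination h₁ x + h₂ x⟩

theorem prod {j : ℕ} (f : Fin j → (Fin d → ℝ) → ℝ) (hf : ∀ i, PolyLT 2 (f i)) :
    PolyLT (j + 1) fun x => ∏ i, f i x := by
  induction j with
  | zero => simpa using const 0 1
  | succ j ih =>
    simp only [Fin.prod_univ_succ]
    exact ((hf 0).mul (ih (fun i => f i.succ) fun i => hf _)).mono (by omega)

theorem exists_mvPolynomial (h : PolyLT n p) : ∃ P : MvPolynomial (Fin d) ℝ,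
    P.totalDegree ≤ n - 1 ∧ ∀ x, p x = MvPolynomial.eval x P := by
  induction h with
  | zero n => exact ⟨0, by simp⟩
  | const n c => exact ⟨MvPolynomial.C c, by simp⟩
  | @coord_mul n p i hp ih =>
    obtain ⟨P, hP, hPe⟩ := ih
    rcases n with _ | n
    · exact ⟨0, by simp [hp.eq_zero]⟩
    · refine ⟨MvPolynomial.X i * P, ?_, fun x => by simp [hPe]⟩
      refine (MvPolynomial.totalDegree_mul _ _).trans ?_
      rw [MvPolynomial.totalDegree_X]
      omega
  | add _ _ ih₁ ih₂ =>
    obtain ⟨P, hP, hPe⟩ := ih₁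
    obtain ⟨Q, hQ, hQe⟩ := ih₂
    exact ⟨P + Q, (MvPolynomial.totalDegree_add _ _).trans (max_le hP hQ),
      fun x => by simp [hPe, hQe]⟩

theorem eval_mvPolynomial (P : MvPolynomial (Fin d) ℝ) (hP : P.totalDegree ≤ n) :
    PolyLT (n + 1) fun x : Fin d → ℝ => MvPolynomial.eval x P := by
  have hmon : ∀ s : Multiset (Fin d), PolyLT (s.card + 1) fun x : Fin d → ℝ => (s.map x).prod := by
    intro s
    induction s using Multiset.induction_on with
    | empty => simpa using const 0 1
    | cons a s ih => simpa using coord_mul a ih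
  simp only [MvPolynomial.eval_eq]
  refine sum _ fun s hs => const_mul _ ?_
  have h := (hmon s.toMultiset).mono (m := n + 1) (by
    have := MvPolynomial.le_totalDegree hs
    rw [Finsupp.card_toMultiset]
    exact Nat.succ_le_succ (this.trans hP))
  convert h using 2 with x
  rw [Finsupp.toMultiset_map, Finsupp.prod_toMultiset, Finsupp.prod_mapDomain_index (by simp) (by simp [pow_add])]
  simp [Finsupp.prod]

end PolyLT

/-- The space of polynomial functions of total degree less than `n`. -/
def polyLT (d n : ℕ) : Submodule ℝ ((Fin d → ℝ) → ℝ) where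
  carrier := {p | PolyLT n p}
  zero_mem' := .zero n
  add_mem' := .add
  smul_mem' c _ h := h.const_mul c

theorem mem_polyLT {n : ℕ} {p : (Fin d → ℝ) → ℝ} : p ∈ polyLT d n ↔ PolyLT n p := Iff.rfl

instance finiteDimensional_polyLT (d n : ℕ) : FiniteDimensional ℝ (polyLT d n) := by
  induction n with
  | zero =>
    have : polyLT d 0 = ⊥ := eq_bot_iff.2 fun p hp => (PolyLT.eq_zero hp)
    rw [this]
    infer_instance
  | succ n ih =>
    let W : Submodule ℝ ((Fin d → ℝ) → ℝ) :=
      Submodule.span ℝ {fun _ => 1} ⊔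
        ⨆ i : Fin d, (polyLT d n).map (LinearMap.mulLeft ℝ (fun x : Fin d → ℝ => x i))
    have hW : FiniteDimensional ℝ W := inferInstance
    have hle : polyLT d (n + 1) ≤ W := by
      intro p hp
      have key : ∀ {m : ℕ} {p : (Fin d → ℝ) → ℝ}, PolyLT m p → m = n + 1 → p ∈ W := by
        intro m p h
        induction h with
        | zero => exact fun _ => W.zero_mem
        | const m c =>
          intro _
          refine Submodule.mem_sup_left (Submodule.mem_span_singleton.2 ⟨c, ?_⟩)
          ext; simp
        | coord_mul i hq =>
          intro h
          obtain rfl : _ = n := by simpa using h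
          exact Submodule.mem_sup_right (Submodule.mem_iSup_of_mem i ⟨_, hq, rfl⟩)
        | add _ _ ih₁ ih₂ => exact fun h => W.add_mem (ih₁ h) (ih₂ h)
      exact key hp rfl
    exact Submodule.finiteDimensional_of_le hle

theorem exists_hausdorffMeasure_restrict_image_eq {X : Type*} [NormedAddCommGroup X]
    [NormedSpace ℝ X] [MeasurableSpace X] [BorelSpace X] {m : ℕ} (L : (Fin m → ℝ) →ₗ[ℝ] X)
    (hL : Function.Injective L) (b : X) :
    ∃ c : ℝ≥0∞, c ≠ 0 ∧ c ≠ ∞ ∧ ∀ s : Set (Fin m → ℝ),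
      (μH[(m : ℝ)] : Measure X).restrict ((fun y => b + L y) '' s) =
        c • (volume.restrict s).map fun y => b + L y := by
  let R := LinearMap.range L
  let e : (Fin m → ℝ) ≃L[ℝ] R := (LinearEquiv.ofInjective L hL).toContinuousLinearEquiv
  have hR : Module.finrank ℝ R = m := by
    rw [← e.toLinearEquiv.finrank_eq]; simp
  have hHaar : (μH[(m : ℝ)] : Measure R).IsAddHaarMeasure := by
    have h : (μH[(Module.finrank ℝ R : ℝ)] : Measure R).IsAddHaarMeasure := inferInstance
    rwa [hR] at h
  have hHaar' : ((μH[(m : ℝ)] : Measure R).map e.symm).IsAddHaarMeasure :=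
    e.symm.isAddHaarMeasure_map _
  obtain ⟨c, hc0, hct, hc⟩ : ∃ c : ℝ≥0∞, c ≠ 0 ∧ c ≠ ∞ ∧
      (μH[(m : ℝ)] : Measure R).map e.symm = c • (volume : Measure (Fin m → ℝ)) :=
    ⟨_, ENNReal.coe_ne_zero.2 (Measure.addHaarScalarFactor_pos_of_isAddHaarMeasure _ _).ne',
      ENNReal.coe_ne_top, Measure.isAddLeftInvariant_eq_smul _ _⟩
  refine ⟨c, hc0, hct, fun s => ?_⟩
  have h1 : (μH[(m : ℝ)] : Measure R) = c • (volume : Measure (Fin m → ℝ)).map e := by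
    rw [← Measure.map_smul, ← hc, Measure.map_map e.continuous.measurable e.symm.continuous.measurable]
    simp
  have hiso : Isometry fun z : R => b + (z : X) :=
    (IsometryEquiv.addLeft b).isometry.comp isometry_subtype_coe
  have h2 := hiso.map_hausdorffMeasure (d := m) (Or.inl (by positivity))
  rw [h1, Measure.map_smul, Measure.map_map hiso.continuous.measurable e.continuous.measurable] at h2
  have hcomp : ((fun z : R => b + (z : X)) ∘ e) = fun y => b + L y := by
    ext y; rfl
  rw [hcomp] at h2
  have hemb : MeasurableEmbedding fun y => b + L y := by
    have hcl : Topology.IsClosedEmbedding fun y => b + L y :=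
      (Homeomorph.addLeft b).isClosedEmbedding.comp (LinearMap.isClosedEmbedding_of_injective
        (LinearMap.ker_eq_bot.2 hL))
    exact hcl.measurableEmbedding
  have hsub : (fun y => b + L y) '' s ⊆ range fun z : R => b + (z : X) := by
    rintro _ ⟨y, -, rfl⟩
    exact ⟨e y, rfl⟩
  have h3 := congrArg (fun μ : Measure X => μ.restrict ((fun y => b + L y) '' s)) h2
  simp only [Measure.restrict_smul] at h3
  rw [hemb.restrict_map, preimage_image_eq _ hemb.injective,
    Measure.restrict_restrict_of_subset hsub] at h3
  exact h3.symm

/-- Barycentric coordinates on the reference simplex. -/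
def lam (i : Fin (d + 1)) (x : Fin d → ℝ) : ℝ := Fin.cases (1 - ∑ j, x j) x i

/-- Differentials of the barycentric coordinates. -/
def dlam (i : Fin (d + 1)) : (Fin d → ℝ) →ₗ[ℝ] ℝ :=
  Fin.cases (-∑ j, LinearMap.proj j) (fun j => LinearMap.proj j) i

@[simp] theorem lam_zero (x : Fin d → ℝ) : lam 0 x = 1 - ∑ j, x j := rfl
@[simp] theorem lam_succ (j : Fin d) (x : Fin d → ℝ) : lam j.succ x = x j := rfl
@[simp] theorem dlam_zero (x : Fin d → ℝ) : dlam 0 x = -∑ j, x j := by simp [dlam]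
@[simp] theorem dlam_succ (j : Fin d) (x : Fin d → ℝ) : dlam j.succ x = x j := rfl

theorem lam_add (i : Fin (d + 1)) (x y : Fin d → ℝ) : lam i (x + y) = lam i x + dlam i y := by
  cases i using Fin.cases <;> simp [Finset.sum_add_distrib]; ring

theorem sum_lam (x : Fin d → ℝ) : ∑ i, lam i x = 1 := by simp [Fin.sum_univ_succ]

theorem continuous_lam (i : Fin (d + 1)) : Continuous (lam i) := by
  cases i using Fin.cases
  · exact continuous_const.sub (continuous_finsetSum _ fun j _ => continuous_apply j)
  · exact continuous_apply _

theorem polyLT_lam (i : Fin (d + 1)) : PolyLT 2 (lam (d := d) i) := by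
  cases i using Fin.cases
  · exact ((PolyLT.const 0 1).mono (by norm_num)).sub (PolyLT.sum _ fun j _ => PolyLT.coord j)
  · exact PolyLT.coord _

/-- The reference simplex. -/
def simplex (d : ℕ) : Set (Fin d → ℝ) := {x | ∀ i, 0 ≤ lam i x}

theorem isClosed_simplex : IsClosed (simplex d) := by
  simp only [simplex, ofPred_forall]
  exact isClosed_iInter fun i => isClosed_le continuous_const (continuous_lam i)

theorem mem_simplex {x : Fin d → ℝ} : x ∈ simplex d ↔ (∀ j, 0 ≤ x j) ∧ ∑ j, x j ≤ 1 := by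
  simp only [simplex, mem_ofPred_eq, Fin.forall_fin_succ, lam_zero, lam_succ, sub_nonneg]
  tauto

theorem lam_le_one {x : Fin d → ℝ} (hx : x ∈ simplex d) (i : Fin (d + 1)) : lam i x ≤ 1 := by
  rw [← sum_lam x]
  exact Finset.single_le_sum (fun i _ => hx i) (Finset.mem_univ i)

theorem isCompact_simplex : IsCompact (simplex d) := by
  refine (isCompact_Icc (a := (0 : Fin d → ℝ)) (b := 1)).of_isClosed_subset isClosed_simplex ?_
  exact fun x hx => ⟨fun j => hx j.succ, fun j => lam_le_one hx j.succ⟩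

theorem measurableSet_simplex : MeasurableSet (simplex d) := isClosed_simplex.measurableSet

theorem convex_simplex : Convex ℝ (simplex d) := by
  intro x hx y hy a b ha hb hab
  rw [mem_simplex] at *
  refine ⟨fun j => add_nonneg (mul_nonneg ha (hx.1 j)) (mul_nonneg hb (hy.1 j)), ?_⟩
  simp only [Pi.add_apply, Pi.smul_apply, smul_eq_mul, Finset.sum_add_distrib, ← Finset.mul_sum]
  nlinarith [mul_le_mul_of_nonneg_left hx.2 ha, mul_le_mul_of_nonneg_left hy.2 hb]

/-- The open reference simplex. -/
def openSimplex (d : ℕ) : Set (Fin d → ℝ) := {x | ∀ i, 0 < lam i x}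

theorem isOpen_openSimplex : IsOpen (openSimplex d) := by
  simp only [openSimplex, ofPred_forall]
  exact isOpen_iInter_of_finite fun i => isOpen_lt continuous_const (continuous_lam i)

theorem openSimplex_nonempty : (openSimplex d).Nonempty := by
  refine ⟨fun _ => 1 / (d + 1), fun i => ?_⟩
  cases i using Fin.cases
  · have : (0 : ℝ) < d + 1 := by positivity
    simp only [lam_zero, Finset.sum_const, Finset.card_univ, Fintype.card_fin, nsmul_eq_mul]
    rw [sub_pos, mul_one_div, div_lt_one this]
    linarith
  · simp only [lam_succ]; positivity

theorem openSimplex_subset : openSimplex d ⊆ simplex d := fun _ hx i => (hx i).le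

theorem volume_simplex_pos : 0 < volume (simplex d) :=
  (isOpen_openSimplex.measure_pos volume openSimplex_nonempty).trans_le
    (measure_mono openSimplex_subset)

theorem volume_simplex_lt_top : volume (simplex d) < ∞ := isCompact_simplex.measure_lt_top

/-- The face of the reference simplex on which the `i`-th barycentric coordinate vanishes. -/
def face (i : Fin (d + 1)) : Set (Fin d → ℝ) := {x ∈ simplex d | lam i x = 0}

theorem PolyLT.eq_zero_of_openSimplex {n : ℕ} {p : (Fin d → ℝ) → ℝ} (h : PolyLT n p)
    (h0 : ∀ x ∈ openSimplex d, p x = 0) : p = 0 := by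
  obtain ⟨x₀, hx₀⟩ := openSimplex_nonempty (d := d)
  refine AnalyticOnNhd.eq_of_eventuallyEq (𝕜 := ℝ) (z₀ := x₀)
    (fun x _ => (h.contDiff (r := ⊤)).contDiffAt.analyticAt) (fun x _ => analyticAt_const) ?_
  filter_upwards [isOpen_openSimplex.mem_nhds hx₀] with x hx using h0 x hx

theorem eqOn_zero_of_setIntegral_eq_zero {f : (Fin d → ℝ) → ℝ} (hf : Continuous f)
    (h0 : ∀ x ∈ simplex d, 0 ≤ f x) (hi : ∫ x in simplex d, f x = 0) :
    ∀ x ∈ openSimplex d, f x = 0 := by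
  have hint : IntegrableOn f (simplex d) := hf.continuousOn.integrableOn_compact isCompact_simplex
  rw [setIntegral_eq_zero_iff_of_nonneg_ae ((ae_restrict_iff' measurableSet_simplex).2
    (Filter.Eventually.of_forall h0)) hint] at hi
  have h1 : f =ᵐ[volume.restrict (openSimplex d)] fun _ => 0 :=
    ae_restrict_of_ae_restrict_of_subset openSimplex_subset hi
  exact Measure.eqOn_open_of_ae_eq h1 isOpen_openSimplex hf.continuousOn continuousOn_const

section ReferenceFaces

variable {m : ℕ}

/-- Insertion of a linear functional of `y` as the `j`-th coordinate. -/
def insertLin (j : Fin (m + 1)) (a : (Fin m → ℝ) →ₗ[ℝ] ℝ) :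
    (Fin m → ℝ) →ₗ[ℝ] (Fin (m + 1) → ℝ) where
  toFun y := j.insertNth (a y) y
  map_add' x y := by
    ext k
    rcases Fin.eq_self_or_eq_succAbove j k with rfl | ⟨k, rfl⟩ <;> simp
  map_smul' c x := by
    ext k
    rcases Fin.eq_self_or_eq_succAbove j k with rfl | ⟨k, rfl⟩ <;> simp

theorem insertLin_apply (j : Fin (m + 1)) (a : (Fin m → ℝ) →ₗ[ℝ] ℝ) (y : Fin m → ℝ) :
    insertLin j a y = (j.insertNth (a y) y : Fin (m + 1) → ℝ) := rfl

theorem insertLin_injective (j : Fin (m + 1)) (a : (Fin m → ℝ) →ₗ[ℝ] ℝ) :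
    Function.Injective (insertLin j a) := by
  intro x y h
  ext k
  simpa [insertLin_apply] using congrFun h (j.succAbove k)

theorem insertNth_add_single (j : Fin (m + 1)) (s t : ℝ) (y : Fin m → ℝ) :
    (j.insertNth (t + s) y : Fin (m + 1) → ℝ) = Pi.single j s + j.insertNth t y := by
  ext k
  rcases Fin.eq_self_or_eq_succAbove j k with rfl | ⟨k, rfl⟩ <;> simp [add_comm]

/-- Parametrization of the slanted face of the reference simplex, omitting coordinate `j`. -/
def slant (j : Fin (m + 1)) (y : Fin m → ℝ) : Fin (m + 1) → ℝ := j.insertNth (1 - ∑ i, y i) y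

/-- Parametrization of the faces of the reference simplex. -/
def faceMap (i : Fin (m + 2)) (y : Fin m → ℝ) : Fin (m + 1) → ℝ :=
  Fin.cases (slant 0 y) (fun j => j.insertNth 0 y) i

theorem slant_eq (j : Fin (m + 1)) :
    slant j = fun y => Pi.single j 1 + insertLin j (-∑ i, LinearMap.proj i) y := by
  ext1 y
  rw [slant, insertLin_apply, ← insertNth_add_single]
  simp [neg_add_eq_sub]

theorem faceMap_succ_eq (j : Fin (m + 1)) : faceMap j.succ = fun y => 0 + insertLin j 0 y := by
  ext1 y
  simp [faceMap, insertLin_apply]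

theorem exists_faceMap_eq (i : Fin (m + 2)) : ∃ (b : Fin (m + 1) → ℝ)
    (L : (Fin m → ℝ) →ₗ[ℝ] (Fin (m + 1) → ℝ)), Function.Injective L ∧
      faceMap i = fun y => b + L y := by
  cases i using Fin.cases with
  | zero => exact ⟨_, _, insertLin_injective _ _, slant_eq 0⟩
  | succ j => exact ⟨_, _, insertLin_injective _ _, faceMap_succ_eq j⟩

theorem continuous_slant (j : Fin (m + 1)) : Continuous (slant j) := by
  rw [slant_eq]
  exact continuous_const.add (LinearMap.continuous_of_finiteDimensional _)

theorem continuous_faceMap (i : Fin (m + 2)) : Continuous (faceMap i) := by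
  obtain ⟨b, L, -, h⟩ := exists_faceMap_eq i
  rw [h]
  exact continuous_const.add (LinearMap.continuous_of_finiteDimensional _)

theorem insertNth_mem_simplex {j : Fin (m + 1)} {t : ℝ} {y : Fin m → ℝ} :
    (j.insertNth t y : Fin (m + 1) → ℝ) ∈ simplex (m + 1) ↔
      y ∈ simplex m ∧ t ∈ Icc 0 (1 - ∑ i, y i) := by
  rw [mem_simplex, mem_simplex, Fin.forall_iff_succAbove j, Fin.sum_univ_succAbove _ j]
  simp only [Fin.insertNth_apply_same, Fin.insertNth_apply_succAbove, mem_Icc]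
  constructor
  · rintro ⟨⟨h1, h2⟩, h3⟩
    exact ⟨⟨h2, by linarith⟩, h1, by linarith⟩
  · rintro ⟨⟨h1, h2⟩, h3, h4⟩
    exact ⟨⟨h3, h1⟩, by linarith⟩

theorem exists_insertNth (j : Fin (m + 1)) (x : Fin (m + 1) → ℝ) :
    ∃ t y, x = (j.insertNth t y : Fin (m + 1) → ℝ) :=
  ⟨x j, j.removeNth x, (Fin.insertNth_self_removeNth j x).symm⟩

theorem slant_image (j : Fin (m + 1)) : slant j '' simplex m = face 0 := by
  ext x
  obtain ⟨t, y, rfl⟩ := exists_insertNth j x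
  simp only [face, mem_sep_iff, insertNth_mem_simplex, lam_zero, Fin.sum_univ_succAbove _ j,
    Fin.insertNth_apply_same, Fin.insertNth_apply_succAbove]
  constructor
  · rintro ⟨z, hz, h⟩
    obtain ⟨h1, rfl⟩ := Fin.insertNth_inj.1 h
    have := (mem_simplex.1 hz).2
    exact ⟨⟨hz, by simp [← h1, this]⟩, by linarith⟩
  · rintro ⟨⟨hy, -⟩, h⟩
    exact ⟨y, hy, by rw [slant]; congr; linarith⟩

theorem faceMap_image (i : Fin (m + 2)) : faceMap i '' simplex m = face i := by
  cases i using Fin.cases with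
  | zero => exact slant_image 0
  | succ j =>
    ext x
    obtain ⟨t, y, rfl⟩ := exists_insertNth j x
    simp only [face, mem_sep_iff, insertNth_mem_simplex, lam_succ, Fin.insertNth_apply_same,
      faceMap, Fin.cases_succ]
    constructor
    · rintro ⟨z, hz, h⟩
      have h' : (j.insertNth 0 z : Fin (m + 1) → ℝ) = j.insertNth t y := h
      obtain ⟨rfl, rfl⟩ := Fin.insertNth_inj.1 h'
      exact ⟨⟨hz, by simpa using (mem_simplex.1 hz).2⟩, rfl⟩
    · rintro ⟨⟨hy, -⟩, rfl⟩
      exact ⟨y, hy, rfl⟩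

/-- Surface measure on the faces of the reference simplex, in the coordinates of `faceMap`. -/
def faceMeasure (i : Fin (m + 2)) : Measure (Fin (m + 1) → ℝ) :=
  (volume.restrict (simplex m)).map (faceMap i)

theorem faceMeasure_zero_eq (j : Fin (m + 1)) :
    faceMeasure (0 : Fin (m + 2)) = (volume.restrict (simplex m)).map (slant j) := by
  obtain ⟨c, hc0, hct, hc⟩ := exists_hausdorffMeasure_restrict_image_eq _
    (insertLin_injective (0 : Fin (m + 1)) (-∑ i, LinearMap.proj i)) (Pi.single 0 1)
  obtain ⟨c', hc0', hct', hc'⟩ := exists_hausdorffMeasure_restrict_image_eq _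
    (insertLin_injective j (-∑ i, LinearMap.proj i)) (Pi.single j 1)
  rw [← slant_eq] at hc hc'
  have h1 := hc (simplex m)
  have h2 := hc' (simplex m)
  rw [slant_image] at h1 h2
  have h3 := congrArg (fun μ : Measure (Fin (m + 1) → ℝ) => μ univ) (h1.symm.trans h2)
  simp only [Measure.smul_apply, smul_eq_mul] at h3
  rw [Measure.map_apply (continuous_slant _).measurable MeasurableSet.univ,
    Measure.map_apply (continuous_slant _).measurable MeasurableSet.univ, preimage_univ, preimage_univ,
    Measure.restrict_apply_univ, ENNReal.mul_left_inj volume_simplex_pos.ne'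
      volume_simplex_lt_top.ne] at h3
  subst h3
  have h4 := congrArg (fun μ => c⁻¹ • μ) (h1.symm.trans h2)
  simp only [smul_smul, ENNReal.inv_mul_cancel hc0 hct, one_smul] at h4
  exact h4

theorem integral_faceMeasure (i : Fin (m + 2)) {f : (Fin (m + 1) → ℝ) → ℝ} (hf : Continuous f) :
    ∫ x, f x ∂faceMeasure i = ∫ y in simplex m, f (faceMap i y) :=
  integral_map (continuous_faceMap i).measurable.aemeasurable hf.aestronglyMeasurable

instance isFiniteMeasure_faceMeasure (i : Fin (m + 2)) : IsFiniteMeasure (faceMeasure i) := by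
  have : IsFiniteMeasure (volume.restrict (simplex m)) :=
    ⟨by simpa using volume_simplex_lt_top⟩
  exact Measure.isFiniteMeasure_map _ _

theorem isClosed_face (i : Fin (d + 1)) : IsClosed (face i) :=
  isClosed_simplex.inter (isClosed_eq (continuous_lam i) continuous_const)

theorem isCompact_face (i : Fin (d + 1)) : IsCompact (face i) :=
  isCompact_simplex.of_isClosed_subset (isClosed_face i) (sep_subset _ _)

theorem ae_mem_face (i : Fin (m + 2)) : ∀ᵐ x ∂faceMeasure i, x ∈ face i := by
  rw [faceMeasure, ae_map_iff (p := (· ∈ face i)) (continuous_faceMap i).measurable.aemeasurable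
    (isClosed_face i).measurableSet]
  filter_upwards [ae_restrict_mem measurableSet_simplex] with y hy
  exact faceMap_image i ▸ mem_image_of_mem _ hy

theorem integrable_faceMeasure (i : Fin (m + 2)) {f : (Fin (m + 1) → ℝ) → ℝ}
    (hf : Continuous f) : Integrable f (faceMeasure i) := by
  have h := hf.continuousOn.integrableOn_compact (μ := faceMeasure i) (isCompact_face i)
  rwa [IntegrableOn, Measure.restrict_eq_self_of_ae_mem (ae_mem_face i)] at h

theorem integrableOn_simplex {f : (Fin d → ℝ) → ℝ} (hf : Continuous f) :
    IntegrableOn f (simplex d) := hf.continuousOn.integrableOn_compact isCompact_simplex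

theorem integral_fderiv_single {f : (Fin (m + 1) → ℝ) → ℝ} (hf : ContDiff ℝ 1 f)
    (j : Fin (m + 1)) :
    ∫ x in simplex (m + 1), fderiv ℝ f x (Pi.single j 1) =
      (∫ x, f x ∂faceMeasure 0) - ∫ x, f x ∂faceMeasure j.succ := by
  have hg : Continuous fun x => fderiv ℝ f x (Pi.single j 1) :=
    (hf.continuous_fderiv (by norm_num)).clm_apply continuous_const
  have hslant : ∫ x, f x ∂faceMeasure (0 : Fin (m + 2)) = ∫ y in simplex m, f (slant j y) := by
    rw [faceMeasure_zero_eq j]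
    exact integral_map (continuous_slant j).measurable.aemeasurable
      hf.continuous.aestronglyMeasurable
  have hm := volume_preserving_piFinSuccAbove (fun _ : Fin (m + 1) => ℝ) j
  set g : (Fin (m + 1) → ℝ) → ℝ :=
    (simplex (m + 1)).indicator fun x => fderiv ℝ f x (Pi.single j 1) with hgdef
  have hgi : Integrable g volume := (integrable_indicator_iff measurableSet_simplex).2
    (integrableOn_simplex hg)
  rw [hslant, integral_faceMeasure _ hf.continuous, ← integral_indicator measurableSet_simplex,
    ← hm.symm.integral_comp' g]
  have hgi' : Integrable (fun p => g ((MeasurableEquiv.piFinSuccAbove (fun _ : Fin (m + 1) => ℝ)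
      j).symm p)) (volume.prod volume) := (hm.symm.integrable_comp_emb
        (MeasurableEquiv.measurableEmbedding _)).2 hgi
  rw [Measure.volume_eq_prod, integral_prod_symm _ hgi', ← integral_sub,
    ← integral_indicator measurableSet_simplex]
  · congr 1
    ext y
    have hins : ∀ t, (MeasurableEquiv.piFinSuccAbove (fun _ : Fin (m + 1) => ℝ) j).symm (t, y) =
      (j.insertNth t y : Fin (m + 1) → ℝ) := fun t => rfl
    simp only [hins]
    by_cases hy : y ∈ simplex m
    · have h1 : (0 : ℝ) ≤ 1 - ∑ i, y i := sub_nonneg.2 (mem_simplex.1 hy).2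
      have hind : (fun t : ℝ => g (j.insertNth t y)) = (Icc 0 (1 - ∑ i, y i)).indicator
          fun t => fderiv ℝ f (j.insertNth t y) (Pi.single j 1) := by
        ext t
        simp only [hgdef, indicator, insertNth_mem_simplex, hy, true_and]
      rw [hind, integral_indicator measurableSet_Icc, integral_Icc_eq_integral_Ioc,
        ← intervalIntegral.integral_of_le h1, indicator_of_mem hy]
      have hline : ∀ t : ℝ, (j.insertNth t y : Fin (m + 1) → ℝ) =
          t • Pi.single j 1 + j.insertNth 0 y := fun t => by
        rw [← Pi.single_smul, ← insertNth_add_single]; simp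
      have hd : ∀ t : ℝ, HasDerivAt (fun t : ℝ => f (j.insertNth t y))
          (fderiv ℝ f (j.insertNth t y) (Pi.single j 1)) t := fun t => by
        have h2 : HasDerivAt (fun t : ℝ => (j.insertNth t y : Fin (m + 1) → ℝ))
            (Pi.single j 1) t := by
          rw [funext hline]
          simpa using ((hasDerivAt_id t).smul_const (Pi.single j (1 : ℝ))).add_const
            (j.insertNth 0 y : Fin (m + 1) → ℝ)
        exact ((hf.differentiable (by norm_num)) _).hasFDerivAt.comp_hasDerivAt t h2
      have hcont : Continuous fun t : ℝ => (j.insertNth t y : Fin (m + 1) → ℝ) := by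
        rw [funext hline]; fun_prop
      rw [intervalIntegral.integral_eq_sub_of_hasDerivAt (fun t _ => hd t)
        ((hg.comp hcont).intervalIntegrable _ _)]
      rfl
    · rw [indicator_of_notMem hy]
      have : ∀ t : ℝ, g (j.insertNth t y) = 0 := fun t => indicator_of_notMem
        (fun h => hy (insertNth_mem_simplex.1 h).1) _
      simp [this]
  · exact integrableOn_simplex (hf.continuous.comp (continuous_slant j))
  · exact integrableOn_simplex (hf.continuous.comp (continuous_faceMap _))

theorem integral_fderiv_apply {f : (Fin (m + 1) → ℝ) → ℝ} (hf : ContDiff ℝ 1 f)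
    (v : Fin (m + 1) → ℝ) :
    ∫ x in simplex (m + 1), fderiv ℝ f x v = -∑ i, dlam i v * ∫ x, f x ∂faceMeasure i := by
  have hv : v = ∑ j, v j • Pi.single j (1 : ℝ) := by
    simpa using pi_eq_sum_univ' v
  have h1 : ∀ x, fderiv ℝ f x v = ∑ j, v j * fderiv ℝ f x (Pi.single j 1) := fun x => by
    conv_lhs => rw [hv]
    simp
  simp only [h1]
  rw [integral_finsetSum _ fun j _ => ?_]
  · simp only [integral_const_mul, integral_fderiv_single hf]
    rw [Fin.sum_univ_succ (n := m + 1)]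
    simp only [dlam_zero, dlam_succ, mul_sub, Finset.sum_sub_distrib, ← Finset.sum_mul]
    ring
  · exact (integrableOn_simplex ((hf.continuous_fderiv (by norm_num)).clm_apply
      continuous_const)).const_mul _

end ReferenceFaces

/-- Measures for which every continuous function is integrable. -/
class IntegratesContinuous {X : Type*} [TopologicalSpace X] [MeasurableSpace X]
    (μ : Measure X) : Prop where
  integrable : ∀ {f : X → ℝ}, Continuous f → Integrable f μ

instance : IntegratesContinuous (volume.restrict (simplex d)) := ⟨integrableOn_simplex⟩

instance {m : ℕ} (i : Fin (m + 2)) : IntegratesContinuous (faceMeasure i) :=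
  ⟨integrable_faceMeasure i⟩

/-- The `L²` norm of a real function. -/
def l2 {X : Type*} [MeasurableSpace X] (μ : Measure X) (f : X → ℝ) : ℝ := √(∫ x, f x ^ 2 ∂μ)

section L2

variable {X : Type*} [MeasurableSpace X] {μ ν : Measure X} {f g : X → ℝ}

theorem l2_nonneg : 0 ≤ l2 μ f := Real.sqrt_nonneg _

theorem l2_sq : l2 μ f ^ 2 = ∫ x, f x ^ 2 ∂μ :=
  Real.sq_sqrt (integral_nonneg fun _ => sq_nonneg _)

theorem l2_const_mul (c : ℝ) : l2 μ (fun x => c * f x) = |c| * l2 μ f := by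
  simp only [l2, mul_pow, integral_const_mul]
  rw [Real.sqrt_mul (sq_nonneg c), Real.sqrt_sq_eq_abs]

theorem l2_neg : l2 μ (fun x => -f x) = l2 μ f := by simp [l2]

theorem l2_zero : l2 μ (fun _ => 0) = 0 := by simp [l2]

theorem l2_sub_comm : l2 μ (fun x => f x - g x) = l2 μ (fun x => g x - f x) := by
  simp only [l2, sub_sq_comm (f _)]

theorem integral_sq_nonneg : 0 ≤ ∫ x, f x ^ 2 ∂μ := integral_nonneg fun _ => sq_nonneg _

/-- A function of which the pairing with itself is bounded by `c * l2 μ f` has norm at most `c`. -/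
theorem l2_le_of_integral_sq_le {c : ℝ} (h : ∫ x, f x ^ 2 ∂μ ≤ c * l2 μ f) (hc : 0 ≤ c) :
    l2 μ f ≤ c := by
  rcases (l2_nonneg (μ := μ) (f := f)).eq_or_lt with h0 | h0
  · rwa [← h0]
  · rw [← l2_sq, sq] at h
    exact le_of_mul_le_mul_right h h0

variable [TopologicalSpace X] [IntegratesContinuous μ] [IntegratesContinuous ν]

theorem abs_integral_mul_le (hf : Continuous f) (hg : Continuous g) :
    |∫ x, f x * g x ∂μ| ≤ l2 μ f * l2 μ g := by
  have key : ∀ t : ℝ, 0 ≤ (∫ x, f x ^ 2 ∂μ) * (t * t) + (2 * ∫ x, f x * g x ∂μ) * t +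
      ∫ x, g x ^ 2 ∂μ := fun t => by
    have h : ∫ x, (t * f x + g x) ^ 2 ∂μ = (∫ x, f x ^ 2 ∂μ) * (t * t) +
        (2 * ∫ x, f x * g x ∂μ) * t + ∫ x, g x ^ 2 ∂μ := by
      rw [← integral_mul_const, ← integral_const_mul, ← integral_mul_const, ← integral_add,
        ← integral_add]
      · congr 1; ext x; ring
      all_goals exact IntegratesContinuous.integrable (by fun_prop)
    exact h ▸ integral_sq_nonneg
  have hd := discrim_le_zero key
  rw [discrim] at hd
  apply abs_le_of_sq_le_sq _ (mul_nonneg l2_nonneg l2_nonneg)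
  rw [mul_pow, l2_sq, l2_sq]
  linarith

theorem integral_mul_le (hf : Continuous f) (hg : Continuous g) :
    ∫ x, f x * g x ∂μ ≤ l2 μ f * l2 μ g := (le_abs_self _).trans (abs_integral_mul_le hf hg)

theorem l2_add_le (hf : Continuous f) (hg : Continuous g) :
    l2 μ (fun x => f x + g x) ≤ l2 μ f + l2 μ g := by
  apply le_of_sq_le_sq _ (add_nonneg l2_nonneg l2_nonneg)
  have h : ∫ x, (f x + g x) ^ 2 ∂μ =
      ∫ x, f x ^ 2 ∂μ + 2 * ∫ x, f x * g x ∂μ + ∫ x, g x ^ 2 ∂μ := by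
    rw [← integral_const_mul, ← integral_add, ← integral_add]
    · congr 1; ext x; ring
    all_goals exact IntegratesContinuous.integrable (by fun_prop)
  rw [l2_sq, h, add_sq, l2_sq, l2_sq]
  linarith [integral_mul_le (μ := μ) hf hg]

theorem l2_sub_le (hf : Continuous f) (hg : Continuous g) :
    l2 μ (fun x => f x - g x) ≤ l2 μ f + l2 μ g := by
  simp only [sub_eq_add_neg]
  exact (l2_add_le hf hg.neg).trans_eq (congrArg (_ + ·) l2_neg)

theorem l2_sum_le {ι : Type*} (s : Finset ι) {F : ι → X → ℝ} (hF : ∀ i, Continuous (F i)) :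
    l2 μ (fun x => ∑ i ∈ s, F i x) ≤ ∑ i ∈ s, l2 μ (F i) := by
  classical
  induction s using Finset.induction_on with
  | empty => simp [l2_zero]
  | insert a s ha ih =>
    simp only [Finset.sum_insert ha]
    exact (l2_add_le (hF a) (continuous_finsetSum _ fun i _ => hF i)).trans (by gcongr)

theorem l2_mul_le {b : ℝ} (hg : Continuous g) (hf : Continuous f)
    (h : ∀ᵐ x ∂μ, |f x| ≤ b) (hb : 0 ≤ b) : l2 μ (fun x => f x * g x) ≤ b * l2 μ g := by
  apply le_of_sq_le_sq _ (mul_nonneg hb l2_nonneg)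
  rw [mul_pow, l2_sq, l2_sq, ← integral_const_mul]
  refine integral_mono_ae (IntegratesContinuous.integrable (by fun_prop))
    (IntegratesContinuous.integrable (by fun_prop)) ?_
  filter_upwards [h] with x hx
  rw [mul_pow]
  exact mul_le_mul_of_nonneg_right (sq_le_sq' (abs_le.1 hx).1 (abs_le.1 hx).2) (sq_nonneg _)

end L2

section FiniteDimensional

variable {V : Type*} [AddCommGroup V] [Module ℝ V] [FiniteDimensional ℝ V]

theorem exists_seminorm_le (p₁ p₂ : Seminorm ℝ V) (h : ∀ v, p₂ v = 0 → v = 0) :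
    ∃ C, 0 ≤ C ∧ ∀ v, p₁ v ≤ C * p₂ v := by
  let b := Module.finBasis ℝ V
  have hcoord : ∀ i, ∃ C, 0 ≤ C ∧ ∀ v, |b.coord i v| ≤ C * p₂ v := fun i => by
    let _ : NormedAddCommGroup V := AddGroupNorm.toNormedAddCommGroup
      { p₂.toAddGroupSeminorm with eq_zero_of_map_eq_zero' := h }
    let _ : NormedSpace ℝ V := ⟨fun a v => (map_smul_eq_mul p₂ a v).le⟩
    exact ⟨_, norm_nonneg _, (b.coord i).toContinuousLinearMap.le_opNorm⟩
  choose C hC0 hC using hcoord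
  refine ⟨∑ i, C i * p₁ (b i), Finset.sum_nonneg fun i _ => mul_nonneg (hC0 i) (apply_nonneg _ _),
    fun v => ?_⟩
  conv_lhs => rw [← b.sum_repr v]
  refine (Finset.le_sum_of_subadditive p₁ (map_zero p₁).le (map_add_le_add p₁) _ _).trans ?_
  rw [Finset.sum_mul]
  refine Finset.sum_le_sum fun i _ => ?_
  rw [map_smul_eq_mul, mul_right_comm]
  exact mul_le_mul_of_nonneg_right (hC i v) (apply_nonneg _ _)

/-- The `L²` seminorm pulled back along a linear map into continuous functions. -/
def l2Seminorm {X : Type*} [TopologicalSpace X] [MeasurableSpace X] (μ : Measure X)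
    [IntegratesContinuous μ] {V : Type*} [AddCommGroup V] [Module ℝ V] (T : V →ₗ[ℝ] (X → ℝ))
    (hT : ∀ v, Continuous (T v)) : Seminorm ℝ V :=
  Seminorm.of (fun v => l2 μ (T v))
    (fun v w => by rw [map_add]; exact l2_add_le (hT v) (hT w))
    (fun c v => by rw [map_smul]; exact l2_const_mul c)

theorem exists_l2_le {X Y : Type*} [TopologicalSpace X] [MeasurableSpace X] [TopologicalSpace Y]
    [MeasurableSpace Y] (μ : Measure X) [IntegratesContinuous μ] (ν : Measure Y)
    [IntegratesContinuous ν] (T : V →ₗ[ℝ] (X → ℝ)) (S : V →ₗ[ℝ] (Y → ℝ))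
    (hT : ∀ v, Continuous (T v)) (hS : ∀ v, Continuous (S v))
    (h : ∀ v, ∫ x, S v x ^ 2 ∂ν = 0 → v = 0) :
    ∃ C, 0 ≤ C ∧ ∀ v, l2 μ (T v) ≤ C * l2 ν (S v) :=
  exists_seminorm_le (l2Seminorm μ T hT) (l2Seminorm ν S hS) fun v hv => h v <| by
    rw [← l2_sq, show l2 ν (S v) = 0 from hv]; norm_num

end FiniteDimensional

/-- The `L²` norm on the reference simplex. -/
abbrev volNorm (v : (Fin d → ℝ) → ℝ) : ℝ := l2 (volume.restrict (simplex d)) v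

/-- Partial derivatives. -/
def pd (j : Fin d) (v : (Fin d → ℝ) → ℝ) (x : Fin d → ℝ) : ℝ := fderiv ℝ v x (Pi.single j 1)

/-- The `H¹` norm on the reference simplex. -/
def h1 (v : (Fin d → ℝ) → ℝ) : ℝ := volNorm v + ∑ j, volNorm (pd j v)

theorem volNorm_le_h1 (v : (Fin d → ℝ) → ℝ) : volNorm v ≤ h1 v :=
  le_add_of_nonneg_right (Finset.sum_nonneg fun _ _ => l2_nonneg)

theorem h1_nonneg (v : (Fin d → ℝ) → ℝ) : 0 ≤ h1 v := l2_nonneg.trans (volNorm_le_h1 v)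

theorem continuous_pd {v : (Fin d → ℝ) → ℝ} (hv : ContDiff ℝ 1 v) (j : Fin d) :
    Continuous (pd j v) := (hv.continuous_fderiv (by norm_num)).clm_apply continuous_const

theorem PolyLT.pd {n : ℕ} {p : (Fin d → ℝ) → ℝ} (h : PolyLT n p) (j : Fin d) :
    PolyLT (n - 1) (pd j p) := h.partialDeriv _

theorem pd_mul {v w : (Fin d → ℝ) → ℝ} (hv : ContDiff ℝ 1 v) (hw : ContDiff ℝ 1 w) (j : Fin d)
    (x : Fin d → ℝ) : pd j (fun x => v x * w x) x = pd j v x * w x + v x * pd j w x := by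
  have h1 := (hv.differentiable (by norm_num)) x
  have h2 := (hw.differentiable (by norm_num)) x
  rw [pd, fderiv_fun_mul h1 h2]
  simp [pd]
  ring

theorem pd_sub {v w : (Fin d → ℝ) → ℝ} (hv : ContDiff ℝ 1 v) (hw : ContDiff ℝ 1 w) (j : Fin d)
    (x : Fin d → ℝ) : pd j (fun x => v x - w x) x = pd j v x - pd j w x := by
  have h1 := (hv.differentiable (by norm_num)) x
  have h2 := (hw.differentiable (by norm_num)) x
  rw [pd, fderiv_fun_sub h1 h2]
  simp [pd]

theorem pd_coord_sub (j : Fin d) (c : ℝ) (x : Fin d → ℝ) : pd j (fun x => x j - c) x = 1 := by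
  have h : HasFDerivAt (fun x : Fin d → ℝ => x j - c)
      (ContinuousLinearMap.proj (R := ℝ) (φ := fun _ : Fin d => ℝ) j) x :=
    (ContinuousLinearMap.proj (R := ℝ) (φ := fun _ : Fin d => ℝ) j).hasFDerivAt.sub_const c
  rw [pd, h.fderiv]
  simp

theorem dlam_eq_sum (i : Fin (d + 1)) (y : Fin d → ℝ) :
    dlam i y = ∑ j, y j * dlam i (Pi.single j 1) := by
  conv_lhs => rw [show y = ∑ j, y j • Pi.single j (1 : ℝ) by simpa using pi_eq_sum_univ' y]
  simp only [map_sum, map_smul, smul_eq_mul]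

/-- The vertices of the reference simplex. -/
def vtx (i : Fin (d + 1)) : Fin d → ℝ := Fin.cases 0 (fun j => Pi.single j 1) i

theorem lam_vtx (l i : Fin (d + 1)) : lam l (vtx i) = if l = i then 1 else 0 := by
  cases i using Fin.cases with
  | zero => cases l using Fin.cases <;> simp [vtx]
  | succ i =>
    cases l using Fin.cases with
    | zero => simp [vtx, (Fin.succ_ne_zero i).symm]
    | succ l => simp [vtx, Pi.single_apply]

theorem vtx_mem_simplex (i : Fin (d + 1)) : vtx i ∈ simplex d := fun l => by
  rw [lam_vtx]; split <;> norm_num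

theorem dlam_sub (l : Fin (d + 1)) (x y : Fin d → ℝ) : dlam l (x - y) = lam l x - lam l y := by
  have := lam_add l y (x - y)
  rw [add_sub_cancel] at this
  linarith

theorem abs_sub_apply_le_one {x y : Fin d → ℝ} (hx : x ∈ simplex d) (hy : y ∈ simplex d)
    (j : Fin d) : |x j - y j| ≤ 1 := by
  have h1 := hx j.succ
  have h2 := lam_le_one hx j.succ
  have h3 := hy j.succ
  have h4 := lam_le_one hy j.succ
  simp only [lam_succ] at *
  rw [abs_le]
  constructor <;> linarith

section Divergence

variable {m : ℕ}

theorem integral_div {F : Fin (m + 1) → (Fin (m + 1) → ℝ) → ℝ} (hF : ∀ j, ContDiff ℝ 1 (F j)) :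
    ∫ x in simplex (m + 1), ∑ j, pd j (F j) x =
      -∑ i, ∫ x, dlam i (fun j => F j x) ∂faceMeasure i := by
  rw [integral_finsetSum _ fun j _ => integrableOn_simplex (continuous_pd (hF j) j)]
  have h : ∀ j, ∫ x in simplex (m + 1), pd j (F j) x =
      -∑ i, dlam i (Pi.single j 1) * ∫ x, F j x ∂faceMeasure i := fun j =>
    integral_fderiv_apply (hF j) _
  simp only [h, Finset.sum_neg_distrib]
  rw [Finset.sum_comm]
  congr 2
  ext i
  simp only [dlam_eq_sum i fun j => F j _]
  rw [integral_finsetSum _ fun j _ => (integrable_faceMeasure i (hF j).continuous).mul_const _]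
  simp only [integral_mul_const, mul_comm]

theorem integral_pd_mul {v w : (Fin (m + 1) → ℝ) → ℝ} (hv : ContDiff ℝ 1 v) (hw : ContDiff ℝ 1 w)
    (hw0 : ∀ i, ∀ x ∈ face i, w x = 0) (j : Fin (m + 1)) :
    ∫ x in simplex (m + 1), pd j v x * w x = -∫ x in simplex (m + 1), v x * pd j w x := by
  rw [eq_neg_iff_add_eq_zero, ← integral_add]
  · simp only [← pd_mul hv hw]
    refine (integral_fderiv_apply (hv.mul hw) _).trans (neg_eq_zero.2 (Finset.sum_eq_zero
      fun i _ => mul_eq_zero_of_right _ (integral_eq_zero_of_ae ?_)))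
    filter_upwards [ae_mem_face i] with x hx
    simp [hw0 i x hx]
  · exact integrableOn_simplex ((continuous_pd hv j).mul hw.continuous)
  · exact integrableOn_simplex (hv.continuous.mul (continuous_pd hw j))

theorem integral_sq_faceMeasure {v : (Fin (m + 1) → ℝ) → ℝ} (hv : ContDiff ℝ 1 v)
    (i : Fin (m + 2)) :
    ∫ x, v x ^ 2 ∂faceMeasure i = ∫ x in simplex (m + 1),
      (2 * (∑ j, (v x * ((x j - vtx i j) * pd j v x))) + (m + 1) * v x ^ 2) := by
  have hF : ∀ j : Fin (m + 1), ContDiff ℝ 1 fun x => v x * v x * (x j - vtx i j) := fun j => by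
    fun_prop
  have hdiv := integral_div hF
  have hpd : ∀ j : Fin (m + 1), ∀ x, pd j (fun x => v x * v x * (x j - vtx i j)) x =
      2 * (v x * ((x j - vtx i j) * pd j v x)) + v x ^ 2 := fun j x => by
    rw [pd_mul (hv.mul hv) (by fun_prop), pd_mul hv hv, pd_coord_sub]
    ring
  simp only [hpd, Finset.sum_add_distrib, ← Finset.mul_sum, Finset.sum_const, Finset.card_univ,
    Fintype.card_fin, nsmul_eq_mul, Nat.cast_add, Nat.cast_one] at hdiv
  simp only [← Finset.mul_sum]
  rw [hdiv, ← Finset.sum_neg_distrib, Finset.sum_eq_single i]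
  · rw [← integral_neg]
    refine integral_congr_ae ?_
    filter_upwards [ae_mem_face i] with x hx
    have h1 : (fun j => v x * v x * (x j - vtx i j)) = (v x * v x) • (x - vtx i) := rfl
    rw [h1, map_smul, dlam_sub, hx.2, lam_vtx, if_pos rfl]
    simp [sq]
  · intro l _ hl
    refine neg_eq_zero.2 (integral_eq_zero_of_ae ?_)
    filter_upwards [ae_mem_face l] with x hx
    have h1 : (fun j => v x * v x * (x j - vtx i j)) = (v x * v x) • (x - vtx i) := rfl
    rw [h1, map_smul, dlam_sub, hx.2, lam_vtx, if_neg hl]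
    simp
  · simp

theorem l2_faceMeasure_le {v : (Fin (m + 1) → ℝ) → ℝ} (hv : ContDiff ℝ 1 v) (i : Fin (m + 2)) :
    l2 (faceMeasure i) v ≤ (m + 1) * h1 v := by
  apply le_of_sq_le_sq _ (mul_nonneg (by positivity) (h1_nonneg v))
  have hpd : ∀ j, Continuous (pd j v) := continuous_pd hv
  have hvc := hv.continuous
  rw [l2_sq, integral_sq_faceMeasure hv, integral_add, integral_const_mul, integral_const_mul,
    integral_finsetSum _ fun j _ => integrableOn_simplex (by fun_prop), ← l2_sq]
  · have hle : ∑ j, ∫ x in simplex (m + 1), v x * ((x j - vtx i j) * pd j v x) ≤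
        volNorm v * ∑ j, volNorm (pd j v) := by
      rw [Finset.mul_sum]
      refine Finset.sum_le_sum fun j _ => (integral_mul_le hvc (by fun_prop)).trans
        (mul_le_mul_of_nonneg_left ?_ l2_nonneg)
      refine (l2_mul_le (μ := volume.restrict (simplex (m + 1))) (b := 1) (f := fun x => x j - vtx i j) (hpd j) (by fun_prop) ?_
        zero_le_one).trans_eq (one_mul _)
      filter_upwards [ae_restrict_mem measurableSet_simplex] with x hx
      exact abs_sub_apply_le_one hx (vtx_mem_simplex i) j
    have ha : 0 ≤ volNorm v := l2_nonneg
    have hb : 0 ≤ ∑ j, volNorm (pd j v) := Finset.sum_nonneg fun _ _ => l2_nonneg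
    rw [h1]
    set a := volNorm v
    set b := ∑ j, volNorm (pd j v)
    have hm : (0 : ℝ) ≤ m := by positivity
    change 2 * _ + _ * a ^ 2 ≤ _
    have h3 : ((m : ℝ) + 1) * (a + b) ^ 2 ≤ ((m + 1) * (a + b)) ^ 2 := by
      rw [mul_pow]
      exact mul_le_mul_of_nonneg_right (by nlinarith) (sq_nonneg _)
    refine le_trans ?_ h3
    nlinarith [mul_nonneg hm (mul_nonneg ha hb), mul_nonneg hm (sq_nonneg b), sq_nonneg b]
  · exact integrableOn_simplex (by fun_prop)
  · exact integrableOn_simplex (by fun_prop)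

end Divergence

theorem lintegral_homothety_le {Φ : (Fin d → ℝ) → ℝ≥0∞} (hΦ : Measurable Φ) {t : ℝ}
    (ht : 1 / 2 ≤ t) (ht1 : t ≤ 1) {y : Fin d → ℝ} (hy : y ∈ simplex d) :
    ∫⁻ x in simplex d, Φ (t • x + (1 - t) • y) ≤ 2 ^ d * ∫⁻ x in simplex d, Φ x := by
  have ht0 : 0 < t := by linarith
  set g := (simplex d).indicator Φ with hg
  have hgm : Measurable g := hΦ.indicator measurableSet_simplex
  calc ∫⁻ x in simplex d, Φ (t • x + (1 - t) • y)
      ≤ ∫⁻ x in simplex d, g (t • x + (1 - t) • y) := by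
        refine setLIntegral_mono' measurableSet_simplex fun x hx => ?_
        rw [hg, indicator_of_mem]
        exact convex_simplex hx hy ht0.le (by linarith) (by ring)
    _ ≤ ∫⁻ x, g (t • x + (1 - t) • y) := setLIntegral_le_lintegral _ _
    _ = ∫⁻ z, g (z + (1 - t) • y) ∂(Measure.map (t • ·) volume) := by
        rw [lintegral_map (f := fun z => g (z + (1 - t) • y)) (hgm.comp (measurable_add_const _))
          (measurable_const_smul t)]
    _ = ENNReal.ofReal |(t ^ d)⁻¹| * ∫⁻ x in simplex d, Φ x := by
        rw [Measure.map_addHaar_smul _ ht0.ne', lintegral_smul_measure,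
          lintegral_add_right_eq_self, hg, lintegral_indicator measurableSet_simplex,
          Module.finrank_fintype_fun_eq_card, Fintype.card_fin, smul_eq_mul]
    _ ≤ 2 ^ d * ∫⁻ x in simplex d, Φ x := by
        gcongr
        rw [abs_of_pos (by positivity), ← inv_pow, ENNReal.ofReal_pow (by positivity)]
        gcongr
        refine ENNReal.ofReal_le_of_le_toReal ?_
        simpa using inv_anti₀ (by norm_num) ht

theorem lintegral_lintegral_homothety_le {Φ : (Fin d → ℝ) → ℝ≥0∞} (hΦ : Measurable Φ) {t : ℝ}
    (ht : t ∈ Icc (0 : ℝ) 1) :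
    ∫⁻ y in simplex d, ∫⁻ x in simplex d, Φ (t • x + (1 - t) • y) ≤
      volume (simplex d) * (2 ^ d * ∫⁻ x in simplex d, Φ x) := by
  have aux : ∀ s : ℝ, 1 / 2 ≤ s → s ≤ 1 →
      ∫⁻ y in simplex d, ∫⁻ x in simplex d, Φ (s • x + (1 - s) • y) ≤
      volume (simplex d) * (2 ^ d * ∫⁻ x in simplex d, Φ x) := fun s hs hs1 => by
    refine (setLIntegral_mono' measurableSet_simplex fun y hy =>
      lintegral_homothety_le hΦ hs hs1 hy).trans_eq ?_
    rw [lintegral_const, Measure.restrict_apply_univ, mul_comm]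
  by_cases h : 1 / 2 ≤ t
  · exact aux t h ht.2
  · refine le_trans (le_of_eq ?_) (aux (1 - t) (by linarith) (by linarith [ht.1]))
    rw [lintegral_lintegral_swap]
    · congr 1; ext x; congr 1; ext y
      congr 1
      rw [add_comm, sub_sub_cancel (1 : ℝ) t]
    · exact (hΦ.comp (by fun_prop)).aemeasurable

theorem polyLT_multilinear {j : ℕ} (M : ContinuousMultilinearMap ℝ (fun _ : Fin j => Fin d → ℝ) ℝ)
    (y : Fin d → ℝ) : PolyLT (j + 1) fun x => M fun _ => x - y := by
  have h : ∀ x, (M fun _ => x - y) = ∑ r : Fin j → Fin d,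
      (M fun i => Pi.single (r i) 1) * ∏ i, (x (r i) - y (r i)) := fun x => by
    have hx : x - y = ∑ l, (x l - y l) • Pi.single l (1 : ℝ) := by
      simpa using pi_eq_sum_univ' (x - y)
    conv_lhs => rw [hx]
    rw [M.map_sum]
    simp only [M.map_smul_univ, smul_eq_mul, mul_comm]
  simp only [h]
  exact PolyLT.sum _ fun r _ => (PolyLT.prod _ fun i =>
    (PolyLT.coord _).sub ((PolyLT.const 0 _).mono (by norm_num))).const_mul _

theorem sq_intervalIntegral_le {g : ℝ → ℝ} (hg : Continuous g) :
    (∫ t in (0 : ℝ)..1, g t) ^ 2 ≤ ∫ t in Icc (0 : ℝ) 1, g t ^ 2 := by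
  have : IntegratesContinuous (volume.restrict (Icc (0 : ℝ) 1)) :=
    ⟨fun hf => hf.continuousOn.integrableOn_compact isCompact_Icc⟩
  have h := abs_integral_mul_le (μ := volume.restrict (Icc (0 : ℝ) 1)) hg
    (continuous_const (y := (1 : ℝ)))
  have h1 : l2 (volume.restrict (Icc (0 : ℝ) 1)) (fun _ => 1) = 1 := by simp [l2]
  rw [h1] at h
  simp only [mul_one] at h
  rw [intervalIntegral.integral_of_le zero_le_one, ← integral_Icc_eq_integral_Ioc, ← l2_sq]
  exact sq_le_sq' (abs_le.1 h).1 (abs_le.1 h).2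

open Nat in
/-- The Taylor polynomial of degree `n` of `v` at `y`. -/
def taylorPoly (n : ℕ) (v : (Fin d → ℝ) → ℝ) (y x : Fin d → ℝ) : ℝ :=
  ∑ j ∈ Finset.range (n + 1), (j ! : ℝ)⁻¹ * iteratedFDeriv ℝ j v y fun _ => x - y

theorem polyLT_taylorPoly (n : ℕ) (v : (Fin d → ℝ) → ℝ) (y : Fin d → ℝ) :
    PolyLT (n + 1) (taylorPoly n v y) :=
  PolyLT.sum _ fun _ hj => ((polyLT_multilinear _ y).const_mul _).mono (Finset.mem_range.1 hj)

theorem norm_sub_le_one {x y : Fin d → ℝ} (hx : x ∈ simplex d) (hy : y ∈ simplex d) :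
    ‖x - y‖ ≤ 1 :=
  (pi_norm_le_iff_of_nonneg zero_le_one).2 fun j => abs_sub_apply_le_one hx hy j

theorem sq_sub_taylorPoly_le {n : ℕ} {v : (Fin d → ℝ) → ℝ} (hv : ContDiff ℝ (n + 1) v)
    {x y : Fin d → ℝ} (hx : x ∈ simplex d) (hy : y ∈ simplex d) :
    (v x - taylorPoly n v y x) ^ 2 ≤
      ∫ t in Icc (0 : ℝ) 1, ‖iteratedFDeriv ℝ (n + 1) v (t • x + (1 - t) • y)‖ ^ 2 := by
  have hD : Continuous (iteratedFDeriv ℝ (n + 1) v) := hv.continuous_iteratedFDeriv (by simp)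
  have hT := map_add_eq_sum_add_integral_iteratedFDeriv (f := v) (x := y) (y := x - y) (n := n)
    fun t _ => hv.contDiffAt
  rw [add_sub_cancel] at hT
  refine le_trans ?_ (sq_intervalIntegral_le (g := fun t =>
    ‖iteratedFDeriv ℝ (n + 1) v (t • x + (1 - t) • y)‖) (by fun_prop))
  have hle : |v x - taylorPoly n v y x| ≤
      ∫ t in (0 : ℝ)..1, ‖iteratedFDeriv ℝ (n + 1) v (t • x + (1 - t) • y)‖ := by
    rw [hT, taylorPoly]
    simp only [smul_eq_mul, add_sub_cancel_left]
    rw [abs_mul, abs_of_pos (by positivity), ← Real.norm_eq_abs]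
    refine (mul_le_of_le_one_left (norm_nonneg _)
      (inv_le_one_of_one_le₀ (by exact_mod_cast Nat.one_le_iff_ne_zero.2 n.factorial_ne_zero))).trans ?_
    refine intervalIntegral.norm_integral_le_of_norm_le zero_le_one
      (Filter.Eventually.of_forall fun t ht => ?_)
      (Continuous.intervalIntegrable (by fun_prop) _ _)
    have hxy : y + t • (x - y) = t • x + (1 - t) • y := by module
    rw [norm_mul, hxy, norm_pow]
    refine (mul_le_of_le_one_left (norm_nonneg _) (pow_le_one₀ (norm_nonneg _) ?_)).trans ?_
    · rw [Real.norm_eq_abs, abs_le]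
      constructor <;> linarith [ht.1, ht.2]
    · refine (ContinuousMultilinearMap.le_opNorm _ _).trans (mul_le_of_le_one_right
        (norm_nonneg _) (Finset.prod_le_one (fun _ _ => norm_nonneg _) fun _ _ =>
          norm_sub_le_one hx hy))
  rw [← sq_abs]
  exact pow_le_pow_left₀ (abs_nonneg _) hle 2

theorem ofReal_integral_simplex {f : (Fin d → ℝ) → ℝ} (hf : Continuous f) (h0 : ∀ x, 0 ≤ f x) :
    ENNReal.ofReal (∫ x in simplex d, f x) = ∫⁻ x in simplex d, ENNReal.ofReal (f x) :=
  ofReal_integral_eq_lintegral_ofReal (integrableOn_simplex hf) (Filter.Eventually.of_forall h0)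

/-- The **Bramble–Hilbert lemma** in `L²` on the reference simplex. -/
theorem exists_polyLT_volNorm_sub_le (n : ℕ) {v : (Fin d → ℝ) → ℝ} (hv : ContDiff ℝ n v) :
    ∃ P, PolyLT n P ∧ volNorm (fun x => v x - P x) ≤
      2 ^ d * volNorm fun x => ‖iteratedFDeriv ℝ n v x‖ := by
  obtain _ | n := n
  · refine ⟨fun _ => 0, .zero 0, ?_⟩
    have h : volNorm (fun x => ‖iteratedFDeriv ℝ 0 v x‖) = volNorm v := by
      simp [volNorm, l2]
    simp only [sub_zero]
    rw [h]
    exact le_mul_of_one_le_left l2_nonneg (one_le_pow₀ one_le_two)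
  push_cast at hv
  have hD : Continuous (iteratedFDeriv ℝ (n + 1) v) := hv.continuous_iteratedFDeriv (by simp)
  set Φ : (Fin d → ℝ) → ℝ≥0∞ := fun z =>
    ENNReal.ofReal (‖iteratedFDeriv ℝ (n + 1) v z‖ ^ 2) with hΦ
  have hΦm : Measurable Φ := by
    have : Continuous fun z => ‖iteratedFDeriv ℝ (n + 1) v z‖ ^ 2 := by fun_prop
    exact (ENNReal.continuous_ofReal.comp this).measurable
  set G : (Fin d → ℝ) → ℝ≥0∞ := fun y => ∫⁻ x in simplex d, ∫⁻ t in Icc (0 : ℝ) 1,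
    Φ (t • x + (1 - t) • y) with hG
  have hΦ3 : Measurable fun p : ((Fin d → ℝ) × (Fin d → ℝ)) × ℝ =>
      Φ (p.2 • p.1.2 + (1 - p.2) • p.1.1) := hΦm.comp (by fun_prop)
  have hGm : Measurable G := (hΦ3.lintegral_prod_right').lintegral_prod_right'
  have hGint : ∫⁻ y in simplex d, G y ≤ volume (simplex d) * (2 ^ d * ∫⁻ x in simplex d, Φ x) := by
    calc ∫⁻ y in simplex d, G y
        = ∫⁻ y in simplex d, ∫⁻ t in Icc (0 : ℝ) 1, ∫⁻ x in simplex d,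
            Φ (t • x + (1 - t) • y) := by
          refine lintegral_congr fun y => ?_
          exact lintegral_lintegral_swap (Measurable.aemeasurable (hΦm.comp (by fun_prop)))
      _ = ∫⁻ t in Icc (0 : ℝ) 1, ∫⁻ y in simplex d, ∫⁻ x in simplex d,
            Φ (t • x + (1 - t) • y) := by
          refine lintegral_lintegral_swap (Measurable.aemeasurable ?_)
          have : Measurable fun p : ((Fin d → ℝ) × ℝ) × (Fin d → ℝ) =>
            Φ (p.1.2 • p.2 + (1 - p.1.2) • p.1.1) := hΦm.comp (by fun_prop)
          exact this.lintegral_prod_right'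
      _ ≤ ∫⁻ _ in Icc (0 : ℝ) 1, volume (simplex d) * (2 ^ d * ∫⁻ x in simplex d, Φ x) :=
          setLIntegral_mono' measurableSet_Icc fun t ht => lintegral_lintegral_homothety_le hΦm ht
      _ = volume (simplex d) * (2 ^ d * ∫⁻ x in simplex d, Φ x) := by
          simp
  obtain ⟨y, hy, hyG⟩ := exists_le_setLAverage volume_simplex_pos.ne' volume_simplex_lt_top.ne
    hGm.aemeasurable
  rw [setLAverage_eq] at hyG
  have hyG' : G y ≤ 2 ^ d * ∫⁻ x in simplex d, Φ x :=
    hyG.trans (ENNReal.div_le_of_le_mul' hGint)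
  have hTc := (polyLT_taylorPoly n v y).continuous
  refine ⟨taylorPoly n v y, polyLT_taylorPoly n v y, ?_⟩
  have hsq : volNorm (fun x => v x - taylorPoly n v y x) ^ 2 ≤
      2 ^ d * volNorm (fun x => ‖iteratedFDeriv ℝ (n + 1) v x‖) ^ 2 := by
    have hvc := hv.continuous
    rw [volNorm, volNorm, l2_sq, l2_sq,
      ← ENNReal.ofReal_le_ofReal_iff (mul_nonneg (by positivity) integral_sq_nonneg),
      ofReal_integral_simplex (by fun_prop) (fun _ => sq_nonneg _),
      ENNReal.ofReal_mul (by positivity),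
      ofReal_integral_simplex (by fun_prop) (fun _ => sq_nonneg _),
      ENNReal.ofReal_pow (by norm_num), ENNReal.ofReal_ofNat]
    refine le_trans ?_ hyG'
    refine setLIntegral_mono' measurableSet_simplex fun x hx => ?_
    refine (ENNReal.ofReal_le_ofReal (sq_sub_taylorPoly_le hv hx hy)).trans_eq ?_
    exact ofReal_integral_eq_lintegral_ofReal
      (ContinuousOn.integrableOn_compact isCompact_Icc (by fun_prop))
      (Filter.Eventually.of_forall fun _ => sq_nonneg _)
  apply le_of_sq_le_sq _ (mul_nonneg (by positivity) l2_nonneg)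
  refine hsq.trans ?_
  rw [mul_pow]
  exact mul_le_mul_of_nonneg_right (le_self_pow₀ (one_le_pow₀ one_le_two) (by norm_num))
    (sq_nonneg _)

theorem PolyLT.eq_zero_of_integral_sq {n : ℕ} {r b : (Fin d → ℝ) → ℝ} (hr : PolyLT n r)
    (hb : Continuous b) (hb0 : ∀ x ∈ openSimplex d, b x ≠ 0)
    (h : ∫ x in simplex d, (b x * r x) ^ 2 = 0) : r = 0 := by
  have hrc := hr.continuous
  refine hr.eq_zero_of_openSimplex fun x hx => ?_
  have := eqOn_zero_of_setIntegral_eq_zero (by fun_prop) (fun _ _ => sq_nonneg _) h x hx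
  exact (mul_eq_zero.1 (pow_eq_zero_iff two_ne_zero |>.1 this)).resolve_left (hb0 x hx)

/-- The bubble function of the reference simplex. -/
def bubble (x : Fin d → ℝ) : ℝ := ∏ i, lam i x

theorem polyLT_bubble : PolyLT (d + 2) (bubble (d := d)) := PolyLT.prod _ polyLT_lam

theorem bubble_eq_zero {i : Fin (d + 1)} {x : Fin d → ℝ} (hx : x ∈ face i) : bubble x = 0 :=
  Finset.prod_eq_zero (Finset.mem_univ i) hx.2

theorem bubble_ne_zero {x : Fin d → ℝ} (hx : x ∈ openSimplex d) : bubble x ≠ 0 :=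
  Finset.prod_ne_zero_iff.2 fun i _ => (hx i).ne'

/-- Multiplication by a fixed function on polynomials. -/
def mulPoly (n : ℕ) (b : (Fin d → ℝ) → ℝ) : polyLT d n →ₗ[ℝ] ((Fin d → ℝ) → ℝ) where
  toFun r := fun x => b x * r.1 x
  map_add' r s := by ext x; simp [mul_add]
  map_smul' c r := by ext x; simp [mul_left_comm]

/-- The partial derivative of the product with a fixed polynomial. -/
def pdMulPoly (n : ℕ) (b : (Fin d → ℝ) → ℝ) (j : Fin d) :
    polyLT d n →ₗ[ℝ] ((Fin d → ℝ) → ℝ) where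
  toFun r := fun x => pd j b x * r.1 x + b x * pd j r.1 x
  map_add' r s := by
    ext x
    have h : pd j (r.1 + s.1) x = pd j r.1 x + pd j s.1 x := by
      rw [pd, fderiv_add (r.2.differentiable x) (s.2.differentiable x)]; rfl
    simp only [Submodule.coe_add, Pi.add_apply, h]
    ring
  map_smul' c r := by
    ext x
    have h : pd j (c • r.1) x = c * pd j r.1 x := by
      rw [pd, fderiv_const_smul (r.2.differentiable x)]; rfl
    simp only [Submodule.coe_smul, Pi.smul_apply, smul_eq_mul, h, RingHom.id_apply]
    ring

section

variable {m : ℕ}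

theorem exists_volNorm_le_of_pd (n : ℕ) (j : Fin (m + 1)) : ∃ C, 0 ≤ C ∧
    ∀ (g r : (Fin (m + 1) → ℝ) → ℝ), ContDiff ℝ 1 g → PolyLT n r →
      volNorm r ≤ C * (volNorm (fun x => r x - pd j g x) + volNorm g) := by
  have hβ : PolyLT _ (bubble (d := m + 1)) := polyLT_bubble
  have hβc := hβ.continuous
  have hβ2 := hβ.mul hβ
  have hS : ∀ r : polyLT (m + 1) n, Continuous (mulPoly n bubble r) := fun r =>
    hβc.mul r.2.continuous
  have h0 : ∀ r : polyLT (m + 1) n, ∫ x in simplex (m + 1), mulPoly n bubble r x ^ 2 = 0 →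
      r = 0 := fun r hr => Subtype.ext
    (r.2.eq_zero_of_integral_sq hβc (fun _ => bubble_ne_zero) hr)
  let vol := volume.restrict (simplex (m + 1))
  obtain ⟨C₁, hC₁, h₁⟩ := exists_l2_le vol vol (mulPoly n fun _ => 1) (mulPoly n bubble)
    (fun r => continuous_const.mul r.2.continuous) hS h0
  obtain ⟨C₂, hC₂, h₂⟩ := exists_l2_le vol vol (mulPoly n fun x => bubble x * bubble x)
    (mulPoly n bubble) (fun r => (hβc.mul hβc).mul r.2.continuous) hS h0
  obtain ⟨C₃, hC₃, h₃⟩ := exists_l2_le vol vol (pdMulPoly n (fun x => bubble x * bubble x) j)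
    (mulPoly n bubble)
    (fun r => ((hβ2.pd j).continuous.mul r.2.continuous).add
      (hβ2.continuous.mul (r.2.pd j).continuous)) hS h0
  refine ⟨C₁ * (C₂ + C₃), by positivity, fun g r hg hr => ?_⟩
  have hgc := hg.continuous
  have hpg := continuous_pd hg j
  have hrc := hr.continuous
  have h₁ := h₁ ⟨r, hr⟩
  have h₂ := h₂ ⟨r, hr⟩
  have h₃ := h₃ ⟨r, hr⟩
  have e₁ : mulPoly n (fun _ => 1) ⟨r, hr⟩ = r := by ext x; simp [mulPoly]
  have e₃ : pdMulPoly n (fun x => bubble x * bubble x) j ⟨r, hr⟩ = pd j fun x => bubble x * bubble x * r x := by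
    ext x; exact (pd_mul hβ2.contDiff hr.contDiff j x).symm
  rw [e₁] at h₁
  rw [e₃] at h₃
  set B := l2 vol (mulPoly n bubble ⟨r, hr⟩) with hB
  have hB0 : 0 ≤ B := l2_nonneg
  have hX : 0 ≤ volNorm (fun x => r x - pd j g x) := l2_nonneg
  have hY : 0 ≤ volNorm g := l2_nonneg
  have hw : PolyLT _ (fun x => bubble x * bubble x * r x) := hβ2.mul hr
  have hwc := hw.continuous
  have hpw := continuous_pd hw.contDiff j
  have key : ∫ x in simplex (m + 1), (bubble x * r x) ^ 2 =
      (∫ x in simplex (m + 1), (r x - pd j g x) * (bubble x * bubble x * r x)) -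
      ∫ x in simplex (m + 1), g x * pd j (fun x => bubble x * bubble x * r x) x := by
    rw [sub_eq_add_neg, ← integral_pd_mul hg hw.contDiff
      (fun i x hx => by simp [bubble_eq_zero hx]) j, ← integral_add]
    · congr 1; ext x; ring
    · exact integrableOn_simplex (by fun_prop)
    · exact integrableOn_simplex (by fun_prop)
  have hBle : B ≤ (C₂ + C₃) * (volNorm (fun x => r x - pd j g x) + volNorm g) := by
    refine l2_le_of_integral_sq_le ?_ (by positivity)
    refine key.trans_le ?_
    have i1 := integral_mul_le (μ := vol) (f := fun x => r x - pd j g x) (by fun_prop) hwc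
    have i2 := (abs_le.1 (abs_integral_mul_le (μ := vol) hgc hpw)).1
    have i1' := i1.trans (mul_le_mul_of_nonneg_left h₂ hX)
    have i2' := mul_le_mul_of_nonneg_left h₃ hY
    nlinarith [mul_nonneg (mul_nonneg hC₂ hY) hB0, mul_nonneg (mul_nonneg hC₃ hX) hB0]
  calc volNorm r ≤ C₁ * B := h₁
    _ ≤ C₁ * ((C₂ + C₃) * (volNorm (fun x => r x - pd j g x) + volNorm g)) := by gcongr
    _ = _ := by ring

theorem volNorm_iteratedFDeriv_pd_le {n : ℕ} {v : (Fin d → ℝ) → ℝ} (hv : ContDiff ℝ (n + 1) v)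
    (j : Fin d) : volNorm (fun x => ‖iteratedFDeriv ℝ n (pd j v) x‖) ≤
      volNorm fun x => ‖iteratedFDeriv ℝ (n + 1) v x‖ := by
  have hD : Continuous (iteratedFDeriv ℝ (n + 1) v) := hv.continuous_iteratedFDeriv (by simp)
  have hpd : ContDiff ℝ n (pd j v) :=
    (hv.fderiv_right (m := n) le_rfl).clm_apply contDiff_const
  have hD' : Continuous (iteratedFDeriv ℝ n (pd j v)) := hpd.continuous_iteratedFDeriv le_rfl
  refine Real.sqrt_le_sqrt (integral_mono (integrableOn_simplex (by fun_prop))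
    (integrableOn_simplex (by fun_prop)) fun x => ?_)
  refine pow_le_pow_left₀ (norm_nonneg _) ?_ 2
  let L := ContinuousLinearMap.apply ℝ ℝ (Pi.single j (1 : ℝ) : Fin d → ℝ)
  have hL : ‖L‖ ≤ 1 := ContinuousLinearMap.opNorm_le_bound _ zero_le_one fun A => by
    refine (A.le_opNorm _).trans ?_
    rw [Pi.norm_single, norm_one, mul_one, one_mul]
  have h := L.norm_iteratedFDeriv_comp_left (f := fderiv ℝ v) (x := x) (n := n)
    (hv.fderiv_right (m := n) le_rfl).contDiffAt le_rfl
  rw [norm_iteratedFDeriv_fderiv] at h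
  exact h.trans (mul_le_of_le_one_left (norm_nonneg _) hL)

/-- The **Bramble–Hilbert lemma** in `H¹` on the reference simplex. -/
theorem exists_h1_sub_le (m n : ℕ) : ∃ C, 0 ≤ C ∧ ∀ v : (Fin (m + 1) → ℝ) → ℝ,
    ContDiff ℝ (n + 1) v → ∃ P, PolyLT (n + 1) P ∧
      h1 (fun x => v x - P x) ≤ C * volNorm fun x => ‖iteratedFDeriv ℝ (n + 1) v x‖ := by
  choose C hC0 hC using fun j : Fin (m + 1) => exists_volNorm_le_of_pd n j
  refine ⟨2 ^ (m + 1) + ∑ j, (2 ^ (m + 1) + C j * (2 ^ (m + 1) + 2 ^ (m + 1))),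
    add_nonneg (by positivity) (Finset.sum_nonneg fun j _ => by have := hC0 j; positivity),
    fun v hv => ?_⟩
  have hv1 : ContDiff ℝ 1 v := hv.of_le (by simp)
  obtain ⟨P, hP, hvP⟩ := exists_polyLT_volNorm_sub_le (n + 1) (v := v) (by exact_mod_cast hv)
  refine ⟨P, hP, ?_⟩
  set M := volNorm fun x => ‖iteratedFDeriv ℝ (n + 1) v x‖ with hM
  have hM0 : 0 ≤ M := l2_nonneg
  rw [h1, add_mul, Finset.sum_mul]
  refine add_le_add hvP (Finset.sum_le_sum fun j _ => ?_)
  have hpd : ContDiff ℝ n (pd j v) :=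
    (hv.fderiv_right (m := n) le_rfl).clm_apply contDiff_const
  obtain ⟨Q, hQ, hvQ⟩ := exists_polyLT_volNorm_sub_le n hpd
  have hvQ' := hvQ.trans (mul_le_mul_of_nonneg_left (volNorm_iteratedFDeriv_pd_le hv j)
    (by positivity))
  have hr : PolyLT n fun x => Q x - pd j P x := hQ.sub (hP.pd j)
  have hg : ContDiff ℝ 1 fun x => v x - P x := hv1.sub hP.contDiff
  have h := hC j _ _ hg hr
  simp only [pd_sub hv1 hP.contDiff, sub_sub_sub_cancel_right] at h
  have e1 : pd j (fun x => v x - P x) = fun x => (pd j v x - Q x) + (Q x - pd j P x) := by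
    ext x; rw [pd_sub hv1 hP.contDiff]; ring
  rw [e1]
  refine (l2_add_le ((continuous_pd hv1 j).sub hQ.continuous) hr.continuous).trans ?_
  rw [volNorm, volNorm, l2_sub_comm (f := Q) (g := pd j v)] at h
  have h' := h.trans (mul_le_mul_of_nonneg_left (add_le_add hvQ' hvP) (hC0 j))
  calc _ ≤ 2 ^ (m + 1) * M + C j * (2 ^ (m + 1) * M + 2 ^ (m + 1) * M) := add_le_add hvQ' h'
    _ = _ := by ring

end

theorem exists_eq_of_definite {V : Type*} [AddCommGroup V] [Module ℝ V] [FiniteDimensional ℝ V]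
    (B : V →ₗ[ℝ] V →ₗ[ℝ] ℝ) (h : ∀ v, B v v = 0 → v = 0) (f : V →ₗ[ℝ] ℝ) : ∃ v, B v = f := by
  have hinj : Function.Injective B := (injective_iff_map_eq_zero B).2 fun v hv => h v (by simp [hv])
  exact (LinearMap.injective_iff_surjective_of_finrank_eq_finrank
    Subspace.dual_finrank_eq.symm).1 hinj f

section Pairing

variable {X : Type*} [TopologicalSpace X] [MeasurableSpace X] {W : Submodule ℝ (X → ℝ)}

/-- The linear functional `w ↦ ∫ f w`. -/
def pairL (ν : Measure X) [IntegratesContinuous ν] (hW : ∀ w ∈ W, Continuous w) {f : X → ℝ}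
    (hf : Continuous f) : W →ₗ[ℝ] ℝ where
  toFun w := ∫ x, f x * w.1 x ∂ν
  map_add' v w := by
    have hv := hW _ v.2
    have hw := hW _ w.2
    rw [← integral_add]
    · simp only [Submodule.coe_add, Pi.add_apply, mul_add]
    all_goals exact IntegratesContinuous.integrable (by fun_prop)
  map_smul' c w := by
    simp only [Submodule.coe_smul, Pi.smul_apply, smul_eq_mul, RingHom.id_apply,
      mul_left_comm _ c, integral_const_mul]

/-- The weighted `L²` pairing as a bilinear form. -/
def pairB (ν : Measure X) [IntegratesContinuous ν] (hW : ∀ w ∈ W, Continuous w) {b : X → ℝ}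
    (hb : Continuous b) : W →ₗ[ℝ] W →ₗ[ℝ] ℝ where
  toFun v := pairL ν hW (hb.mul (hW v v.2))
  map_add' v v' := by
    ext w
    have hv := hW _ v.2
    have hv' := hW _ v'.2
    have hw := hW _ w.2
    simp only [pairL, LinearMap.coe_mk, AddHom.coe_mk, LinearMap.add_apply]
    rw [← integral_add]
    · simp only [Submodule.coe_add, Pi.add_apply, mul_add, add_mul]
    all_goals exact IntegratesContinuous.integrable (by fun_prop)
  map_smul' c v := by
    ext w
    simp only [pairL, LinearMap.coe_mk, AddHom.coe_mk, LinearMap.smul_apply, Submodule.coe_smul,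
      Pi.mul_apply, Pi.smul_apply, smul_eq_mul, RingHom.id_apply, mul_left_comm _ c, mul_assoc c,
      integral_const_mul]

theorem pairL_apply {ν : Measure X} [IntegratesContinuous ν] {hW : ∀ w ∈ W, Continuous w}
    {f : X → ℝ} {hf : Continuous f} {w : W} : pairL ν hW hf w = ∫ x, f x * w.1 x ∂ν := rfl

theorem pairB_apply {ν : Measure X} [IntegratesContinuous ν] {hW : ∀ w ∈ W, Continuous w}
    {b : X → ℝ} {hb : Continuous b} {v w : W} :
    pairB ν hW hb v w = ∫ x, b x * v.1 x * w.1 x ∂ν := rfl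

end Pairing

theorem continuous_of_mem_polyLT {n : ℕ} : ∀ w ∈ polyLT d n, Continuous w :=
  fun _ h => PolyLT.continuous h

/-- Orthogonality to polynomials of degree less than `k` on the reference simplex. -/
def Perp (k : ℕ) (w : (Fin d → ℝ) → ℝ) : Prop :=
  ∀ p, PolyLT k p → ∫ x in simplex d, w x * p x = 0

theorem Perp.sub {k : ℕ} {v w : (Fin d → ℝ) → ℝ} (hv : Perp k v) (hw : Perp k w)
    (hvc : Continuous v) (hwc : Continuous w) : Perp k fun x => v x - w x := fun p hp => by
  have hpc := hp.continuous
  have h := hv p hp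
  have h' := hw p hp
  simp only [sub_mul]
  rw [integral_sub, h, h', sub_zero]
  all_goals exact integrableOn_simplex (by fun_prop)

theorem Perp.add {k : ℕ} {v w : (Fin d → ℝ) → ℝ} (hv : Perp k v) (hw : Perp k w)
    (hvc : Continuous v) (hwc : Continuous w) : Perp k fun x => v x + w x := fun p hp => by
  have hpc := hp.continuous
  have h := hv p hp
  have h' := hw p hp
  simp only [add_mul]
  rw [integral_add, h, h', add_zero]
  all_goals exact integrableOn_simplex (by fun_prop)

theorem Perp.const_mul {k : ℕ} {w : (Fin d → ℝ) → ℝ} (hw : Perp k w) (c : ℝ) :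
    Perp k fun x => c * w x := fun p hp => by
  simp only [mul_assoc, integral_const_mul, hw p hp, mul_zero]

theorem Perp.sum {k : ℕ} {ι : Type*} (s : Finset ι) {F : ι → (Fin d → ℝ) → ℝ}
    (hF : ∀ i, Perp k (F i)) (hc : ∀ i, Continuous (F i)) :
    Perp k fun x => ∑ i ∈ s, F i x := by
  classical
  induction s using Finset.induction_on with
  | empty => intro p _; simp
  | insert a s ha ih =>
    simp only [Finset.sum_insert ha]
    exact (hF a).add ih (hc a) (continuous_finsetSum _ fun i _ => hc i)

theorem volume_definite {n : ℕ} {b w : (Fin d → ℝ) → ℝ} (hb : Continuous b)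
    (hb0 : ∀ x ∈ simplex d, 0 ≤ b x) (hb1 : ∀ x ∈ openSimplex d, b x ≠ 0) (hw : PolyLT n w)
    (h : ∫ x in simplex d, b x * w x * w x = 0) : w = 0 := by
  have hwc := hw.continuous
  refine hw.eq_zero_of_openSimplex fun x hx => ?_
  have := eqOn_zero_of_setIntegral_eq_zero (f := fun x => b x * w x * w x) (by fun_prop)
    (fun x hx => by rw [mul_assoc]; exact mul_nonneg (hb0 x hx) (mul_self_nonneg _)) h x hx
  rw [mul_assoc, mul_eq_zero, mul_self_eq_zero] at this
  exact this.resolve_left (hb1 x hx)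

/-- The `L²` projection to polynomials. -/
theorem exists_perp_sub (k : ℕ) {f : (Fin d → ℝ) → ℝ} (hf : Continuous f) :
    ∃ δ, PolyLT k δ ∧ Perp k fun x => δ x - f x := by
  obtain ⟨⟨δ, hδ⟩, h⟩ := exists_eq_of_definite
    (pairB (volume.restrict (simplex d)) (continuous_of_mem_polyLT (n := k))
      (continuous_const (y := (1 : ℝ))))
    (fun v hv => Subtype.ext (volume_definite continuous_const (fun _ _ => zero_le_one)
      (fun _ _ => one_ne_zero) v.2 hv))
    (pairL (volume.restrict (simplex d)) continuous_of_mem_polyLT hf)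
  refine ⟨δ, hδ, fun p hp => ?_⟩
  have h1 := LinearMap.congr_fun h ⟨p, hp⟩
  rw [pairB_apply, pairL_apply] at h1
  have hpc := hp.continuous
  have hδc := PolyLT.continuous hδ
  simp only [one_mul] at h1
  simp only [sub_mul]
  rw [integral_sub, h1, sub_self]
  all_goals exact integrableOn_simplex (by fun_prop)

/-- Polynomials of degree at most `k` which are orthogonal to those of degree less than `k`. -/
def perpPoly (d k : ℕ) : Submodule ℝ ((Fin d → ℝ) → ℝ) where
  carrier := {w | PolyLT (k + 1) w ∧ Perp k w}
  zero_mem' := ⟨.zero _, fun p _ => by simp⟩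
  add_mem' := fun h h' => ⟨h.1.add h'.1, h.2.add h'.2 h.1.continuous h'.1.continuous⟩
  smul_mem' c _ h := ⟨h.1.const_mul c, h.2.const_mul c⟩

instance finiteDimensional_perpPoly (d k : ℕ) : FiniteDimensional ℝ (perpPoly d k) :=
  Submodule.finiteDimensional_of_le (S₂ := polyLT d (k + 1)) fun _ h => h.1

theorem continuous_of_mem_perpPoly {k : ℕ} : ∀ w ∈ perpPoly d k, Continuous w :=
  fun _ h => h.1.continuous

theorem polyLT_linear {n : ℕ} (L : (Fin d → ℝ) →ₗ[ℝ] ℝ) {F : Fin d → (Fin n → ℝ) → ℝ} {l : ℕ}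
    (hF : ∀ j, PolyLT l (F j)) : PolyLT l fun x => L fun j => F j x := by
  have h : ∀ x, (L fun j => F j x) = ∑ j, L (Pi.single j 1) * F j x := fun x => by
    conv_lhs => rw [show (fun j => F j x) = ∑ j, F j x • Pi.single j (1 : ℝ) by
      simpa using pi_eq_sum_univ' fun j => F j x]
    simp only [map_sum, map_smul, smul_eq_mul, mul_comm]
  simp only [h]
  exact PolyLT.sum _ fun j _ => (hF j).const_mul _

section Faces

variable {m : ℕ}

theorem polyLT_faceMap (i : Fin (m + 2)) (l : Fin (m + 1)) :
    PolyLT 2 fun y : Fin m → ℝ => faceMap i y l := by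
  obtain ⟨b, L, -, h⟩ := exists_faceMap_eq i
  rw [h]
  exact ((PolyLT.const 0 (b l)).mono (by norm_num)).add
    (polyLT_linear (LinearMap.proj l ∘ₗ L) fun j => PolyLT.coord j)

theorem eq_zero_on_face {n : ℕ} {w : (Fin (m + 1) → ℝ) → ℝ} (hw : PolyLT n w) (i : Fin (m + 2))
    (h : ∫ x, w x * w x ∂faceMeasure i = 0) : ∀ x ∈ face i, w x = 0 := by
  have hwc := hw.continuous
  rw [integral_faceMeasure i (by fun_prop)] at h
  have h0 := volume_definite (continuous_const (y := (1 : ℝ))) (fun _ _ => zero_le_one)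
    (fun _ _ => one_ne_zero) (hw.comp (polyLT_faceMap i)) (by simpa using h)
  intro x hx
  rw [← faceMap_image] at hx
  obtain ⟨y, -, rfl⟩ := hx
  exact congrFun h0 y

theorem sub_lam_smul_mem_face {i j : Fin (d + 1)} (hij : i ≠ j) {x : Fin d → ℝ}
    (hx : x ∈ simplex d) : x - lam i x • (vtx i - vtx j) ∈ face i := by
  have h : ∀ l, lam l (x - lam i x • (vtx i - vtx j)) =
      lam l x - lam i x * ((if l = i then 1 else 0) - if l = j then 1 else 0) := fun l => by
    rw [sub_eq_add_neg, lam_add, map_neg, map_smul, dlam_sub, lam_vtx, lam_vtx, smul_eq_mul]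
    ring
  refine ⟨fun l => ?_, by simp [h, hij]⟩
  rw [h]
  have h1 := hx l
  have h2 := hx i
  split_ifs with h3 h4 h4
  · exact absurd (h3.symm.trans h4) hij
  · subst h3; simp
  · simp; linarith
  · simpa

theorem perpPoly_eq_zero_of_face {k : ℕ} {w : (Fin (m + 1) → ℝ) → ℝ} (hw : PolyLT (k + 1) w)
    (hp : Perp k w) (i : Fin (m + 2)) (h : ∫ x, w x * w x ∂faceMeasure i = 0) : w = 0 := by
  obtain ⟨j, hj⟩ := exists_ne i
  obtain ⟨s, hs, hws⟩ := hw.exists_factor (polyLT_lam i) (vtx i - vtx j)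
  have h1 : ∀ x ∈ simplex (m + 1), w x = lam i x * s x := fun x hx => by
    rw [← hws, eq_zero_on_face hw i h _ (sub_lam_smul_mem_face hj.symm hx), sub_zero]
  have h2 : s = 0 := by
    refine volume_definite (continuous_lam i) (fun x hx => hx i) (fun x hx => (hx i).ne') hs ?_
    rw [← hp s hs]
    exact setIntegral_congr_fun measurableSet_simplex fun x hx => by simp only [h1 x hx]
  refine hw.eq_zero_of_openSimplex fun x hx => ?_
  rw [h1 x (openSimplex_subset hx), h2]
  simp

theorem exists_perp_trace {k : ℕ} (i : Fin (m + 2)) {P : (Fin (m + 1) → ℝ) → ℝ}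
    (hP : PolyLT (k + 1) P) :
    ∃ w, PolyLT (k + 1) w ∧ Perp k w ∧ ∀ x ∈ face i, w x = P x := by
  obtain ⟨⟨s, hs⟩, h⟩ := exists_eq_of_definite
    (pairB (volume.restrict (simplex (m + 1))) (continuous_of_mem_polyLT (n := k))
      (continuous_lam i))
    (fun v hv => Subtype.ext (volume_definite (continuous_lam i) (fun x hx => hx i)
      (fun x hx => (hx i).ne') v.2 hv))
    (pairL (volume.restrict (simplex (m + 1))) continuous_of_mem_polyLT hP.continuous)
  refine ⟨fun x => P x - lam i x * s x, hP.sub (((polyLT_lam i).mul hs).mono (by omega)),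
    fun p hp => ?_, fun x hx => by simp [hx.2]⟩
  have h1 := LinearMap.congr_fun h ⟨p, hp⟩
  rw [pairB_apply, pairL_apply] at h1
  have hpc := hp.continuous
  have hsc := PolyLT.continuous hs
  have hPc := hP.continuous
  have hlc := continuous_lam i
  simp only [sub_mul]
  rw [integral_sub, h1, sub_self]
  all_goals exact integrableOn_simplex (by fun_prop)

theorem exists_volNorm_le_face (m k : ℕ) : ∃ C, 0 ≤ C ∧ ∀ (i : Fin (m + 2))
    (w : (Fin (m + 1) → ℝ) → ℝ), PolyLT (k + 1) w → Perp k w →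
      volNorm w ≤ C * l2 (faceMeasure i) w := by
  have h : ∀ i : Fin (m + 2), ∃ C, 0 ≤ C ∧ ∀ v : perpPoly (m + 1) k,
      volNorm v.1 ≤ C * l2 (faceMeasure i) v.1 := fun i =>
    exists_l2_le _ _ (perpPoly (m + 1) k).subtype (perpPoly (m + 1) k).subtype
      (fun v => v.2.1.continuous) (fun v => v.2.1.continuous) fun v hv => Subtype.ext
        (perpPoly_eq_zero_of_face v.2.1 v.2.2 i (by simpa [sq] using hv))
  choose C hC0 hC using h
  refine ⟨∑ i, C i, Finset.sum_nonneg fun i _ => hC0 i, fun i w hw hp => (hC i ⟨w, hw, hp⟩).trans ?_⟩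
  exact mul_le_mul_of_nonneg_right (Finset.single_le_sum (fun i _ => hC0 i) (Finset.mem_univ i))
    l2_nonneg

theorem exists_face_le_volNorm (m n : ℕ) : ∃ C, 0 ≤ C ∧ ∀ (i : Fin (m + 2))
    (w : (Fin (m + 1) → ℝ) → ℝ), PolyLT n w → l2 (faceMeasure i) w ≤ C * volNorm w := by
  have h : ∀ i : Fin (m + 2), ∃ C, 0 ≤ C ∧ ∀ v : polyLT (m + 1) n,
      l2 (faceMeasure i) v.1 ≤ C * volNorm v.1 := fun i =>
    exists_l2_le _ _ (polyLT (m + 1) n).subtype (polyLT (m + 1) n).subtype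
      (fun v => PolyLT.continuous v.2) (fun v => PolyLT.continuous v.2) fun v hv => Subtype.ext
        (volume_definite (continuous_const (y := (1 : ℝ))) (fun _ _ => zero_le_one)
          (fun _ _ => one_ne_zero) v.2 (by simpa [sq] using hv))
  choose C hC0 hC using h
  refine ⟨∑ i, C i, Finset.sum_nonneg fun i _ => hC0 i, fun i w hw => (hC i ⟨w, hw⟩).trans ?_⟩
  exact mul_le_mul_of_nonneg_right (Finset.single_le_sum (fun i _ => hC0 i) (Finset.mem_univ i))
    l2_nonneg

end Faces

section Projection

variable {m k : ℕ}

/-- The HDG projection system on the reference simplex with facewise weights `t`. -/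
structure RefProj (k : ℕ) (t : Fin (m + 2) → ℝ) (q : Fin (m + 1) → (Fin (m + 1) → ℝ) → ℝ)
    (u : (Fin (m + 1) → ℝ) → ℝ) (Pq : Fin (m + 1) → (Fin (m + 1) → ℝ) → ℝ)
    (Pu : (Fin (m + 1) → ℝ) → ℝ) : Prop where
  polyq : ∀ j, PolyLT (k + 1) (Pq j)
  polyu : PolyLT (k + 1) Pu
  volq : ∀ j, Perp k fun x => Pq j x - q j x
  volu : Perp k fun x => Pu x - u x
  face : ∀ i μ, PolyLT (k + 1) μ → ∫ x, (-dlam i (fun j => Pq j x - q j x) +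
    t i * (Pu x - u x)) * μ x ∂faceMeasure i = 0

variable {t : Fin (m + 2) → ℝ} {q Pq Pq' : Fin (m + 1) → (Fin (m + 1) → ℝ) → ℝ}
  {u Pu Pu' w : (Fin (m + 1) → ℝ) → ℝ}

theorem continuous_dlam_field (i : Fin (d + 1)) {F : Fin d → (Fin d → ℝ) → ℝ}
    (hF : ∀ j, Continuous (F j)) : Continuous fun x => dlam i fun j => F j x :=
  (LinearMap.continuous_of_finiteDimensional (dlam i)).comp (continuous_pi hF)

theorem sum_integral_face_eq (hP : ∀ j, PolyLT (k + 1) (Pq j)) (hq : ∀ j, ContDiff ℝ 1 (q j))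
    (hv : ∀ j, Perp k fun x => Pq j x - q j x) (hw : PolyLT (k + 1) w) (hwp : Perp k w) :
    ∑ i, ∫ x, dlam i (fun j => Pq j x - q j x) * w x ∂faceMeasure i =
      ∫ x in simplex (m + 1), (∑ j, pd j (q j) x) * w x := by
  have hF : ∀ j, ContDiff ℝ 1 fun x => (Pq j x - q j x) * w x := fun j =>
    ((hP j).contDiff.sub (hq j)).mul hw.contDiff
  have h := integral_div hF
  have hpd : ∀ j x, pd j (fun x => (Pq j x - q j x) * w x) x =
      w x * pd j (Pq j) x - pd j (q j) x * w x + (Pq j x - q j x) * pd j w x := fun j x => by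
    rw [pd_mul ((hP j).contDiff.sub (hq j)) hw.contDiff, pd_sub (hP j).contDiff (hq j)]
    ring
  have hd : ∀ i x, dlam i (fun j => (Pq j x - q j x) * w x) =
      dlam i (fun j => Pq j x - q j x) * w x := fun i x => by
    have : (fun j => (Pq j x - q j x) * w x) = w x • fun j => Pq j x - q j x := by
      ext j; simp [mul_comm]
    rw [this, map_smul, smul_eq_mul, mul_comm]
  have hwc := hw.continuous
  have c1 : ∀ j, Continuous (pd j (Pq j)) := fun j => continuous_pd (hP j).contDiff j
  have c2 : ∀ j, Continuous (pd j (q j)) := fun j => continuous_pd (hq j) j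
  have c3 : ∀ j, Continuous (pd j w) := fun j => continuous_pd hw.contDiff j
  have c4 : ∀ j, Continuous (Pq j) := fun j => (hP j).continuous
  have c5 : ∀ j, Continuous (q j) := fun j => (hq j).continuous
  have h1 : ∀ j, ∫ x in simplex (m + 1), pd j (fun x => (Pq j x - q j x) * w x) x =
      -∫ x in simplex (m + 1), pd j (q j) x * w x := fun j => by
    have e1 : ∫ x in simplex (m + 1), w x * pd j (Pq j) x = 0 := hwp _ ((hP j).pd j)
    have e2 : ∫ x in simplex (m + 1), (Pq j x - q j x) * pd j w x = 0 := hv j _ (hw.pd j)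
    simp only [hpd]
    rw [integral_add, integral_sub, e1, e2]
    · ring
    all_goals exact integrableOn_simplex (by fun_prop)
  rw [integral_finsetSum _ fun j _ => integrableOn_simplex (continuous_pd (hF j) j)] at h
  simp only [h1, hd, Finset.sum_neg_distrib, neg_inj] at h
  simp only [Finset.sum_mul]
  rw [← h, integral_finsetSum]
  exact fun j _ => integrableOn_simplex ((c2 j).mul hwc)

theorem RefProj.sum_integral_face (h : RefProj k t q u Pq Pu) (hq : ∀ j, ContDiff ℝ 1 (q j))
    (hu : ContDiff ℝ 1 u) (hw : PolyLT (k + 1) w) (hwp : Perp k w) :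
    ∑ i, t i * ∫ x, (Pu x - u x) * w x ∂faceMeasure i =
      ∫ x in simplex (m + 1), (∑ j, pd j (q j) x) * w x := by
  rw [← sum_integral_face_eq h.polyq hq h.volq hw hwp]
  refine Finset.sum_congr rfl fun i _ => ?_
  have h1 := h.face i w hw
  have c1 := h.polyu.continuous
  have c2 := hu.continuous
  have c3 := hw.continuous
  have c4 := continuous_dlam_field i fun j => (h.polyq j).continuous.sub (hq j).continuous
  have e : ∀ x, (-dlam i (fun j => Pq j x - q j x) + t i * (Pu x - u x)) * w x =
    t i * ((Pu x - u x) * w x) - dlam i (fun j => Pq j x - q j x) * w x := fun x => by ring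
  simp only [e] at h1
  rw [integral_sub, integral_const_mul] at h1
  · linarith
  all_goals exact integrable_faceMeasure i (by fun_prop)

theorem RefProj.sub (h : RefProj k t q u Pq Pu) (h' : RefProj k t q u Pq' Pu')
    (hq : ∀ j, Continuous (q j)) (hu : Continuous u) :
    RefProj k t (fun _ _ => 0) (fun _ => 0) (fun j x => Pq j x - Pq' j x)
      fun x => Pu x - Pu' x where
  polyq j := (h.polyq j).sub (h'.polyq j)
  polyu := h.polyu.sub h'.polyu
  volq j := by
    simpa using (h.volq j).sub (h'.volq j) ((h.polyq j).continuous.sub (hq j))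
      ((h'.polyq j).continuous.sub (hq j))
  volu := by
    simpa using h.volu.sub h'.volu (h.polyu.continuous.sub hu) (h'.polyu.continuous.sub hu)
  face i μ hμ := by
    have c1 := h.polyu.continuous
    have c1' := h'.polyu.continuous
    have c3 := hμ.continuous
    have c4 := continuous_dlam_field i fun j => (h.polyq j).continuous.sub (hq j)
    have c4' := continuous_dlam_field i fun j => (h'.polyq j).continuous.sub (hq j)
    have e : ∀ x, dlam i (fun j => Pq j x - Pq' j x - 0) =
        dlam i (fun j => Pq j x - q j x) - dlam i fun j => Pq' j x - q j x := fun x => by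
      rw [← map_sub]; congr 1; ext j; simp
    have h0 := h.face i μ hμ
    have h0' := h'.face i μ hμ
    refine Eq.trans ?_ (sub_eq_zero.2 (h0.trans h0'.symm))
    rw [← integral_sub]
    · congr 1; ext x; rw [e]; ring
    all_goals exact integrable_faceMeasure i (by fun_prop)

theorem exists_refProj (ht : ∀ i, 0 < t i) (hq : ∀ j, ContDiff ℝ 1 (q j)) (hu : ContDiff ℝ 1 u) :
    ∃ Pq Pu, RefProj k t q u Pq Pu := by
  have cq : ∀ j, Continuous (q j) := fun j => (hq j).continuous
  have cu := hu.continuous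
  have hW := continuous_of_mem_perpPoly (d := m + 1) (k := k)
  obtain ⟨δ₁, hδ₁, hδ₁p⟩ := exists_perp_sub k cu
  have cδ₁ := hδ₁.continuous
  have cdiv : Continuous fun x => ∑ j, pd j (q j) x :=
    continuous_finsetSum _ fun j _ => continuous_pd (hq j) j
  obtain ⟨⟨δ₂, hδ₂, hδ₂p⟩, hB⟩ := exists_eq_of_definite
    (∑ i, t i • pairB (faceMeasure i) hW (continuous_const (y := (1 : ℝ))))
    (fun v hv => by
      simp only [LinearMap.sum_apply, LinearMap.smul_apply, pairB_apply, one_mul, smul_eq_mul] at hv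
      have h0 := (Finset.sum_eq_zero_iff_of_nonneg fun i _ => mul_nonneg (ht i).le
        (integral_nonneg fun x => mul_self_nonneg (v.1 x))).1 hv 0 (Finset.mem_univ _)
      exact Subtype.ext (perpPoly_eq_zero_of_face v.2.1 v.2.2 0
        ((mul_eq_zero.1 h0).resolve_left (ht 0).ne')))
    (pairL (volume.restrict (simplex (m + 1))) hW cdiv -
      ∑ i, t i • pairL (faceMeasure i) hW (cδ₁.sub cu))
  have cδ₂ := hδ₂.continuous
  set Pu : (Fin (m + 1) → ℝ) → ℝ := fun x => δ₁ x + δ₂ x with hPu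
  have hPuP : PolyLT (k + 1) Pu := (hδ₁.mono k.le_succ).add hδ₂
  have cPu := hPuP.continuous
  have hPuw : ∀ w, PolyLT (k + 1) w → Perp k w →
      ∑ i, t i * ∫ x, (Pu x - u x) * w x ∂faceMeasure i =
        ∫ x in simplex (m + 1), (∑ j, pd j (q j) x) * w x := fun w hw hwp => by
    have h1 := LinearMap.congr_fun hB ⟨w, hw, hwp⟩
    simp only [LinearMap.sum_apply, LinearMap.smul_apply, LinearMap.sub_apply, pairB_apply,
      pairL_apply, one_mul, smul_eq_mul, Pi.sub_apply] at h1
    rw [eq_sub_iff_add_eq, ← Finset.sum_add_distrib] at h1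
    rw [← h1]
    refine Finset.sum_congr rfl fun i _ => ?_
    have cw := hw.continuous
    rw [← mul_add, ← integral_add]
    · congr 2; ext x; simp only [hPu]; ring
    all_goals exact integrable_faceMeasure i (by fun_prop)
  have hface : ∀ i : Fin (m + 2), ∃ a, PolyLT (k + 1) a ∧
      (Perp k fun x => a x - dlam i fun j => q j x) ∧
      ∀ μ, PolyLT (k + 1) μ → ∫ x, (-(a x - dlam i fun j => q j x) +
        t i * (Pu x - u x)) * μ x ∂faceMeasure i = 0 := fun i => by
    have cd := continuous_dlam_field i cq
    obtain ⟨a₁, ha₁, ha₁p⟩ := exists_perp_sub k cd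
    have ca₁ := ha₁.continuous
    have cr : Continuous fun x => (dlam i fun j => q j x) + t i * (Pu x - u x) - a₁ x := by fun_prop
    obtain ⟨⟨a₂, ha₂, ha₂p⟩, hB⟩ := exists_eq_of_definite
      (pairB (faceMeasure i) hW (continuous_const (y := (1 : ℝ))))
      (fun v hv => Subtype.ext (perpPoly_eq_zero_of_face v.2.1 v.2.2 i
        (by simpa only [pairB_apply, one_mul] using hv)))
      (pairL (faceMeasure i) hW cr)
    have ca₂ := ha₂.continuous
    refine ⟨fun x => a₁ x + a₂ x, (ha₁.mono k.le_succ).add ha₂, ?_, fun μ hμ => ?_⟩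
    · convert ha₁p.add ha₂p (ca₁.sub cd) ca₂ using 2
      ring
    · obtain ⟨w, hw, hwp, hwμ⟩ := exists_perp_trace i hμ
      have h1 := LinearMap.congr_fun hB ⟨w, hw, hwp⟩
      simp only [pairB_apply, pairL_apply, one_mul] at h1
      have cw := hw.continuous
      rw [← sub_eq_zero, ← integral_sub] at h1
      · rw [← neg_eq_zero, ← integral_neg, ← h1]
        refine integral_congr_ae ?_
        filter_upwards [ae_mem_face i] with x hx
        rw [hwμ x hx]
        ring
      all_goals exact integrable_faceMeasure i (by fun_prop)
  choose a ha hap haf using fun j : Fin (m + 1) => hface j.succ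
  simp only [dlam_succ] at hap haf
  refine ⟨a, Pu, ha, hPuP, hap, ?_, fun i μ hμ => ?_⟩
  · convert hδ₁p.add hδ₂p (cδ₁.sub cu) cδ₂ using 2
    simp only [hPu]; ring
  · cases i using Fin.cases with
    | succ j => simpa only [dlam_succ] using haf j μ hμ
    | zero =>
      obtain ⟨w, hw, hwp, hwμ⟩ := exists_perp_trace 0 hμ
      have cw := hw.continuous
      have h1 := sum_integral_face_eq ha hq hap hw hwp
      rw [← hPuw w hw hwp] at h1
      have h2 : ∀ i, ∫ x, (-dlam i (fun j => a j x - q j x) + t i * (Pu x - u x)) * w x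
          ∂faceMeasure i = t i * (∫ x, (Pu x - u x) * w x ∂faceMeasure i) -
            ∫ x, dlam i (fun j => a j x - q j x) * w x ∂faceMeasure i := fun i => by
        have cd := continuous_dlam_field i fun j => (ha j).continuous.sub (cq j)
        rw [← integral_const_mul, ← integral_sub]
        · congr 1; ext x; ring
        all_goals exact integrable_faceMeasure i (by fun_prop)
      rw [← sub_eq_zero, ← neg_eq_zero, neg_sub, ← Finset.sum_sub_distrib] at h1
      simp only [← h2] at h1
      rw [Fin.sum_univ_succ, Finset.sum_eq_zero, add_zero] at h1
      · rw [← h1]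
        refine integral_congr_ae ?_
        filter_upwards [ae_mem_face 0] with x hx
        rw [hwμ x hx]
      · intro j _
        simpa only [dlam_succ] using haf j w hw

end Projection

section Estimates

variable {m k : ℕ} {t : Fin (m + 2) → ℝ} {q Pq : Fin (m + 1) → (Fin (m + 1) → ℝ) → ℝ}
  {u Pu : (Fin (m + 1) → ℝ) → ℝ}

theorem Perp.volNorm_le {a f : (Fin d → ℝ) → ℝ} (h : Perp k fun x => a x - f x) (ha : PolyLT k a)
    (hf : Continuous f) : volNorm a ≤ volNorm f := by
  have hac := ha.continuous
  refine l2_le_of_integral_sq_le (le_trans (le_of_eq ?_) (integral_mul_le hf hac)) l2_nonneg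
  rw [← sub_eq_zero, ← integral_sub, ← h a ha]
  · congr 1; ext x; ring
  all_goals exact integrableOn_simplex (by fun_prop)

/-- A polynomial with the same moments as `g` is the sum of a polynomial bounded by `g` and one
orthogonal to lower degrees. -/
theorem exists_perp_split {δ g : (Fin d → ℝ) → ℝ} (hδ : PolyLT (k + 1) δ) (hg : Continuous g)
    (h : Perp k fun x => δ x - g x) : ∃ δ₁ δ₂, PolyLT k δ₁ ∧ PolyLT (k + 1) δ₂ ∧ Perp k δ₂ ∧
      (∀ x, δ x = δ₁ x + δ₂ x) ∧ volNorm δ₁ ≤ volNorm g := by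
  have hδc := hδ.continuous
  obtain ⟨δ₁, hδ₁, hp⟩ := exists_perp_sub k hδc
  have hδ₁c := hδ₁.continuous
  refine ⟨δ₁, fun x => δ x - δ₁ x, hδ₁, hδ.sub (hδ₁.mono k.le_succ), ?_, fun x => by ring, ?_⟩
  · convert hp.const_mul (-1) using 2; ring
  · refine Perp.volNorm_le ?_ hδ₁ hg
    convert hp.add h (hδ₁c.sub hδc) (hδc.sub hg) using 2; ring

theorem exists_refProj_scalar_le (m k : ℕ) : ∃ C, 0 ≤ C ∧ ∀ (t : Fin (m + 2) → ℝ)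
    (q Pq : Fin (m + 1) → (Fin (m + 1) → ℝ) → ℝ) (u Pu P p : (Fin (m + 1) → ℝ) → ℝ),
    (∀ i, 0 < t i) → (∀ j, ContDiff ℝ 1 (q j)) → ContDiff ℝ 1 u → RefProj k t q u Pq Pu →
    PolyLT (k + 1) P → PolyLT k p → ∀ j,
    volNorm (fun x => Pu x - u x) ≤ C * (h1 (fun x => u x - P x) +
      volNorm (fun x => (∑ j, pd j (q j) x) - p x) / t j) ∧
    l2 (faceMeasure j) (fun x => Pu x - u x) ≤ C * (h1 (fun x => u x - P x) +
      volNorm (fun x => (∑ j, pd j (q j) x) - p x) / t j) := by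
  obtain ⟨C₁, hC₁, h₁⟩ := exists_volNorm_le_face m k
  obtain ⟨C₂, hC₂, h₂⟩ := exists_face_le_volNorm m (k + 1)
  set c : ℝ := (m + 2) * ((m + 1 + C₂) * C₂) with hc
  have hc0 : 0 ≤ c := by positivity
  refine ⟨(1 + C₂) * (C₁ ^ 2 * (1 + c)) + (2 + (m + 1) + C₂), by positivity,
    fun t q Pq u Pu P p ht hq hu hP hPP hp j => ?_⟩
  set g : (Fin (m + 1) → ℝ) → ℝ := fun x => u x - P x with hg
  set f : (Fin (m + 1) → ℝ) → ℝ := fun x => (∑ j, pd j (q j) x) - p x with hf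
  have gC : ContDiff ℝ 1 g := hu.sub hPP.contDiff
  have gc := gC.continuous
  have cu := hu.continuous
  have cP := hPP.continuous
  have cp := hp.continuous
  have cdiv : Continuous fun x => ∑ j, pd j (q j) x :=
    continuous_finsetSum _ fun j _ => continuous_pd (hq j) j
  have fc : Continuous f := cdiv.sub cp
  obtain ⟨δ₁, δ₂, hδ₁, hδ₂, hδ₂p, hδ, hδ₁g⟩ := exists_perp_split (hP.polyu.sub hPP) gc
    (by convert hP.volu using 2; simp only [hg]; ring)
  have cδ₁ := hδ₁.continuous
  have cδ₂ := hδ₂.continuous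
  have hPu : ∀ x, Pu x - u x = δ₂ x - (g x - δ₁ x) := fun x => by
    have := hδ x; simp only [hg]; linarith
  have hg0 := h1_nonneg g
  have hNg := volNorm_le_h1 g
  have hN₂ : 0 ≤ volNorm δ₂ := l2_nonneg
  have hNf : 0 ≤ volNorm f := l2_nonneg
  have hr : ∀ i, l2 (faceMeasure i) (fun x => g x - δ₁ x) ≤ (m + 1 + C₂) * h1 g := fun i => by
    have e1 := l2_sub_le (μ := faceMeasure i) gc cδ₁
    have e2 := l2_faceMeasure_le gC i
    have e3 := (h₂ i δ₁ (hδ₁.mono k.le_succ)).trans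
      (mul_le_mul_of_nonneg_left (hδ₁g.trans hNg) hC₂)
    linarith
  obtain ⟨a, ha⟩ := Finite.exists_max t
  have key : t a * volNorm δ₂ ^ 2 ≤ C₁ ^ 2 * ((volNorm f + t a * (c * h1 g)) * volNorm δ₂) := by
    have e1 := hP.sum_integral_face hq hu hδ₂ hδ₂p
    have e2 : ∫ x in simplex (m + 1), (∑ j, pd j (q j) x) * δ₂ x ≤ volNorm f * volNorm δ₂ := by
      refine le_trans (le_of_eq ?_) (integral_mul_le fc cδ₂)
      rw [← add_zero (∫ x in simplex (m + 1), f x * δ₂ x), ← hδ₂p p hp, ← integral_add]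
      · congr 1; ext x; simp only [hf]; ring
      all_goals exact integrableOn_simplex (by fun_prop)
    have e3 : ∀ i, t i * l2 (faceMeasure i) δ₂ ^ 2 - t a * ((m + 1 + C₂) * C₂ * h1 g * volNorm δ₂)
        ≤ t i * ∫ x, (Pu x - u x) * δ₂ x ∂faceMeasure i := fun i => by
      have e4 : ∫ x, (Pu x - u x) * δ₂ x ∂faceMeasure i =
          l2 (faceMeasure i) δ₂ ^ 2 - ∫ x, (g x - δ₁ x) * δ₂ x ∂faceMeasure i := by
        rw [l2_sq, ← integral_sub]
        · congr 1; ext x; rw [hPu]; ring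
        all_goals exact integrable_faceMeasure i (by fun_prop)
      have e5 : ∫ x, (g x - δ₁ x) * δ₂ x ∂faceMeasure i ≤
          (m + 1 + C₂) * C₂ * h1 g * volNorm δ₂ := by
        refine (integral_mul_le (gc.sub cδ₁) cδ₂).trans ?_
        calc _ ≤ ((m + 1 + C₂) * h1 g) * (C₂ * volNorm δ₂) :=
              mul_le_mul (hr i) (h₂ i δ₂ hδ₂) l2_nonneg (by positivity)
          _ = _ := by ring
      have e6 := mul_le_mul_of_nonneg_left e5 (ht i).le
      have e7 := mul_le_mul_of_nonneg_right (ha i)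
        (show 0 ≤ (m + 1 + C₂) * C₂ * h1 g * volNorm δ₂ by positivity)
      rw [e4, mul_sub]
      linarith
    have e4 := Finset.sum_le_sum fun i (_ : i ∈ Finset.univ) => e3 i
    rw [e1, Finset.sum_sub_distrib, Finset.sum_const, Finset.card_univ, Fintype.card_fin,
      nsmul_eq_mul] at e4
    have e5 := Finset.single_le_sum (f := fun i => t i * l2 (faceMeasure i) δ₂ ^ 2)
      (fun i _ => mul_nonneg (ht i).le (sq_nonneg _)) (Finset.mem_univ a)
    have e6 : t a * l2 (faceMeasure a) δ₂ ^ 2 ≤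
        (volNorm f + t a * (c * h1 g)) * volNorm δ₂ := by
      push_cast at e4
      simp only [hc]
      linarith
    have e7 := pow_le_pow_left₀ hN₂ (h₁ a δ₂ hδ₂ hδ₂p) 2
    have e8 := mul_le_mul_of_nonneg_left e7 (ht a).le
    have e9 := mul_le_mul_of_nonneg_left e6 (sq_nonneg C₁)
    calc _ ≤ _ := e8
      _ = _ := by ring
      _ ≤ _ := e9
  have hδ₂le : volNorm δ₂ ≤ C₁ ^ 2 * (1 + c) * (h1 g + volNorm f / t j) := by
    have e1 : volNorm f / t a ≤ volNorm f / t j := div_le_div_of_nonneg_left hNf (ht j) (ha j)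
    have e0 : 0 ≤ volNorm f / t a := div_nonneg hNf (ht a).le
    have e2 : volNorm δ₂ ≤ C₁ ^ 2 * (volNorm f / t a + c * h1 g) := by
      rcases hN₂.eq_or_lt with h0 | h0
      · rw [← h0]; positivity
      · refine le_of_mul_le_mul_left ?_ (mul_pos (ht a) h0)
        calc t a * volNorm δ₂ * volNorm δ₂ = t a * volNorm δ₂ ^ 2 := by ring
          _ ≤ _ := key
          _ = _ := by field_simp [(ht a).ne']
    refine e2.trans ?_
    rw [mul_assoc (C₁ ^ 2) (1 + c)]
    refine mul_le_mul_of_nonneg_left ?_ (sq_nonneg C₁)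
    nlinarith [mul_nonneg hc0 (e0.trans e1)]
  set R := h1 g + volNorm f / t j with hR
  have hR2 : 0 ≤ volNorm f / t j := div_nonneg hNf (ht j).le
  have hR0 : h1 g ≤ R := by rw [hR]; linarith
  have hR1 := hg0.trans hR0
  set A := C₁ ^ 2 * (1 + c) with hA
  have hA0 : 0 ≤ A := by positivity
  have cr : Continuous fun x => g x - δ₁ x := gc.sub cδ₁
  have hAR := mul_nonneg hA0 hR1
  have hmR := mul_nonneg (m.cast_nonneg (α := ℝ)) hR1
  have hCR := mul_nonneg hC₂ hR1
  constructor
  · have e1 := l2_sub_le (μ := volume.restrict (simplex (m + 1))) cδ₂ cr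
    have e2 := l2_sub_le (μ := volume.restrict (simplex (m + 1))) gc cδ₁
    have e3 := mul_nonneg hC₂ hAR
    simp only [hPu, volNorm] at *
    linarith
  · have e1 := l2_sub_le (μ := faceMeasure j) cδ₂ cr
    have e2 := (h₂ j δ₂ hδ₂).trans (mul_le_mul_of_nonneg_left hδ₂le hC₂)
    have e3 := (hr j).trans (mul_le_mul_of_nonneg_left hR0 (by positivity))
    simp only [hPu]
    linarith

end Estimates

section FieldEstimate

theorem sum_dlam (y : Fin d → ℝ) : ∑ i, dlam i y = 0 := by
  simp [Fin.sum_univ_succ]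

theorem abs_dlam_single_le (i : Fin (d + 1)) (j : Fin d) : |dlam i (Pi.single j 1)| ≤ 1 := by
  cases i using Fin.cases with
  | zero => simp
  | succ i =>
    rw [dlam_succ, Pi.single_apply]
    split <;> simp

theorem l2_dlam_le {X : Type*} [MeasurableSpace X] [TopologicalSpace X] {μ : Measure X}
    [IntegratesContinuous μ] {F : Fin d → X → ℝ} (hF : ∀ j, Continuous (F j)) (i : Fin (d + 1)) :
    l2 μ (fun x => dlam i fun j => F j x) ≤ ∑ j, l2 μ (F j) := by
  have e : ∀ x, dlam i (fun j => F j x) = ∑ j, dlam i (Pi.single j 1) * F j x := fun x =>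
    (dlam_eq_sum i _).trans (Finset.sum_congr rfl fun j _ => mul_comm _ _)
  simp only [e]
  refine (l2_sum_le _ fun j => continuous_const.mul (hF j)).trans
    (Finset.sum_le_sum fun j _ => ?_)
  exact (l2_const_mul _).trans_le <| mul_le_of_le_one_left l2_nonneg (abs_dlam_single_le i j)

theorem perp_dlam_field {k : ℕ} {F : Fin d → (Fin d → ℝ) → ℝ} (h : ∀ j, Perp k (F j))
    (hF : ∀ j, Continuous (F j)) (i : Fin (d + 1)) : Perp k fun x => dlam i fun j => F j x := by
  have e : ∀ x, dlam i (fun j => F j x) = ∑ j, dlam i (Pi.single j 1) * F j x := fun x =>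
    (dlam_eq_sum i _).trans (Finset.sum_congr rfl fun j _ => mul_comm _ _)
  simp only [e]
  exact Perp.sum _ (fun j => (h j).const_mul _) fun j => continuous_const.mul (hF j)

theorem exists_refProj_field_le (m k : ℕ) : ∃ C, 0 ≤ C ∧ ∀ (t : Fin (m + 2) → ℝ)
    (q Pq Q : Fin (m + 1) → (Fin (m + 1) → ℝ) → ℝ) (u Pu P p : (Fin (m + 1) → ℝ) → ℝ),
    (∀ i, 0 < t i) → (∀ j, ContDiff ℝ 1 (q j)) → ContDiff ℝ 1 u → RefProj k t q u Pq Pu →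
    (∀ j, PolyLT (k + 1) (Q j)) → PolyLT (k + 1) P → PolyLT k p →
    ∀ (a : Fin (m + 2)) (s : ℝ), (∀ i ≠ a, t i ≤ s) → ∀ j,
    volNorm (fun x => Pq j x - q j x) ≤ C * ((∑ j, h1 fun x => q j x - Q j x) +
      s * h1 (fun x => u x - P x) + volNorm fun x => (∑ j, pd j (q j) x) - p x) := by
  obtain ⟨C₀, hC₀, h₀⟩ := exists_refProj_scalar_le m k
  obtain ⟨C₁, hC₁, h₁⟩ := exists_volNorm_le_face m k
  obtain ⟨C₂, hC₂, h₂⟩ := exists_face_le_volNorm m (k + 1)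
  set B : ℝ := C₁ * (m + 1 + C₂ + C₀) + 2 with hB
  have hB0 : 0 ≤ B := by positivity
  refine ⟨(m + 1) * B, by positivity,
    fun t q Pq Q u Pu P p ht hq hu hP hQ hPP hp a s hs => ?_⟩
  set H := ∑ j, h1 fun x => q j x - Q j x with hH
  set G := h1 fun x => u x - P x with hG
  set N := volNorm fun x => (∑ j, pd j (q j) x) - p x with hN
  have hH0 : 0 ≤ H := Finset.sum_nonneg fun _ _ => h1_nonneg _
  have hG0 : 0 ≤ G := h1_nonneg _
  have hN0 : 0 ≤ N := l2_nonneg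
  have hs0 : 0 ≤ s := by
    obtain ⟨i, hi⟩ := exists_ne a
    exact (ht i).le.trans (hs i hi)
  have hsG : 0 ≤ s * G := mul_nonneg hs0 hG0
  have cu := hu.continuous
  have cPu := hP.polyu.continuous
  have cqQ : ∀ j, Continuous fun x => q j x - Q j x :=
    fun j => (hq j).continuous.sub (hQ j).continuous
  have cPQ : ∀ j, Continuous fun x => Pq j x - Q j x :=
    fun j => (hP.polyq j).continuous.sub (hQ j).continuous
  have cPq : ∀ j, Continuous fun x => Pq j x - q j x :=
    fun j => (hP.polyq j).continuous.sub (hq j).continuous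
  have hne : ∀ i ≠ a, volNorm (fun x => dlam i fun j => Pq j x - q j x) ≤ B * (H + s * G + N) := by
    intro i hi
    set b : (Fin (m + 1) → ℝ) → ℝ := fun x => dlam i fun j => q j x - Q j x with hb
    have cb : Continuous b := continuous_dlam_field i cqQ
    have he : ∀ x, (dlam i fun j => Pq j x - q j x) = (dlam i fun j => Pq j x - Q j x) - b x :=
      fun x => by
        simp only [hb]
        rw [← map_sub]; congr 1; ext j; simp
    have hNb : volNorm b ≤ H := (l2_dlam_le cqQ i).trans
      (Finset.sum_le_sum fun j _ => volNorm_le_h1 _)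
    have hFb : l2 (faceMeasure i) b ≤ (m + 1) * H := by
      rw [hH, Finset.mul_sum]
      exact (l2_dlam_le cqQ i).trans (Finset.sum_le_sum fun j _ =>
        l2_faceMeasure_le ((hq j).sub (hQ j).contDiff) i)
    obtain ⟨a₁, a₂, ha₁, ha₂, ha₂p, ha, ha₁b⟩ := exists_perp_split
      (polyLT_linear (dlam i) fun j => (hP.polyq j).sub (hQ j)) cb
      (by simpa only [← he] using perp_dlam_field hP.volq cPq i)
    have ca₁ := ha₁.continuous
    have ca₂ := ha₂.continuous
    have he' : ∀ x, (dlam i fun j => Pq j x - q j x) = a₂ x - (b x - a₁ x) := fun x => by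
      rw [he, ha]; ring
    have cba : Continuous fun x => b x - a₁ x := cb.sub ca₁
    have cPuu : Continuous fun x => Pu x - u x := cPu.sub cu
    have hF₁ : l2 (faceMeasure i) a₁ ≤ C₂ * H :=
      (h₂ i a₁ (ha₁.mono k.le_succ)).trans (mul_le_mul_of_nonneg_left (ha₁b.trans hNb) hC₂)
    have hFba := l2_sub_le (μ := faceMeasure i) cb ca₁
    have hu' := (h₀ t q Pq u Pu P p ht hq hu hP hPP hp i).2
    have htu : t i * l2 (faceMeasure i) (fun x => Pu x - u x) ≤ C₀ * (s * G + N) := by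
      have e1 := mul_le_mul_of_nonneg_left hu' (ht i).le
      have e2 : t i * (C₀ * (G + N / t i)) = C₀ * (t i * G + N) := by
        field_simp [(ht i).ne']
      refine e1.trans (e2.le.trans (mul_le_mul_of_nonneg_left ?_ hC₀))
      linarith [mul_le_mul_of_nonneg_right (hs i hi) hG0]
    have hF₂ : l2 (faceMeasure i) a₂ ≤ (m + 1 + C₂ + C₀) * (H + s * G + N) := by
      refine le_trans (l2_le_of_integral_sq_le (c := l2 (faceMeasure i) (fun x => b x - a₁ x) +
        t i * l2 (faceMeasure i) fun x => Pu x - u x) ?_ ?_) ?_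
      · have e1 := hP.face i a₂ ha₂
        have e2 := integral_mul_le (μ := faceMeasure i) cba ca₂
        have e3 := mul_le_mul_of_nonneg_left (integral_mul_le (μ := faceMeasure i) cPuu ca₂)
          (ht i).le
        have e4 : ∫ x, (-dlam i (fun j => Pq j x - q j x) + t i * (Pu x - u x)) * a₂ x
            ∂faceMeasure i = (∫ x, (b x - a₁ x) * a₂ x ∂faceMeasure i) +
              t i * (∫ x, (Pu x - u x) * a₂ x ∂faceMeasure i) -
              ∫ x, a₂ x ^ 2 ∂faceMeasure i := by
          rw [← integral_const_mul, ← integral_add, ← integral_sub]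
          · congr 1; ext x; rw [he']; ring
          all_goals exact integrable_faceMeasure i (by fun_prop)
        rw [add_mul]
        linarith
      · exact add_nonneg l2_nonneg (mul_nonneg (ht i).le l2_nonneg)
      · have e1 : 0 ≤ (m + 1 + C₂) * (s * G + N) := by positivity
        have e2 : 0 ≤ C₀ * H := by positivity
        linarith
    have hNa₂ := (h₁ i a₂ ha₂ ha₂p).trans (mul_le_mul_of_nonneg_left hF₂ hC₁)
    have e1 := l2_sub_le (μ := volume.restrict (simplex (m + 1))) ca₂ cba
    have e2 := l2_sub_le (μ := volume.restrict (simplex (m + 1))) cb ca₁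
    simp only [he', volNorm] at *
    rw [hB]
    linarith
  have hall : ∀ i, volNorm (fun x => dlam i fun j => Pq j x - q j x) ≤
      (m + 1) * B * (H + s * G + N) := by
    intro i
    have hR : 0 ≤ B * (H + s * G + N) := by positivity
    by_cases hi : i = a
    · subst hi
      have e : ∀ x, (dlam i fun j => Pq j x - q j x) =
          -∑ l ∈ Finset.univ.erase i, dlam l fun j => Pq j x - q j x := fun x => by
        have := sum_dlam fun j => Pq j x - q j x
        rw [← Finset.add_sum_erase _ _ (Finset.mem_univ i)] at this
        linarith
      simp only [e, volNorm, l2_neg]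
      refine (l2_sum_le _ fun l => continuous_dlam_field l cPq).trans ?_
      refine (Finset.sum_le_sum fun l hl => hne l (Finset.ne_of_mem_erase hl)).trans ?_
      rw [Finset.sum_const, Finset.card_erase_of_mem (Finset.mem_univ i), Finset.card_univ,
        Fintype.card_fin, nsmul_eq_mul, mul_assoc]
      push_cast [Nat.add_sub_cancel]
      exact le_of_eq (by norm_num)
    · refine (hne i hi).trans ?_
      rw [mul_assoc]
      exact le_mul_of_one_le_left hR (by simp)
  intro j
  simpa only [dlam_succ] using hall j.succ

/-- The reference projection is unique. -/
theorem RefProj.unique {m k : ℕ} {t : Fin (m + 2) → ℝ} {q Pq Pq' : Fin (m + 1) →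
    (Fin (m + 1) → ℝ) → ℝ} {u Pu Pu' : (Fin (m + 1) → ℝ) → ℝ} (ht : ∀ i, 0 < t i)
    (hq : ∀ j, Continuous (q j)) (hu : Continuous u) (h : RefProj k t q u Pq Pu)
    (h' : RefProj k t q u Pq' Pu') : (∀ j, Pq j = Pq' j) ∧ Pu = Pu' := by
  have hs := h.sub h' hq hu
  have hz : ∀ v : (Fin (m + 1) → ℝ) → ℝ, PolyLT (k + 1) v → volNorm v ≤ 0 → v = 0 :=
    fun v hv h0 => volume_definite (continuous_const (y := (1 : ℝ))) (fun _ _ => zero_le_one)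
      (fun _ _ => one_ne_zero) hv (by
        have := l2_sq (μ := volume.restrict (simplex (m + 1))) (f := v)
        rw [show l2 _ v = 0 from le_antisymm h0 l2_nonneg] at this
        simpa [sq] using this.symm)
  have hpd : ∀ (j : Fin (m + 1)) x, pd j (fun _ => (0 : ℝ)) x = 0 := fun j x => by
    simp [pd]
  have hpd' : ∀ j : Fin (m + 1), pd j (fun _ => (0 : ℝ)) = fun _ => 0 := fun j => funext (hpd j)
  have hc0 : ContDiff ℝ 1 fun _ : Fin (m + 1) → ℝ => (0 : ℝ) := contDiff_const
  obtain ⟨C, hC, hCu⟩ := exists_refProj_scalar_le m k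
  obtain ⟨C', hC', hCq⟩ := exists_refProj_field_le m k
  obtain ⟨a, ha⟩ := Finite.exists_max t
  have eu := (hCu t _ _ _ _ (fun _ => 0) (fun _ => 0) ht (fun _ => hc0) hc0 hs (.zero _)
    (.zero _) 0).1
  have eq := hCq t _ _ (fun _ _ => 0) _ _ (fun _ => 0) (fun _ => 0) ht (fun _ => hc0) hc0 hs
    (fun _ => .zero _) (.zero _) (.zero _) a (t a) fun i _ => ha i
  simp only [hpd, hpd', Finset.sum_const_zero, sub_zero, h1, volNorm, l2_zero, zero_div, add_zero,
    mul_zero] at eu eq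
  exact ⟨fun j => funext fun x => sub_eq_zero.1 (congrFun (hz _ (hs.polyq j) (eq j)) x),
    funext fun x => sub_eq_zero.1 (congrFun (hz _ hs.polyu eu) x)⟩

end FieldEstimate

/-- The `L²` norm of the `n`-th derivative on the reference simplex. -/
abbrev semiNorm (n : ℕ) (v : (Fin d → ℝ) → ℝ) : ℝ := volNorm fun x => ‖iteratedFDeriv ℝ n v x‖

theorem contDiff_pd {n : ℕ} {v : (Fin d → ℝ) → ℝ} (hv : ContDiff ℝ (n + 1) v) (j : Fin d) :
    ContDiff ℝ n (pd j v) :=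
  (hv.fderiv_right le_rfl).clm_apply contDiff_const

theorem exists_h1_sub_le_of_le (m k : ℕ) : ∃ C, 0 ≤ C ∧ ∀ n ≤ k, ∀ v : (Fin (m + 1) → ℝ) → ℝ,
    ContDiff ℝ (n + 1) v →
      ∃ P, PolyLT (n + 1) P ∧ h1 (fun x => v x - P x) ≤ C * semiNorm (n + 1) v := by
  choose C hC h using exists_h1_sub_le m
  refine ⟨∑ n ∈ Finset.range (k + 1), C n, Finset.sum_nonneg fun n _ => hC n, fun n hn v hv => ?_⟩
  obtain ⟨P, hP, hPv⟩ := h n v hv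
  exact ⟨P, hP, hPv.trans (mul_le_mul_of_nonneg_right (Finset.single_le_sum (fun n _ => hC n)
    (Finset.mem_range_succ_iff.2 hn)) l2_nonneg)⟩

/-- The error estimates on the reference simplex. -/
theorem exists_refProj_estimates (m k : ℕ) : ∃ C, 0 ≤ C ∧ ∀ (t : Fin (m + 2) → ℝ)
    (q Pq : Fin (m + 1) → (Fin (m + 1) → ℝ) → ℝ) (u Pu : (Fin (m + 1) → ℝ) → ℝ),
    (∀ i, 0 < t i) → (∀ j, ContDiff ℝ (k + 1) (q j)) → ContDiff ℝ (k + 1) u →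
    RefProj k t q u Pq Pu → ∀ lu lq : ℕ, lu ≤ k → lq ≤ k →
    (∀ j, volNorm (fun x => Pu x - u x) ≤
      C * (semiNorm (lu + 1) u + semiNorm lq (fun x => ∑ j, pd j (q j) x) / t j)) ∧
    ∀ (a : Fin (m + 2)) (s : ℝ), (∀ i ≠ a, t i ≤ s) → ∀ j,
      volNorm (fun x => Pq j x - q j x) ≤ C * ((∑ j, semiNorm (lq + 1) (q j)) +
        s * semiNorm (lu + 1) u + semiNorm lq fun x => ∑ j, pd j (q j) x) := by
  obtain ⟨C₁, hC₁, h₁⟩ := exists_refProj_scalar_le m k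
  obtain ⟨C₂, hC₂, h₂⟩ := exists_refProj_field_le m k
  obtain ⟨C₃, hC₃, h₃⟩ := exists_h1_sub_le_of_le m k
  set D : ℝ := C₃ + 2 ^ (m + 1) with hD
  have hD3 : C₃ ≤ D := le_add_of_nonneg_right (by positivity)
  have hD2 : 2 ^ (m + 1) ≤ D := le_add_of_nonneg_left hC₃
  have hD0 : 0 ≤ D := hC₃.trans hD3
  refine ⟨(C₁ + C₂) * D, by positivity, fun t q Pq u Pu ht hq hu hP lu lq hlu hlq => ?_⟩
  have one_le : (1 : WithTop ℕ∞) ≤ k + 1 := le_add_self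
  have hq1 : ∀ j, ContDiff ℝ 1 (q j) := fun j => (hq j).of_le one_le
  have hu1 : ContDiff ℝ 1 u := hu.of_le one_le
  have mono : ∀ {n : ℕ}, n ≤ k → ((n + 1 : ℕ) : WithTop ℕ∞) ≤ k + 1 := fun h => by
    exact_mod_cast Nat.succ_le_succ h
  obtain ⟨P, hPP, hPu⟩ := h₃ lu hlu u (hu.of_le (by exact_mod_cast mono hlu))
  choose Q hQ hQq using fun j => h₃ lq hlq (q j) ((hq j).of_le (by exact_mod_cast mono hlq))
  have hdiv : ContDiff ℝ lq fun x => ∑ j, pd j (q j) x :=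
    (ContDiff.sum fun j _ => contDiff_pd (hq j) j).of_le (by exact_mod_cast hlq)
  obtain ⟨p, hp, hpq⟩ := exists_polyLT_volNorm_sub_le lq hdiv
  have hu2 : h1 (fun x => u x - P x) ≤ D * semiNorm (lu + 1) u :=
    hPu.trans (mul_le_mul_of_nonneg_right hD3 l2_nonneg)
  have hq2 : ∑ j, h1 (fun x => q j x - Q j x) ≤ D * ∑ j, semiNorm (lq + 1) (q j) := by
    rw [Finset.mul_sum]
    exact Finset.sum_le_sum fun j _ => (hQq j).trans (mul_le_mul_of_nonneg_right hD3 l2_nonneg)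
  have hp2 : volNorm (fun x => (∑ j, pd j (q j) x) - p x) ≤
      D * semiNorm lq fun x => ∑ j, pd j (q j) x :=
    hpq.trans (mul_le_mul_of_nonneg_right hD2 l2_nonneg)
  refine ⟨fun j => ?_, fun a s hs j => ?_⟩
  · refine (h₁ t q Pq u Pu P p ht hq1 hu1 hP (hPP.mono (by omega)) (hp.mono hlq) j).1.trans ?_
    have e : D * semiNorm (lu + 1) u + D * semiNorm lq (fun x => ∑ j, pd j (q j) x) / t j =
      D * (semiNorm (lu + 1) u + semiNorm lq (fun x => ∑ j, pd j (q j) x) / t j) := by ring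
    have h0 : 0 ≤ semiNorm (lu + 1) u + semiNorm lq (fun x => ∑ j, pd j (q j) x) / t j :=
      add_nonneg l2_nonneg (div_nonneg l2_nonneg (ht j).le)
    rw [mul_assoc, ← e]
    refine mul_le_mul (by linarith) (add_le_add hu2 (div_le_div_of_nonneg_right hp2 (ht j).le))
      (add_nonneg (h1_nonneg _) (div_nonneg l2_nonneg (ht j).le)) (by positivity)
  · have hs0 : 0 ≤ s := by
      obtain ⟨i, hi⟩ := exists_ne a
      exact (ht i).le.trans (hs i hi)
    refine (h₂ t q Pq Q u Pu P p ht hq1 hu1 hP (fun j => (hQ j).mono (by omega))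
      (hPP.mono (by omega)) (hp.mono hlq) a s hs j).trans ?_
    have e : (D * ∑ j, semiNorm (lq + 1) (q j)) + s * (D * semiNorm (lu + 1) u) +
        D * semiNorm lq (fun x => ∑ j, pd j (q j) x) = D * ((∑ j, semiNorm (lq + 1) (q j)) +
        s * semiNorm (lu + 1) u + semiNorm lq fun x => ∑ j, pd j (q j) x) := by ring
    rw [mul_assoc, ← e]
    refine mul_le_mul (by linarith) (add_le_add (add_le_add hq2
      (mul_le_mul_of_nonneg_left hu2 hs0)) hp2) ?_ (by positivity)
    exact add_nonneg (add_nonneg (Finset.sum_nonneg fun _ _ => h1_nonneg _)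
      (mul_nonneg hs0 (h1_nonneg _))) l2_nonneg

section Chart

variable {vv : Fin (d + 1) → EuclideanSpace ℝ (Fin d)} {B : (Fin d → ℝ) ≃L[ℝ] EuclideanSpace ℝ (Fin d)}

theorem exists_chart (h : AffineIndependent ℝ vv) :
    ∃ B : (Fin d → ℝ) ≃L[ℝ] EuclideanSpace ℝ (Fin d), ∀ ξ, B ξ = ∑ l, dlam l ξ • vv l := by
  rw [affineIndependent_iff_linearIndependent_vsub ℝ vv 0] at h
  have h' : LinearIndependent ℝ fun j : Fin d => vv j.succ - vv 0 :=
    h.comp (fun j : Fin d => ⟨j.succ, Fin.succ_ne_zero j⟩) fun i j hij => by simpa using hij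
  have hinj : Function.Injective (Fintype.linearCombination ℝ fun j : Fin d => vv j.succ - vv 0) :=
    h'.fintypeLinearCombination_injective
  let e := LinearEquiv.ofInjectiveOfFinrankEq _ hinj (by simp)
  refine ⟨e.toContinuousLinearEquiv, fun ξ => ?_⟩
  have : e.toContinuousLinearEquiv ξ =
    Fintype.linearCombination ℝ (fun j : Fin d => vv j.succ - vv 0) ξ := rfl
  rw [this, Fintype.linearCombination_apply, Fin.sum_univ_succ]
  simp only [dlam_zero, dlam_succ, smul_sub, Finset.sum_sub_distrib, neg_smul, Finset.sum_smul]
  abel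

theorem lam_eq (l : Fin (d + 1)) (x : Fin d → ℝ) :
    lam l x = (if l = 0 then 1 else 0) + dlam l x := by
  cases l using Fin.cases with
  | zero => simp [sub_eq_add_neg]
  | succ j => simp [Fin.succ_ne_zero]

theorem chart_eq (hB : ∀ ξ, B ξ = ∑ l, dlam l ξ • vv l) (x : Fin d → ℝ) :
    vv 0 + B x = ∑ l, lam l x • vv l := by
  simp [hB, lam_eq, add_smul, Finset.sum_add_distrib]

theorem chart_vtx (hB : ∀ ξ, B ξ = ∑ l, dlam l ξ • vv l) (i : Fin (d + 1)) :
    vv 0 + B (vtx i) = vv i := by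
  simp [chart_eq hB, lam_vtx]

theorem chart_image (hB : ∀ ξ, B ξ = ∑ l, dlam l ξ • vv l) (s : Set (Fin (d + 1))) :
    (fun x => vv 0 + B x) '' {x ∈ simplex d | ∀ i ∉ s, lam i x = 0} = convexHull ℝ (vv '' s) := by
  classical
  apply Subset.antisymm
  · rintro _ ⟨x, ⟨hx, hxs⟩, rfl⟩
    have hz : ∀ l ∈ Finset.univ, lam l x ≠ 0 → l ∈ s := fun l _ hl => by
      by_contra hls
      exact hl (hxs l hls)
    simp only [chart_eq hB]
    rw [← Finset.sum_filter_of_ne (p := (· ∈ s)) fun l hl h0 => hz l hl fun h => h0 (by simp [h])]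
    refine (convex_convexHull ℝ _).sum_mem (fun l _ => hx l) ?_ fun l hl =>
      subset_convexHull ℝ _ (mem_image_of_mem _ (Finset.mem_filter.1 hl).2)
    rw [Finset.sum_filter_of_ne hz, sum_lam]
  · refine convexHull_min ?_ ?_
    · rintro _ ⟨i, hi, rfl⟩
      refine ⟨vtx i, ⟨vtx_mem_simplex i, fun l hl => ?_⟩, chart_vtx hB i⟩
      rw [lam_vtx, if_neg]
      rintro rfl
      exact hl hi
    · have hc : Convex ℝ {x ∈ simplex d | ∀ i ∉ s, lam i x = 0} := by
        rintro x ⟨hx, hxs⟩ y ⟨hy, hys⟩ a b ha hb hab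
        refine ⟨convex_simplex hx hy ha hb hab, fun i hi => ?_⟩
        have h1 := hxs i hi
        have h2 := hys i hi
        simp only [lam_eq, map_add, map_smul, smul_eq_mul] at *
        linear_combination a * h1 + b * h2 + (-if i = 0 then (1 : ℝ) else 0) * hab
      have := (hc.linear_image B.toLinearEquiv.toLinearMap).translate (vv 0)
      rwa [image_image] at this

theorem chart_image_simplex (hB : ∀ ξ, B ξ = ∑ l, dlam l ξ • vv l) :
    (fun x => vv 0 + B x) '' simplex d = convexHull ℝ (range vv) := by
  rw [← image_univ, ← chart_image hB]
  simp

theorem chart_image_face (hB : ∀ ξ, B ξ = ∑ l, dlam l ξ • vv l) (i : Fin (d + 1)) :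
    (fun x => vv 0 + B x) '' face i = convexHull ℝ (vv '' {j | j ≠ i}) := by
  rw [← chart_image hB]
  simp [face]

theorem norm_vertex_sub_le {K : Set (EuclideanSpace ℝ (Fin d))} (hK : K = convexHull ℝ (range vv)) (i j : Fin (d + 1)) :
    ‖vv i - vv j‖ ≤ diam K := by
  have hb : Bornology.IsBounded K := by
    rw [hK, isBounded_convexHull]
    exact (finite_range vv).isBounded
  rw [← dist_eq_norm]
  exact dist_le_diam_of_mem hb (hK ▸ subset_convexHull ℝ _ (mem_range_self i))
    (hK ▸ subset_convexHull ℝ _ (mem_range_self j))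

theorem norm_chart_le (hB : ∀ ξ, B ξ = ∑ l, dlam l ξ • vv l) {K : Set (EuclideanSpace ℝ (Fin d))}
    (hK : K = convexHull ℝ (range vv)) : ‖(B : (Fin d → ℝ) →L[ℝ] EuclideanSpace ℝ (Fin d))‖ ≤ d * diam K := by
  refine ContinuousLinearMap.opNorm_le_bound _ (mul_nonneg d.cast_nonneg diam_nonneg) fun ξ => ?_
  have h : B ξ = ∑ j, ξ j • (vv j.succ - vv 0) := by
    rw [hB, Fin.sum_univ_succ]
    simp only [dlam_zero, dlam_succ, smul_sub, Finset.sum_sub_distrib, neg_smul, Finset.sum_smul]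
    abel
  rw [ContinuousLinearEquiv.coe_coe, h]
  refine (norm_sum_le_of_le _ fun j _ => (norm_smul_le _ _).trans (mul_le_mul (norm_le_pi_norm ξ j)
    (norm_vertex_sub_le hK _ _) (norm_nonneg _) (norm_nonneg _))).trans ?_
  simp only [Finset.sum_const, Finset.card_univ, Fintype.card_fin, nsmul_eq_mul]
  exact le_of_eq (by ring)

theorem abs_dlam_symm_le (hB : ∀ ξ, B ξ = ∑ l, dlam l ξ • vv l) {K : Set (EuclideanSpace ℝ (Fin d))}
    (hK : K = convexHull ℝ (range vv)) {z : EuclideanSpace ℝ (Fin d)} {r : ℝ} (hr : 0 < r) (hz : ball z r ⊆ K)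
    (i : Fin (d + 1)) (y : EuclideanSpace ℝ (Fin d)) : |dlam i (B.symm y)| ≤ ‖y‖ / r := by
  have key : ∀ w : EuclideanSpace ℝ (Fin d), ‖w‖ < r → |dlam i (B.symm w)| ≤ 1 := fun w hw => by
    have h1 : z + w ∈ K := hz (by simpa [mem_ball, dist_eq_norm] using hw)
    have h2 : z ∈ K := hz (mem_ball_self hr)
    rw [hK, ← chart_image_simplex hB] at h1 h2
    obtain ⟨a, ha, hax⟩ := h1
    obtain ⟨b, hb, hbx⟩ := h2
    have e : w = B (a - b) := by
      rw [map_sub]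
      simp only at hax hbx
      have : w = (vv 0 + B a) - (vv 0 + B b) := by rw [hax, hbx]; abel
      rw [this]; abel
    rw [e, B.symm_apply_apply, dlam_sub, abs_le]
    have h3 := ha i
    have h4 := hb i
    have h5 := lam_le_one ha i
    have h6 := lam_le_one hb i
    constructor <;> linarith
  refine le_of_forall_gt_imp_ge_of_dense fun t ht => ?_
  have ht0 : 0 < t := (div_nonneg (norm_nonneg y) hr.le).trans_lt ht
  have h := key (t⁻¹ • y) (by
    rw [norm_smul, Real.norm_of_nonneg (by positivity), inv_mul_lt_iff₀ ht0]
    exact (div_lt_iff₀ hr).1 ht)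
  rwa [map_smul, map_smul, smul_eq_mul, abs_mul, abs_of_pos (by positivity),
    inv_mul_le_iff₀ ht0, mul_one] at h

end Chart

section Normal

variable {m : ℕ} {vv : Fin (m + 2) → EuclideanSpace ℝ (Fin (m + 1))}
  {B : (Fin (m + 1) → ℝ) ≃L[ℝ] EuclideanSpace ℝ (Fin (m + 1))}

theorem exists_normal_eq (hB : ∀ ξ, B ξ = ∑ l, dlam l ξ • vv l)
    {K : Set (EuclideanSpace ℝ (Fin (m + 1)))} (hK : K = convexHull ℝ (range vv))
    {z : EuclideanSpace ℝ (Fin (m + 1))} {r : ℝ} (hr : 0 < r) (hz : ball z r ⊆ K) (i : Fin (m + 2))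
    {ν : EuclideanSpace ℝ (Fin (m + 1))} (hν : ‖ν‖ = 1)
    (hνK : ∀ x ∈ convexHull ℝ (vv '' {j | j ≠ i}), ∀ y ∈ K, ⟪ν, y - x⟫ ≤ 0) :
    ∃ ρ : ℝ, r ≤ ρ ∧ ρ ≤ diam K ∧ ∀ y, ⟪ν, y⟫ = -ρ * dlam i (B.symm y) := by
  obtain ⟨j₀, hj₀⟩ := exists_ne i
  have hF : ∀ j ≠ i, vv j ∈ convexHull ℝ (vv '' {j | j ≠ i}) := fun j hj =>
    subset_convexHull ℝ _ (mem_image_of_mem _ hj)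
  have hV : ∀ j, vv j ∈ K := fun j => hK ▸ subset_convexHull ℝ _ (mem_range_self j)
  set ρ : ℝ := ⟪ν, vv j₀ - vv i⟫ with hρ
  have hρi := hνK _ (hF j₀ hj₀) _ (hV i)
  have hl : ∀ l, ⟪ν, vv l⟫ = ⟪ν, vv j₀⟫ - if l = i then ρ else 0 := fun l => by
    split_ifs with h
    · rw [h, hρ, inner_sub_right]; ring
    · have h1 := hνK _ (hF j₀ hj₀) _ (hV l)
      have h2 := hνK _ (hF l h) _ (hV j₀)
      rw [inner_sub_right] at h1 h2
      linarith
  obtain ⟨β, hβ⟩ : ∃ β : ℝ, ∀ l, ⟪ν, vv l⟫ = β - if l = i then ρ else 0 := ⟨_, hl⟩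
  have hy : ∀ y, ⟪ν, y⟫ = -ρ * dlam i (B.symm y) := fun y => by
    obtain ⟨ξ, rfl⟩ := B.surjective y
    rw [B.symm_apply_apply, hB, inner_sum]
    simp only [inner_smul_right, hβ, mul_sub, Finset.sum_sub_distrib, mul_ite, mul_zero,
      Finset.sum_ite_eq', Finset.mem_univ, if_true]
    rw [← Finset.sum_mul, sum_dlam]
    ring
  have hρ0 : 0 ≤ ρ := by
    rw [hρ, ← neg_sub, inner_neg_right]; linarith
  refine ⟨ρ, ?_, ?_, hy⟩
  · have h1 := hy ν
    rw [real_inner_self_eq_norm_sq, hν] at h1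
    have h2 := abs_dlam_symm_le hB hK hr hz i ν
    rw [hν] at h2
    have h3 := mul_le_mul_of_nonneg_left ((neg_le_abs _).trans h2) hρ0
    rw [mul_one_div] at h3
    have h4 : 1 ≤ ρ / r := by linarith
    rwa [one_le_div hr] at h4
  · refine (real_inner_le_norm _ _).trans ?_
    rw [hν, one_mul]
    exact norm_vertex_sub_le hK _ _

end Normal

section Transfer

/-- The affine parametrisation `x ↦ v₀ + B x` of Euclidean space. -/
def chart (v₀ : EuclideanSpace ℝ (Fin d)) (B : (Fin d → ℝ) ≃L[ℝ] EuclideanSpace ℝ (Fin d)) :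
    (Fin d → ℝ) ≃ₜ EuclideanSpace ℝ (Fin d) := B.toHomeomorph.trans (Homeomorph.addLeft v₀)

variable {v₀ : EuclideanSpace ℝ (Fin d)} {B : (Fin d → ℝ) ≃L[ℝ] EuclideanSpace ℝ (Fin d)}

theorem chart_apply (x : Fin d → ℝ) : chart v₀ B x = v₀ + B x := rfl

theorem chart_symm_apply (y : EuclideanSpace ℝ (Fin d)) :
    (chart v₀ B).symm y = B.symm (-v₀ + y) := rfl

theorem exists_volume_restrict_chart_image (v₀ : EuclideanSpace ℝ (Fin d))
    (B : (Fin d → ℝ) ≃L[ℝ] EuclideanSpace ℝ (Fin d)) : ∃ c : ℝ≥0∞, c ≠ 0 ∧ c ≠ ∞ ∧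
      ∀ s : Set (Fin d → ℝ), (volume : Measure (EuclideanSpace ℝ (Fin d))).restrict
        (chart v₀ B '' s) = c • (volume.restrict s).map (chart v₀ B) := by
  have hB := B.isAddHaarMeasure_map (volume : Measure (Fin d → ℝ))
  obtain ⟨c, hc0, hct, hc⟩ : ∃ c : ℝ≥0∞, c ≠ 0 ∧ c ≠ ∞ ∧
      (volume : Measure (EuclideanSpace ℝ (Fin d))) =
        c • (volume : Measure (Fin d → ℝ)).map B :=
    ⟨_, ENNReal.coe_ne_zero.2 (Measure.addHaarScalarFactor_pos_of_isAddHaarMeasure _ _).ne',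
      ENNReal.coe_ne_top, Measure.isAddLeftInvariant_eq_smul _ _⟩
  refine ⟨c, hc0, hct, fun s => ?_⟩
  have h : (volume : Measure (EuclideanSpace ℝ (Fin d))) =
      c • (volume : Measure (Fin d → ℝ)).map (chart v₀ B) := by
    conv_lhs => rw [← map_add_left_eq_self volume v₀, hc]
    rw [Measure.map_smul, Measure.map_map (measurable_const_add v₀) B.continuous.measurable]
    rfl
  conv_lhs => rw [h]
  rw [Measure.restrict_smul, (chart v₀ B).measurableEmbedding.restrict_map,
    preimage_image_eq _ (chart v₀ B).injective]

theorem exists_hausdorffMeasure_restrict_chart_image {m : ℕ}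
    (v₀ : EuclideanSpace ℝ (Fin (m + 1)))
    (B : (Fin (m + 1) → ℝ) ≃L[ℝ] EuclideanSpace ℝ (Fin (m + 1))) (i : Fin (m + 2)) :
    ∃ c : ℝ≥0∞, c ≠ 0 ∧ c ≠ ∞ ∧
      (μH[((m + 1 : ℕ) : ℝ) - 1] : Measure (EuclideanSpace ℝ (Fin (m + 1)))).restrict
        (chart v₀ B '' face i) = c • (faceMeasure i).map (chart v₀ B) := by
  obtain ⟨b, L, hL, hbL⟩ := exists_faceMap_eq i
  obtain ⟨c, hc0, hct, hc⟩ := exists_hausdorffMeasure_restrict_image_eq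
    (B.toLinearEquiv.toLinearMap ∘ₗ L) (B.injective.comp hL) (v₀ + B b)
  have he : (fun y => v₀ + B b + (B.toLinearEquiv.toLinearMap ∘ₗ L) y) =
      chart v₀ B ∘ faceMap i := by
    ext1 y
    simp [chart_apply, hbL, add_assoc]
  refine ⟨c, hc0, hct, ?_⟩
  rw [← faceMap_image, ← image_comp, ← he, faceMeasure,
    Measure.map_map (chart v₀ B).measurable (continuous_faceMap i).measurable, ← he, ← hc]
  simp

theorem isPolyOnD_chart_image {k : ℕ} {s : Set (Fin d → ℝ)} {f : EuclideanSpace ℝ (Fin d) → ℝ} :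
    IsPolyOnD k (chart v₀ B '' s) f ↔
      ∃ p, PolyLT (k + 1) p ∧ ∀ x ∈ s, f (chart v₀ B x) = p x := by
  constructor
  · rintro ⟨P, hP, hf⟩
    refine ⟨_, (PolyLT.eval_mvPolynomial P hP).comp (φ := fun x i => chart v₀ B x i)
      fun i => ?_, fun x hx => hf _ (mem_image_of_mem _ hx)⟩
    have h : PolyLT 2 fun x : Fin d → ℝ => B x i :=
      polyLT_linear ((EuclideanSpace.proj i).toLinearMap ∘ₗ B.toLinearEquiv.toLinearMap)
        PolyLT.coord
    exact (PolyLT.const 1 (v₀ i)).add h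
  · rintro ⟨p, hp, hf⟩
    have h : PolyLT (k + 1) fun z : Fin d → ℝ => p ((chart v₀ B).symm (WithLp.toLp 2 z)) :=
      hp.comp fun i => by
        have h : PolyLT 2 fun z : Fin d → ℝ => B.symm (WithLp.toLp 2 z) i :=
          polyLT_linear ((LinearMap.proj i) ∘ₗ B.symm.toLinearEquiv.toLinearMap ∘ₗ
            (WithLp.linearEquiv 2 ℝ (Fin d → ℝ)).symm.toLinearMap) PolyLT.coord
        simpa [chart_symm_apply] using (PolyLT.const 1 (-B.symm v₀ i)).add h
    obtain ⟨P, hP, hPe⟩ := h.exists_mvPolynomial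
    refine ⟨P, hP, ?_⟩
    rintro _ ⟨x, hx, rfl⟩
    rw [← hPe, hf x hx]
    exact congrArg p ((chart v₀ B).symm_apply_apply x).symm

theorem isPolyOnD_comp_chart_symm {k : ℕ} {p : (Fin d → ℝ) → ℝ} (hp : PolyLT (k + 1) p)
    (s : Set (Fin d → ℝ)) :
    IsPolyOnD k (chart v₀ B '' s) fun y => p ((chart v₀ B).symm y) :=
  isPolyOnD_chart_image.2 ⟨p, hp, fun x _ => by rw [Homeomorph.symm_apply_apply]⟩

variable {M : Measure (EuclideanSpace ℝ (Fin d))} {N : Measure (Fin d → ℝ)} {c : ℝ≥0∞}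

theorem integral_of_eq_smul_map_chart (hM : M = c • N.map (chart v₀ B))
    (f : EuclideanSpace ℝ (Fin d) → ℝ) :
    ∫ y, f y ∂M = c.toReal * ∫ x, f (chart v₀ B x) ∂N := by
  rw [hM, integral_smul_measure, (chart v₀ B).measurableEmbedding.integral_map, smul_eq_mul]

theorem forall_integral_mul_eq_zero_iff (hM : M = c • N.map (chart v₀ B)) (hc0 : c ≠ 0)
    (hct : c ≠ ∞) {s : Set (Fin d → ℝ)} (hN : ∀ᵐ x ∂N, x ∈ s) {ρ : ℝ} (hρ : ρ ≠ 0)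
    {g : EuclideanSpace ℝ (Fin d) → ℝ} {g' : (Fin d → ℝ) → ℝ}
    (hg : ∀ x ∈ s, g (chart v₀ B x) = ρ * g' x) (k : ℕ) :
    (∀ w, IsPolyOnD k (chart v₀ B '' s) w → ∫ y, g y * w y ∂M = 0) ↔
      ∀ p, PolyLT (k + 1) p → ∫ x, g' x * p x ∂N = 0 := by
  have key : ∀ (w : EuclideanSpace ℝ (Fin d) → ℝ) (p : (Fin d → ℝ) → ℝ),
      (∀ x ∈ s, w (chart v₀ B x) = p x) →
      ∫ y, g y * w y ∂M = c.toReal * (ρ * ∫ x, g' x * p x ∂N) := fun w p hw => by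
    rw [integral_of_eq_smul_map_chart hM, ← integral_const_mul ρ]
    refine congrArg (c.toReal * ·) (integral_congr_ae ?_)
    filter_upwards [hN] with x hx
    rw [hg x hx, hw x hx, mul_assoc]
  have hc : c.toReal ≠ 0 := ENNReal.toReal_ne_zero.2 ⟨hc0, hct⟩
  constructor
  · intro h p hp
    have h1 := h _ (isPolyOnD_comp_chart_symm hp s)
    rw [key _ p fun x _ => by rw [Homeomorph.symm_apply_apply]] at h1
    simpa [hc, hρ] using h1
  · intro h w hw
    obtain ⟨p, hp, hwp⟩ := isPolyOnD_chart_image.1 hw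
    rw [key w p hwp, h p hp, mul_zero, mul_zero]

theorem perp_iff {g : EuclideanSpace ℝ (Fin d) → ℝ} {g' : (Fin d → ℝ) → ℝ}
    (hg : ∀ x ∈ simplex d, g (chart v₀ B x) = g' x) (k : ℕ) :
    (1 ≤ k → ∀ w, IsPolyOnD (k - 1) (chart v₀ B '' simplex d) w →
      ∫ y in chart v₀ B '' simplex d, g y * w y = 0) ↔ Perp k g' := by
  obtain ⟨c, hc0, hct, hc⟩ := exists_volume_restrict_chart_image v₀ B
  rcases k with _ | k
  · exact ⟨fun _ p hp => by simp [hp.eq_zero], fun _ h => absurd h (by simp)⟩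
  · simp only [Nat.le_add_left, true_implies, Nat.add_sub_cancel]
    exact forall_integral_mul_eq_zero_iff (hc _) hc0 hct (ae_restrict_mem measurableSet_simplex)
      one_ne_zero (fun x hx => (hg x hx).trans (one_mul _).symm) k

theorem forall_perp_iff {G : EuclideanSpace ℝ (Fin d) → EuclideanSpace ℝ (Fin d)}
    {G' : Fin d → (Fin d → ℝ) → ℝ} (hG' : ∀ j, Continuous (G' j))
    (hG : ∀ x ∈ simplex d, G (chart v₀ B x) = B fun j => G' j x) (k : ℕ) :
    (1 ≤ k → ∀ v, IsVPolyOnD (k - 1) (chart v₀ B '' simplex d) v →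
      ∫ y in chart v₀ B '' simplex d, ⟪G y, v y⟫ = 0) ↔ ∀ j, Perp k (G' j) := by
  constructor
  · intro h j
    let L : EuclideanSpace ℝ (Fin d) →L[ℝ] ℝ := ContinuousLinearMap.proj j ∘L
      (B.symm : EuclideanSpace ℝ (Fin d) →L[ℝ] Fin d → ℝ)
    obtain ⟨e, he⟩ : ∃ e : EuclideanSpace ℝ (Fin d), ∀ y, ⟪e, y⟫ = L y :=
      ⟨(InnerProductSpace.toDual ℝ (EuclideanSpace ℝ (Fin d))).symm L, fun y => InnerProductSpace.toDual_symm_apply⟩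
    refine (perp_iff (v₀ := v₀) (B := B) (g := fun y => L (G y)) (fun x hx => ?_) k).1
      fun hk w hw => ?_
    · simp [L, hG x hx]
    · have h1 := h hk (fun y => w y • e) fun i => by
        obtain ⟨p, hp, hwp⟩ := isPolyOnD_chart_image.1 hw
        refine isPolyOnD_chart_image.2 ⟨_, hp.const_mul (e i), fun x hx => ?_⟩
        simp [hwp x hx, mul_comm]
      rw [← h1]
      refine integral_congr_ae (Filter.Eventually.of_forall fun y => ?_)
      change L (G y) * w y = ⟪G y, w y • e⟫
      rw [inner_smul_right, ← he, real_inner_comm, mul_comm]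
  · intro h hk v hv
    obtain ⟨c, -, -, hc⟩ := exists_volume_restrict_chart_image v₀ B
    obtain ⟨k, rfl⟩ := Nat.exists_eq_add_of_le' hk
    choose p hp hvp using fun i => isPolyOnD_chart_image.1 (hv i)
    have hP : ∀ j, PolyLT (k + 1) fun x => ∑ i, B (Pi.single j 1) i * p i x := fun j =>
      PolyLT.sum _ fun i _ => (hp i).const_mul _
    rw [integral_of_eq_smul_map_chart (hc _)]
    have e : ∀ x ∈ simplex d, ⟪G (chart v₀ B x), v (chart v₀ B x)⟫ =
        ∑ j, G' j x * ∑ i, B (Pi.single j 1) i * p i x := fun x hx => by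
      have hξ : (fun j => G' j x) = ∑ j, G' j x • Pi.single j (1 : ℝ) := by
        simpa using pi_eq_sum_univ' fun j => G' j x
      rw [hG x hx, hξ, map_sum, sum_inner]
      refine Finset.sum_congr rfl fun j _ => ?_
      rw [map_smul, inner_smul_left, PiLp.inner_apply]
      congr 1
      refine Finset.sum_congr rfl fun i _ => ?_
      rw [← hvp i x hx]
      simp [mul_comm]
    rw [setIntegral_congr_fun measurableSet_simplex e, integral_finsetSum]
    · rw [Finset.sum_eq_zero fun j _ => h j _ (hP j), mul_zero]
    · exact fun j _ => integrableOn_simplex ((hG' j).mul (hP j).continuous)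

end Transfer

section System

variable {m k : ℕ} {v₀ : EuclideanSpace ℝ (Fin (m + 1))}
  {B : (Fin (m + 1) → ℝ) ≃L[ℝ] EuclideanSpace ℝ (Fin (m + 1))}
  {n : Fin (m + 2) → EuclideanSpace ℝ (Fin (m + 1))} {τ ρ : Fin (m + 2) → ℝ}
  {q Pq : EuclideanSpace ℝ (Fin (m + 1)) → EuclideanSpace ℝ (Fin (m + 1))}
  {u Pu : EuclideanSpace ℝ (Fin (m + 1)) → ℝ} {Pq' : Fin (m + 1) → (Fin (m + 1) → ℝ) → ℝ}
  {Pu' : (Fin (m + 1) → ℝ) → ℝ}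

theorem isVPolyOnD_chart_image {s : Set (Fin (m + 1) → ℝ)} :
    IsVPolyOnD k (chart v₀ B '' s) Pq ↔
      ∃ p : Fin (m + 1) → (Fin (m + 1) → ℝ) → ℝ, (∀ j, PolyLT (k + 1) (p j)) ∧
        ∀ x ∈ s, Pq (chart v₀ B x) = B fun j => p j x := by
  constructor
  · intro h
    choose p hp hpe using fun i => isPolyOnD_chart_image.1 (h i)
    refine ⟨fun j x => B.symm (WithLp.toLp 2 fun i => p i x) j, fun j => ?_, fun x hx => ?_⟩
    · exact polyLT_linear ((LinearMap.proj j) ∘ₗ B.symm.toLinearEquiv.toLinearMap ∘ₗ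
        (WithLp.linearEquiv 2 ℝ (Fin (m + 1) → ℝ)).symm.toLinearMap) hp
    · rw [B.apply_symm_apply]
      ext i
      exact hpe i x hx
  · rintro ⟨p, hp, hpe⟩ i
    refine isPolyOnD_chart_image.2 ⟨_, polyLT_linear ((EuclideanSpace.proj i).toLinearMap ∘ₗ
      B.toLinearEquiv.toLinearMap) hp, fun x hx => ?_⟩
    rw [hpe x hx]
    rfl

theorem projSys_iff_refProj (hρ : ∀ i, 0 < ρ i)
    (hn : ∀ i y, ⟪n i, y⟫ = -ρ i * dlam i (B.symm y)) (hq : Continuous q)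
    (hpq : ∀ j, PolyLT (k + 1) (Pq' j)) (hpu : PolyLT (k + 1) Pu')
    (hPq : ∀ x ∈ simplex (m + 1), Pq (chart v₀ B x) = B fun j => Pq' j x)
    (hPu : ∀ x ∈ simplex (m + 1), Pu (chart v₀ B x) = Pu' x) :
    ProjSys (m + 1) k (chart v₀ B '' simplex (m + 1)) (fun i => chart v₀ B '' face i) n τ q u
        Pq Pu ↔
      RefProj k (fun i => τ i / ρ i) (fun j x => B.symm (q (chart v₀ B x)) j)
        (fun x => u (chart v₀ B x)) Pq' Pu' := by
  have hG : ∀ x ∈ simplex (m + 1), Pq (chart v₀ B x) - q (chart v₀ B x) =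
      B fun j => Pq' j x - B.symm (q (chart v₀ B x)) j := fun x hx => by
    have : (fun j => Pq' j x - B.symm (q (chart v₀ B x)) j) =
      (fun j => Pq' j x) - B.symm (q (chart v₀ B x)) := rfl
    rw [this, map_sub, B.apply_symm_apply, hPq x hx]
  have hcont : ∀ j, Continuous fun x => Pq' j x - B.symm (q (chart v₀ B x)) j := fun j =>
    (hpq j).continuous.sub ((continuous_apply j).comp
      (B.symm.continuous.comp (hq.comp (chart v₀ B).continuous)))
  have h1 := forall_perp_iff (v₀ := v₀) (B := B) (G := fun y => Pq y - q y) hcont hG k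
  have h2 := perp_iff (v₀ := v₀) (B := B) (g := fun y => Pu y - u y)
    (g' := fun x => Pu' x - u (chart v₀ B x)) (fun x hx => by rw [hPu x hx]) k
  choose c hc0 hct hc using fun i => exists_hausdorffMeasure_restrict_chart_image v₀ B i
  have h3 := fun i => forall_integral_mul_eq_zero_iff (hc i) (hc0 i) (hct i) (ae_mem_face i)
      (hρ i).ne'
      (g := fun y => ⟪Pq y - q y, n i⟫ + τ i * (Pu y - u y))
      (g' := fun x => -dlam i (fun j => Pq' j x - B.symm (q (chart v₀ B x)) j) +
        τ i / ρ i * (Pu' x - u (chart v₀ B x))) (fun x hx => by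
          rw [hG x hx.1, hPu x hx.1, real_inner_comm, hn, B.symm_apply_apply]
          have := (hρ i).ne'
          field_simp) k
  constructor
  · rintro ⟨-, -, hv, hw, hf⟩
    exact ⟨hpq, hpu, h1.1 hv, h2.1 hw, fun i => (h3 i).1 (hf i)⟩
  · rintro ⟨-, -, hv, hw, hf⟩
    exact ⟨isVPolyOnD_chart_image.2 ⟨_, hpq, hPq⟩, isPolyOnD_chart_image.2 ⟨_, hpu, hPu⟩,
      h1.2 hv, h2.2 hw, fun i => (h3 i).2 (hf i)⟩

theorem exists_refProj_of_projSys (hρ : ∀ i, 0 < ρ i)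
    (hn : ∀ i y, ⟪n i, y⟫ = -ρ i * dlam i (B.symm y)) (hq : Continuous q)
    (h : ProjSys (m + 1) k (chart v₀ B '' simplex (m + 1)) (fun i => chart v₀ B '' face i) n τ q u
        Pq Pu) :
    ∃ Pq' Pu', RefProj k (fun i => τ i / ρ i) (fun j x => B.symm (q (chart v₀ B x)) j)
        (fun x => u (chart v₀ B x)) Pq' Pu' ∧
      (∀ x ∈ simplex (m + 1), Pq (chart v₀ B x) = B fun j => Pq' j x) ∧
      ∀ x ∈ simplex (m + 1), Pu (chart v₀ B x) = Pu' x := by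
  obtain ⟨Pq', hpq, hPq⟩ := isVPolyOnD_chart_image.1 h.1
  obtain ⟨Pu', hpu, hPu⟩ := isPolyOnD_chart_image.1 h.2.1
  exact ⟨Pq', Pu', (projSys_iff_refProj hρ hn hq hpq hpu hPq hPu).1 h, hPq, hPu⟩

end System

section Pullback

variable {v₀ : EuclideanSpace ℝ (Fin d)} {B : (Fin d → ℝ) ≃L[ℝ] EuclideanSpace ℝ (Fin d)}
  {F : Type*} [NormedAddCommGroup F] [NormedSpace ℝ F]

theorem volNorm_le_mul {f g : (Fin d → ℝ) → ℝ} (hf : Continuous f) (hg : Continuous g) {c : ℝ}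
    (hc : 0 ≤ c) (h : ∀ x, |f x| ≤ c * g x) : volNorm f ≤ c * volNorm g := by
  rw [← abs_of_nonneg hc, ← l2_const_mul]
  refine Real.sqrt_le_sqrt (integral_mono (integrableOn_simplex (hf.pow 2))
    (integrableOn_simplex ((continuous_const.mul hg).pow 2)) fun x => ?_)
  exact sq_le_sq' (abs_le.1 (h x)).1 (abs_le.1 (h x)).2

theorem eLpNorm_simplex {f : (Fin d → ℝ) → ℝ} (hf : Continuous f) :
    eLpNorm f 2 (volume.restrict (simplex d)) = ENNReal.ofReal (volNorm f) := by
  have h2 : MemLp f 2 (volume.restrict (simplex d)) :=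
    (memLp_two_iff_integrable_sq hf.aestronglyMeasurable).2 (integrableOn_simplex (hf.pow 2))
  rw [h2.eLpNorm_eq_integral_rpow_norm two_ne_zero ofNat_ne_top, volNorm, l2, Real.sqrt_eq_rpow]
  norm_num

theorem exists_eLpNorm_chart_image (v₀ : EuclideanSpace ℝ (Fin d))
    (B : (Fin d → ℝ) ≃L[ℝ] EuclideanSpace ℝ (Fin d)) : ∃ c : ℝ≥0∞,
      ∀ (f : EuclideanSpace ℝ (Fin d) → ℝ) (g : (Fin d → ℝ) → ℝ), Continuous g →
        (∀ x ∈ simplex d, f (chart v₀ B x) = g x) →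
        eLpNorm f 2 (volume.restrict (chart v₀ B '' simplex d)) =
          c * ENNReal.ofReal (volNorm g) := by
  obtain ⟨c, -, -, hc⟩ := exists_volume_restrict_chart_image v₀ B
  refine ⟨c ^ (1 / (2 : ℝ≥0∞)).toReal, fun f g hg hfg => ?_⟩
  rw [hc, eLpNorm_smul_measure_of_ne_top ofNat_ne_top,
    (chart v₀ B).measurableEmbedding.eLpNorm_map_measure, smul_eq_mul, ← eLpNorm_simplex hg]
  refine congrArg _ (eLpNorm_congr_ae ?_)
  filter_upwards [ae_restrict_mem measurableSet_simplex] with x hx using hfg x hx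

theorem contDiff_comp_chart {n : WithTop ℕ∞} {v : EuclideanSpace ℝ (Fin d) → F}
    (hv : ContDiff ℝ n v) : ContDiff ℝ n fun x => v (chart v₀ B x) :=
  hv.comp (contDiff_const.add B.contDiff)

theorem norm_iteratedFDeriv_comp_chart_le {n : ℕ} {v : EuclideanSpace ℝ (Fin d) → F}
    (hv : ContDiff ℝ n v) (x : Fin d → ℝ) :
    ‖iteratedFDeriv ℝ n (fun x => v (chart v₀ B x)) x‖ ≤
      ‖(B : (Fin d → ℝ) →L[ℝ] EuclideanSpace ℝ (Fin d))‖ ^ n *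
        ‖iteratedFDeriv ℝ n v (chart v₀ B x)‖ := by
  have h1 : ContDiff ℝ n fun z => v (v₀ + z) := hv.comp (contDiff_const.add contDiff_id)
  have h2 := (B : (Fin d → ℝ) →L[ℝ] EuclideanSpace ℝ (Fin d)).iteratedFDeriv_comp_right h1 x le_rfl
  have h3 : (fun x => v (chart v₀ B x)) =
      (fun z => v (v₀ + z)) ∘ (B : (Fin d → ℝ) →L[ℝ] EuclideanSpace ℝ (Fin d)) := rfl
  rw [h3, h2]
  refine (ContinuousMultilinearMap.norm_compContinuousLinearMap_le _ _).trans (le_of_eq ?_)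
  rw [iteratedFDeriv_comp_add_left, Finset.prod_const, Finset.card_univ, Fintype.card_fin,
    mul_comm]
  rfl

/-- The Sobolev seminorm of order `n` of `v` on the physical element, pulled back to the
reference simplex. -/
abbrev pullNorm (v₀ : EuclideanSpace ℝ (Fin d)) (B : (Fin d → ℝ) ≃L[ℝ] EuclideanSpace ℝ (Fin d))
    (n : ℕ) (v : EuclideanSpace ℝ (Fin d) → F) : ℝ :=
  volNorm fun x => ‖iteratedFDeriv ℝ n v (chart v₀ B x)‖

theorem continuous_norm_iteratedFDeriv_chart {n : ℕ} {v : EuclideanSpace ℝ (Fin d) → F}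
    (hv : ContDiff ℝ n v) : Continuous fun x => ‖iteratedFDeriv ℝ n v (chart v₀ B x)‖ :=
  ((hv.continuous_iteratedFDeriv le_rfl).comp (chart v₀ B).continuous).norm

theorem semiNorm_clm_comp_chart_le {n : ℕ} {v : EuclideanSpace ℝ (Fin d) → F}
    (hv : ContDiff ℝ n v) (L : F →L[ℝ] ℝ) {a b : ℝ} (hL : ‖L‖ ≤ a)
    (hb : ‖(B : (Fin d → ℝ) →L[ℝ] EuclideanSpace ℝ (Fin d))‖ ≤ b) :
    semiNorm n (fun x => L (v (chart v₀ B x))) ≤ a * b ^ n * pullNorm v₀ B n v := by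
  have ha0 := (norm_nonneg _).trans hL
  have hb0 := (norm_nonneg _).trans hb
  have hvc : ContDiff ℝ n fun x => v (chart v₀ B x) := contDiff_comp_chart hv
  refine volNorm_le_mul (((L.contDiff.comp hvc).continuous_iteratedFDeriv le_rfl).norm)
    (continuous_norm_iteratedFDeriv_chart hv) (by positivity) fun x => ?_
  rw [abs_of_nonneg (norm_nonneg _), mul_assoc]
  refine (L.norm_iteratedFDeriv_comp_left hvc.contDiffAt le_rfl).trans ?_
  refine mul_le_mul hL ?_ (norm_nonneg _) ha0
  exact (norm_iteratedFDeriv_comp_chart_le hv x).trans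
    (mul_le_mul_of_nonneg_right (pow_le_pow_left₀ (norm_nonneg _) hb n) (norm_nonneg _))

theorem semiNorm_comp_chart_le {n : ℕ} {v : EuclideanSpace ℝ (Fin d) → ℝ} (hv : ContDiff ℝ n v)
    {b : ℝ} (hb : ‖(B : (Fin d → ℝ) →L[ℝ] EuclideanSpace ℝ (Fin d))‖ ≤ b) :
    semiNorm n (fun x => v (chart v₀ B x)) ≤ b ^ n * pullNorm v₀ B n v := by
  simpa using semiNorm_clm_comp_chart_le hv (ContinuousLinearMap.id ℝ ℝ)
    ContinuousLinearMap.norm_id_le hb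

/-- The trace as a continuous linear functional. -/
def traceCLM (d : ℕ) : (EuclideanSpace ℝ (Fin d) →L[ℝ] EuclideanSpace ℝ (Fin d)) →L[ℝ] ℝ :=
  ∑ i, (EuclideanSpace.proj i : EuclideanSpace ℝ (Fin d) →L[ℝ] ℝ) ∘L
    ContinuousLinearMap.apply ℝ _ (EuclideanSpace.single i (1 : ℝ))

theorem traceCLM_apply (T : EuclideanSpace ℝ (Fin d) →L[ℝ] EuclideanSpace ℝ (Fin d)) :
    traceCLM d T = ∑ i, T (EuclideanSpace.single i 1) i := by
  simp [traceCLM]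

theorem norm_traceCLM_le : ‖traceCLM d‖ ≤ d := by
  refine ContinuousLinearMap.opNorm_le_bound _ d.cast_nonneg fun T => ?_
  rw [traceCLM_apply]
  refine (norm_sum_le_of_le (n := fun _ => ‖T‖) _ fun i _ => ?_).trans (by simp)
  refine (PiLp.norm_apply_le _ i).trans ((T.le_opNorm _).trans ?_)
  simp

theorem traceCLM_eq_sum (B : (Fin d → ℝ) ≃L[ℝ] EuclideanSpace ℝ (Fin d))
    (T : EuclideanSpace ℝ (Fin d) →L[ℝ] EuclideanSpace ℝ (Fin d)) :
    ∑ j, B.symm (T (B (Pi.single j 1))) j = traceCLM d T := by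
  have h1 := LinearMap.trace_conj' (T : EuclideanSpace ℝ (Fin d) →ₗ[ℝ] EuclideanSpace ℝ (Fin d))
    B.symm.toLinearEquiv
  rw [LinearMap.trace_eq_matrix_trace ℝ (Pi.basisFun ℝ (Fin d)),
    LinearMap.trace_eq_sum_inner _ (EuclideanSpace.basisFun (Fin d) ℝ)] at h1
  rw [traceCLM_apply]
  refine Eq.trans ?_ (h1.trans ?_)
  · simp [Matrix.trace, LinearEquiv.conj_apply]
  · refine Finset.sum_congr rfl fun i _ => ?_
    rw [EuclideanSpace.basisFun_apply, EuclideanSpace.inner_single_left]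
    simp

theorem pdivD_eq (q : EuclideanSpace ℝ (Fin d) → EuclideanSpace ℝ (Fin d)) :
    pdivD q = traceCLM d ∘ fderiv ℝ q := by
  ext x
  simp [pdivD, traceCLM_apply]

theorem contDiff_pdivD {n : ℕ} {q : EuclideanSpace ℝ (Fin d) → EuclideanSpace ℝ (Fin d)}
    (hq : ContDiff ℝ (n + 1) q) : ContDiff ℝ n (pdivD q) := by
  rw [pdivD_eq]
  exact (traceCLM d).contDiff.comp (hq.fderiv_right le_rfl)

theorem pullNorm_pdivD_le {n : ℕ} {q : EuclideanSpace ℝ (Fin d) → EuclideanSpace ℝ (Fin d)}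
    (hq : ContDiff ℝ (n + 1) q) : pullNorm v₀ B n (pdivD q) ≤ d * pullNorm v₀ B (n + 1) q := by
  refine volNorm_le_mul (continuous_norm_iteratedFDeriv_chart (contDiff_pdivD hq))
    (continuous_norm_iteratedFDeriv_chart (by exact_mod_cast hq)) d.cast_nonneg fun x => ?_
  rw [abs_of_nonneg (norm_nonneg _), pdivD_eq, ← norm_iteratedFDeriv_fderiv]
  exact ((traceCLM d).norm_iteratedFDeriv_comp_left
    (hq.fderiv_right (m := n) le_rfl).contDiffAt le_rfl).trans
      (mul_le_mul_of_nonneg_right norm_traceCLM_le (norm_nonneg _))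

theorem sum_pd_eq_pdivD {q : EuclideanSpace ℝ (Fin d) → EuclideanSpace ℝ (Fin d)}
    (hq : ContDiff ℝ 1 q) (x : Fin d → ℝ) :
    ∑ j, pd j (fun x => B.symm (q (chart v₀ B x)) j) x = pdivD q (chart v₀ B x) := by
  rw [pdivD_eq, Function.comp_apply, ← traceCLM_eq_sum B]
  refine Finset.sum_congr rfl fun j _ => ?_
  have h1 : HasFDerivAt (chart v₀ B) (B : (Fin d → ℝ) →L[ℝ] EuclideanSpace ℝ (Fin d)) x :=
    B.hasFDerivAt.const_add v₀
  have h2 := (hq.differentiable one_ne_zero (chart v₀ B x)).hasFDerivAt.comp x h1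
  let L : EuclideanSpace ℝ (Fin d) →L[ℝ] ℝ := ContinuousLinearMap.proj j ∘L
    (B.symm : EuclideanSpace ℝ (Fin d) →L[ℝ] Fin d → ℝ)
  have h3 := L.hasFDerivAt.comp x h2
  rw [pd]
  exact congrArg (· (Pi.single j 1)) h3.fderiv

end Pullback

theorem exists_pullback_estimates (m k : ℕ) {η : ℝ} (hη : 0 < η) : ∃ C : ℝ, 0 < C ∧
    ∀ (v₀ : EuclideanSpace ℝ (Fin (m + 1)))
      (B : (Fin (m + 1) → ℝ) ≃L[ℝ] EuclideanSpace ℝ (Fin (m + 1))) (h r : ℝ), 0 < r → 0 < h →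
      h ≤ η * r →
      ‖(B : (Fin (m + 1) → ℝ) →L[ℝ] EuclideanSpace ℝ (Fin (m + 1)))‖ ≤ (m + 1 : ℕ) * h →
      (∀ j y, |B.symm y j| ≤ ‖y‖ / r) →
    ∀ ρ τ : Fin (m + 2) → ℝ, (∀ i, r ≤ ρ i) → (∀ i, ρ i ≤ h) → (∀ i, 0 < τ i) →
    ∀ (q : EuclideanSpace ℝ (Fin (m + 1)) → EuclideanSpace ℝ (Fin (m + 1)))
      (u : EuclideanSpace ℝ (Fin (m + 1)) → ℝ), ContDiff ℝ (k + 1) q → ContDiff ℝ (k + 1) u →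
    ∀ (Pq : Fin (m + 1) → (Fin (m + 1) → ℝ) → ℝ) (Pu : (Fin (m + 1) → ℝ) → ℝ),
      RefProj k (fun i => τ i / ρ i) (fun j x => B.symm (q (chart v₀ B x)) j)
        (fun x => u (chart v₀ B x)) Pq Pu →
    ∀ lu lq : ℕ, lu ≤ k → lq ≤ k →
      (∀ j, volNorm (fun x => Pu x - u (chart v₀ B x)) ≤
        C * h ^ (lu + 1) * pullNorm v₀ B (lu + 1) u +
          C * h ^ (lq + 1) / τ j * pullNorm v₀ B lq (pdivD q)) ∧
      ∀ (a : Fin (m + 2)) (s : ℝ), (∀ i ≠ a, τ i ≤ s) →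
        volNorm (fun x => ‖B fun j => Pq j x - B.symm (q (chart v₀ B x)) j‖) ≤
          C * h ^ (lq + 1) * pullNorm v₀ B (lq + 1) q +
            C * h ^ (lu + 1) * s * pullNorm v₀ B (lu + 1) u := by
  obtain ⟨C₀, hC₀, H⟩ := exists_refProj_estimates m k
  set D : ℝ := ((m + 1 : ℕ) : ℝ) with hD
  have hD1 : 1 ≤ D := by rw [hD]; exact_mod_cast Nat.le_add_left 1 m
  have hD0 : 0 < D := zero_lt_one.trans_le hD1
  set M : ℝ := D ^ (k + 1)
  have hM0 : 0 < M := by positivity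
  set C : ℝ := C₀ * M * D ^ 3 * (η + 1) + 1 with hC
  refine ⟨C, by positivity, ?_⟩
  intro v₀ B h r hr hh hhr hB hBs ρ τ hρr hρh hτ q u hq hu Pq Pu hP lu lq hlu hlq
  have hρ0 : ∀ i, 0 < ρ i := fun i => hr.trans_le (hρr i)
  have hq' : ∀ l ≤ k, ContDiff ℝ (l + 1 : ℕ) q := fun l hl =>
    hq.of_le (by exact_mod_cast Nat.succ_le_succ hl)
  have hu' : ContDiff ℝ (lu + 1 : ℕ) u := hu.of_le (by exact_mod_cast Nat.succ_le_succ hlu)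
  have hdiv : ContDiff ℝ lq (pdivD q) := contDiff_pdivD (by exact_mod_cast hq' lq hlq)
  have hpow : ∀ l ≤ k + 1, (D * h) ^ l ≤ M * h ^ l := fun l hl => by
    rw [mul_pow]
    exact mul_le_mul_of_nonneg_right (pow_le_pow_right₀ hD1 hl) (by positivity)
  let L (j : Fin (m + 1)) : EuclideanSpace ℝ (Fin (m + 1)) →L[ℝ] ℝ :=
    ContinuousLinearMap.proj j ∘L
      (B.symm : EuclideanSpace ℝ (Fin (m + 1)) →L[ℝ] Fin (m + 1) → ℝ)
  have hL : ∀ j, ‖L j‖ ≤ 1 / r := fun j =>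
    ContinuousLinearMap.opNorm_le_bound _ (by positivity) fun y =>
      (hBs j y).trans (le_of_eq (by ring))
  have hqc : ∀ j, ContDiff ℝ (k + 1) fun x => B.symm (q (chart v₀ B x)) j := fun j =>
    (L j).contDiff.comp (contDiff_comp_chart hq)
  have huc : ContDiff ℝ (k + 1) fun x => u (chart v₀ B x) := contDiff_comp_chart hu
  obtain ⟨h1, h2⟩ := H _ _ Pq _ Pu (fun i => div_pos (hτ i) (hρ0 i)) hqc huc hP lu lq hlu hlq
  have hdivq : (fun x => ∑ j, pd j (fun x => B.symm (q (chart v₀ B x)) j) x) =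
      fun x => pdivD q (chart v₀ B x) :=
    funext fun x => sum_pd_eq_pdivD (hq.of_le (by simp)) x
  rw [hdivq] at h1 h2
  set Su := pullNorm v₀ B (lu + 1) u with hSu
  set Sd := pullNorm v₀ B lq (pdivD q) with hSd
  set Sq := pullNorm v₀ B (lq + 1) q with hSq
  have hSu0 : 0 ≤ Su := l2_nonneg
  have hSd0 : 0 ≤ Sd := l2_nonneg
  have hSq0 : 0 ≤ Sq := l2_nonneg
  have hu1 : semiNorm (lu + 1) (fun x => u (chart v₀ B x)) ≤ M * h ^ (lu + 1) * Su :=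
    (semiNorm_comp_chart_le hu' hB).trans
      (mul_le_mul_of_nonneg_right (hpow _ (by omega)) hSu0)
  have hd1 : semiNorm lq (fun x => pdivD q (chart v₀ B x)) ≤ M * h ^ lq * Sd :=
    (semiNorm_comp_chart_le hdiv hB).trans
      (mul_le_mul_of_nonneg_right (hpow _ (by omega)) hSd0)
  have hq1 : ∀ j, semiNorm (lq + 1) (fun x => B.symm (q (chart v₀ B x)) j) ≤
      1 / r * (M * h ^ (lq + 1)) * Sq := fun j =>
    (semiNorm_clm_comp_chart_le (hq' lq hlq) (L j) (hL j) hB).trans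
      (mul_le_mul_of_nonneg_right (mul_le_mul_of_nonneg_left (hpow _ (by omega)) (by positivity))
        hSq0)
  have hdq : Sd ≤ D * Sq := pullNorm_pdivD_le (by exact_mod_cast hq' lq hlq)
  have hD3 : 1 ≤ D ^ 3 := one_le_pow₀ hD1
  have hCM : C₀ * M ≤ C := by
    have : C₀ * M * (1 * 1) ≤ C₀ * M * (D ^ 3 * (η + 1)) :=
      mul_le_mul_of_nonneg_left (mul_le_mul hD3 (by linarith) zero_le_one (by positivity))
        (by positivity)
    rw [hC]; linarith
  refine ⟨fun j => (h1 j).trans ?_, fun a s hs => ?_⟩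
  · have e : M * h ^ lq * Sd / (τ j / ρ j) ≤ M * h ^ (lq + 1) / τ j * Sd := by
      have h3 : M * h ^ lq * Sd / (τ j / ρ j) = M * h ^ lq * Sd / τ j * ρ j := by
        have := (hρ0 j).ne'
        have := (hτ j).ne'
        field_simp
      have h4 := hτ j
      rw [h3]
      exact (mul_le_mul_of_nonneg_left (hρh j) (by positivity)).trans (le_of_eq (by ring))
    calc _ ≤ C₀ * (M * h ^ (lu + 1) * Su + M * h ^ (lq + 1) / τ j * Sd) :=
          mul_le_mul_of_nonneg_left (add_le_add hu1 ((div_le_div_of_nonneg_right hd1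
            (div_pos (hτ j) (hρ0 j)).le).trans e)) hC₀
      _ = C₀ * M * (h ^ (lu + 1) * Su + h ^ (lq + 1) / τ j * Sd) := by ring
      _ ≤ C * (h ^ (lu + 1) * Su + h ^ (lq + 1) / τ j * Sd) := by
          have h4 := hτ j
          exact mul_le_mul_of_nonneg_right hCM (by positivity)
      _ = _ := by ring
  · obtain ⟨i₀, hi₀⟩ := exists_ne a
    have hs0 : 0 ≤ s := (hτ i₀).le.trans (hs i₀ hi₀)
    have ht : ∀ i ≠ a, τ i / ρ i ≤ s / r := fun i hi =>
      div_le_div₀ hs0 (hs i hi) hr (hρr i)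
    set R : ℝ := C₀ * (D * (1 / r * (M * h ^ (lq + 1)) * Sq) + s / r * (M * h ^ (lu + 1) * Su) +
      M * h ^ lq * (D * Sq)) with hR
    have hξc : ∀ j, Continuous fun x => |Pq j x - B.symm (q (chart v₀ B x)) j| := fun j =>
      ((hP.polyq j).continuous.sub (hqc j).continuous).abs
    have hξ : ∀ j, volNorm (fun x => |Pq j x - B.symm (q (chart v₀ B x)) j|) ≤ R := fun j => by
      have e : volNorm (fun x => |Pq j x - B.symm (q (chart v₀ B x)) j|) =
          volNorm fun x => Pq j x - B.symm (q (chart v₀ B x)) j := by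
        simp only [l2, sq_abs]
      rw [e]
      refine (h2 a (s / r) ht j).trans (mul_le_mul_of_nonneg_left (add_le_add (add_le_add ?_ ?_)
        (hd1.trans (mul_le_mul_of_nonneg_left hdq (by positivity)))) hC₀)
      · refine (Finset.sum_le_sum fun j _ => hq1 j).trans (le_of_eq ?_)
        rw [Finset.sum_const, Finset.card_univ, Fintype.card_fin, nsmul_eq_mul]
      · exact mul_le_mul_of_nonneg_left hu1 (by positivity)
    have hpt : ∀ x, |‖B fun j => Pq j x - B.symm (q (chart v₀ B x)) j‖| ≤
        D * h * ∑ j, |Pq j x - B.symm (q (chart v₀ B x)) j| := fun x => by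
      rw [abs_of_nonneg (norm_nonneg _)]
      refine ((B : (Fin (m + 1) → ℝ) →L[ℝ] EuclideanSpace ℝ (Fin (m + 1))).le_opNorm _).trans
        (mul_le_mul hB ?_ (norm_nonneg _) (by positivity))
      refine (pi_norm_le_iff_of_nonneg (Finset.sum_nonneg fun j _ => abs_nonneg _)).2 fun j => ?_
      exact Finset.single_le_sum (f := fun j => |Pq j x - B.symm (q (chart v₀ B x)) j|)
        (fun j _ => abs_nonneg _) (Finset.mem_univ j)
    have hvc : Continuous fun x => ‖B fun j => Pq j x - B.symm (q (chart v₀ B x)) j‖ :=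
      (B.continuous.comp (continuous_pi fun j =>
        (hP.polyq j).continuous.sub (hqc j).continuous)).norm
    have hhr' : h / r ≤ η := (div_le_iff₀ hr).2 hhr
    have hC3 : C₀ * M * D ^ 3 * (η + 1) ≤ C := by rw [hC]; linarith
    have hC2 : C₀ * M * D ^ 2 * η ≤ C := by
      refine le_trans ?_ hC3
      have : D ^ 2 ≤ D ^ 3 := pow_le_pow_right₀ hD1 (by norm_num)
      gcongr
      linarith
    calc _ ≤ D * h * volNorm (fun x => ∑ j, |Pq j x - B.symm (q (chart v₀ B x)) j|) :=
          volNorm_le_mul hvc (continuous_finsetSum _ fun j _ => hξc j) (by positivity) hpt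
      _ ≤ D * h * ∑ j : Fin (m + 1), R := mul_le_mul_of_nonneg_left
          ((l2_sum_le _ hξc).trans (Finset.sum_le_sum fun j _ => hξ j)) (by positivity)
      _ = C₀ * M * D ^ 3 * (h / r + 1) * (h ^ (lq + 1) * Sq) +
          C₀ * M * D ^ 2 * (h / r) * (h ^ (lu + 1) * s * Su) := by
          rw [Finset.sum_const, Finset.card_univ, Fintype.card_fin, nsmul_eq_mul, ← hD, hR]
          field_simp
          ring
      _ ≤ C * (h ^ (lq + 1) * Sq) + C * (h ^ (lu + 1) * s * Su) :=
          add_le_add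
            (mul_le_mul_of_nonneg_right (le_trans (mul_le_mul_of_nonneg_left (by linarith)
              (by positivity)) hC3) (by positivity))
            (mul_le_mul_of_nonneg_right (le_trans (mul_le_mul_of_nonneg_left hhr'
              (by positivity)) hC2) (by positivity))
      _ = _ := by ring

theorem mul_ofReal_le_add (c : ℝ≥0∞) {x a b S T : ℝ} (ha : 0 ≤ a) (hb : 0 ≤ b) (hS : 0 ≤ S)
    (hT : 0 ≤ T) (h : x ≤ a * S + b * T) :
    c * ENNReal.ofReal x ≤
      ENNReal.ofReal a * (c * ENNReal.ofReal S) + ENNReal.ofReal b * (c * ENNReal.ofReal T) := by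
  rw [mul_left_comm, mul_left_comm (ENNReal.ofReal b), ← mul_add, ← ENNReal.ofReal_mul ha,
    ← ENNReal.ofReal_mul hb, ← ENNReal.ofReal_add (mul_nonneg ha hS) (mul_nonneg hb hT)]
  exact mul_le_mul_right (ENNReal.ofReal_le_ofReal h) c

end HDG

theorem HDG_projection_wellposed_and_L2_estimates
    (d : ℕ) (hd : d = 2 ∨ d = 3) (k : ℕ) (η : ℝ) (hη : 0 < η) :
    ∃ C : ℝ, 0 < C ∧
      ∀ (vv : Fin (d+1) → EuclideanSpace ℝ (Fin d)), AffineIndependent ℝ vv →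
      ∀ (K : Set (EuclideanSpace ℝ (Fin d))), K = convexHull ℝ (range vv) →
      -- shape regularity
      (∃ (z : EuclideanSpace ℝ (Fin d)) (r : ℝ), 0 < r ∧ ball z r ⊆ K ∧
        Metric.diam K ≤ η * r) →
      ∀ (Fc : Fin (d+1) → Set (EuclideanSpace ℝ (Fin d))),
        (∀ i, Fc i = convexHull ℝ (vv '' {j | j ≠ i})) →
      ∀ (n : Fin (d+1) → EuclideanSpace ℝ (Fin d)),
        (∀ i, ‖n i‖ = 1 ∧ ∀ x ∈ Fc i, ∀ y ∈ K, ⟪n i, y - x⟫ ≤ 0) →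
      ∀ (τ : Fin (d+1) → ℝ), (∀ i, 0 < τ i) →
      ∀ (q : EuclideanSpace ℝ (Fin d) → EuclideanSpace ℝ (Fin d))
        (u : EuclideanSpace ℝ (Fin d) → ℝ),
        (∀ i, ContDiff ℝ (k+1) fun x => q x i) → ContDiff ℝ (k+1) u →
        -- unique solvability of the projection system
        ((∃ Pq Pu, ProjSys d k K Fc n τ q u Pq Pu) ∧
          (∀ Pq Pu Pq' Pu', ProjSys d k K Fc n τ q u Pq Pu →
            ProjSys d k K Fc n τ q u Pq' Pu' →
            ∀ x ∈ K, Pq x = Pq' x ∧ Pu x = Pu' x)) ∧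
        -- approximation estimates
        (∀ Pq Pu, ProjSys d k K Fc n τ q u Pq Pu →
          ∀ lu lq : ℕ, lu ≤ k → lq ≤ k →
            eLpNorm (fun x => Pu x - u x) 2 (volume.restrict K) ≤
              ENNReal.ofReal (C * Metric.diam K ^ (lu + 1)) *
                sobSemiD (d := d) (lu + 1) 2 K u +
              ENNReal.ofReal (C * Metric.diam K ^ (lq + 1) / sSup (range τ)) *
                sobSemiD (d := d) lq 2 K (pdivD (d := d) q) ∧
            (∀ istar : Fin (d+1), (∀ i, τ i ≤ τ istar) →
              eLpNorm (fun x => Pq x - q x) 2 (volume.restrict K) ≤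
                ENNReal.ofReal (C * Metric.diam K ^ (lq + 1)) *
                  sobSemiD (d := d) (lq + 1) 2 K q +
                ENNReal.ofReal
                  (C * Metric.diam K ^ (lu + 1) * sSup (τ '' {i | i ≠ istar})) *
                  sobSemiD (d := d) (lu + 1) 2 K u)) := by
  obtain ⟨m, rfl⟩ : ∃ m, d = m + 1 := ⟨d - 1, by omega⟩
  obtain ⟨C, hC, H⟩ := HDG.exists_pullback_estimates m k hη
  refine ⟨C, hC, ?_⟩
  rintro vv hvv K hK ⟨z, r, hr, hz, hdiam⟩ Fc hFc n hn τ hτ q u hq hu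
  obtain ⟨B, hB⟩ := HDG.exists_chart hvv
  have hq' : ContDiff ℝ (k + 1) q := contDiff_euclidean.2 hq
  have hKB : K = HDG.chart (vv 0) B '' HDG.simplex (m + 1) :=
    hK.trans (HDG.chart_image_simplex hB).symm
  have hFB : Fc = fun i => HDG.chart (vv 0) B '' HDG.face i :=
    funext fun i => (hFc i).trans (HDG.chart_image_face hB i).symm
  choose ρ hρr hρh hρ using fun i =>
    HDG.exists_normal_eq hB hK hr hz i (hn i).1 (hFc i ▸ (hn i).2)
  have hρ0 : ∀ i, 0 < ρ i := fun i => hr.trans_le (hρr i)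
  have hh : 0 < diam K := (hρ0 0).trans_le (hρh 0)
  have hBn := HDG.norm_chart_le hB hK
  have hBs : ∀ j y, |B.symm y j| ≤ ‖y‖ / r := fun j y => by
    simpa using HDG.abs_dlam_symm_le hB hK hr hz j.succ y
  set h := diam K with hh_def
  clear_value h
  subst hKB hFB
  have ht : ∀ i, 0 < τ i / ρ i := fun i => div_pos (hτ i) (hρ0 i)
  have hqc : ∀ j, ContDiff ℝ (k + 1) fun x => B.symm (q (HDG.chart (vv 0) B x)) j := fun j =>
    (contDiff_apply ℝ ℝ j).comp (B.symm.contDiff.comp (HDG.contDiff_comp_chart hq'))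
  have huc : ContDiff ℝ (k + 1) fun x => u (HDG.chart (vv 0) B x) := HDG.contDiff_comp_chart hu
  refine ⟨⟨?_, ?_⟩, ?_⟩
  · obtain ⟨Pq, Pu, hP⟩ := HDG.exists_refProj (k := k) ht
      (fun j => (hqc j).of_le (by simp)) (huc.of_le (by simp))
    exact ⟨fun y => B fun j => Pq j ((HDG.chart (vv 0) B).symm y),
      fun y => Pu ((HDG.chart (vv 0) B).symm y),
      (HDG.projSys_iff_refProj hρ0 hρ hq'.continuous hP.polyq hP.polyu
        (fun x _ => by simp only [Homeomorph.symm_apply_apply])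
        (fun x _ => by simp only [Homeomorph.symm_apply_apply])).2 hP⟩
  · rintro Pq Pu Pq' Pu' hP hP' _ ⟨x, hx, rfl⟩
    obtain ⟨Qq, Qu, hQ, hQq, hQu⟩ := HDG.exists_refProj_of_projSys hρ0 hρ hq'.continuous hP
    obtain ⟨Qq', Qu', hQ', hQq', hQu'⟩ := HDG.exists_refProj_of_projSys hρ0 hρ hq'.continuous hP'
    obtain ⟨h1, h2⟩ := HDG.RefProj.unique ht (fun j => (hqc j).continuous) huc.continuous hQ hQ'
    rw [hQq x hx, hQq' x hx, hQu x hx, hQu' x hx, h2]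
    simp only [h1, and_self]
  · intro Pq Pu hP lu lq hlu hlq
    obtain ⟨Qq, Qu, hQ, hQq, hQu⟩ := HDG.exists_refProj_of_projSys hρ0 hρ hq'.continuous hP
    obtain ⟨h1, h2⟩ := H (vv 0) B h r hr hh hdiam hBn hBs ρ τ hρr hρh hτ q u hq' hu Qq Qu hQ lu lq
      hlu hlq
    obtain ⟨c, hc⟩ := HDG.exists_eLpNorm_chart_image (vv 0) B
    have hnorm : ∀ {F : Type} [NormedAddCommGroup F] [NormedSpace ℝ F] (l : ℕ)
        (v : EuclideanSpace ℝ (Fin (m + 1)) → F), ContDiff ℝ l v →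
        sobSemiD l 2 (HDG.chart (vv 0) B '' HDG.simplex (m + 1)) v =
          c * ENNReal.ofReal (HDG.pullNorm (vv 0) B l v) := fun l v hv =>
      hc _ _ (HDG.continuous_norm_iteratedFDeriv_chart hv) fun _ _ => rfl
    have hq1 : ContDiff ℝ (lq + 1 : ℕ) q :=
      hq'.of_le (by exact_mod_cast Nat.succ_le_succ hlq)
    rw [hnorm (lu + 1) u (hu.of_le (by exact_mod_cast Nat.succ_le_succ hlu)),
      hnorm (lq + 1) q hq1, hnorm lq _ (HDG.contDiff_pdivD (by exact_mod_cast hq1))]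
    constructor
    · obtain ⟨j, hj⟩ := Finite.exists_max τ
      have hmax : sSup (range τ) = τ j :=
        IsGreatest.csSup_eq ⟨mem_range_self j, by rintro _ ⟨i, rfl⟩; exact hj i⟩
      have hτj := hτ j
      rw [hmax, hc _ (fun x => Qu x - u (HDG.chart (vv 0) B x))
        (hQ.polyu.continuous.sub huc.continuous) fun x hx => by rw [hQu x hx]]
      exact HDG.mul_ofReal_le_add c (by positivity) (by positivity) HDG.l2_nonneg HDG.l2_nonneg
        (h1 j)
    · intro a _
      have hs : ∀ i ≠ a, τ i ≤ sSup (τ '' {i | i ≠ a}) := fun i hi =>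
        le_csSup ((toFinite _).bddAbove) (mem_image_of_mem _ hi)
      obtain ⟨i₀, hi₀⟩ := exists_ne a
      have hs0 := (hτ i₀).le.trans (hs i₀ hi₀)
      rw [← eLpNorm_norm, hc _ (fun x => ‖B fun j => Qq j x -
          B.symm (q (HDG.chart (vv 0) B x)) j‖) (B.continuous.comp (continuous_pi fun j =>
            (hQ.polyq j).continuous.sub (hqc j).continuous)).norm fun x hx => by
        rw [hQq x hx]
        conv_lhs => rw [← B.apply_symm_apply (q _), ← map_sub]
        rfl]
      exact HDG.mul_ofReal_le_add c (by positivity) (by positivity) HDG.l2_nonneg HDG.l2_nonneg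
        (h2 a _ hs)
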